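/- arXiv:2311.12231 — 3 statements merged into one kernel-verified Lean document; each statement's English description precedes it below -/
import Mathlib

section
/- Let V be a 3-dimensional real vector space, B ⊂ V a convex body with 0 in its interior, and 𝒰 ⊂ Gr₂ V a nonempty connected open set such that for every X ∈ 𝒰 there exists a (necessarily unique) line φ(X) ∈ Gr₁ V with B ⊂ (B ∩ X) + φ(X). If the map φ : 𝒰 → Gr₁ V is injective, then B ∩ X is a 0-centered ellipse for every X ∈ 𝒰. -/
open Module Set Pointwise

/-- The Grassmannian of `k`-dimensional linear subspaces of `V`. -/
abbrev Gr (k : ℕ) (V : Type*) [AddCommGroup V] [Module ℝ V] :=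
  {X : Submodule ℝ V // Module.finrank ℝ X = k}

/-- The standard (quotient) topology on the Grassmannian, coinduced from the space of
linearly independent `k`-tuples of vectors. -/
noncomputable instance grTop (k : ℕ) (V : Type*) [AddCommGroup V] [Module ℝ V]
    [TopologicalSpace V] : TopologicalSpace (Gr k V) :=
  TopologicalSpace.coinduced
    (fun v : {v : Fin k → V // LinearIndependent ℝ v} =>
      (⟨Submodule.span ℝ (Set.range v.1), by
          rw [finrank_span_eq_card v.2, Fintype.card_fin]⟩ : Gr k V))
    inferInstance

/-- A convex body: a compact convex set with nonempty interior. -/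
def IsConvexBody {V : Type*} [AddCommGroup V] [Module ℝ V] [TopologicalSpace V]
    (B : Set V) : Prop :=
  IsCompact B ∧ Convex ℝ B ∧ (interior B).Nonempty

/-- `C` is a `k`-cylinder with base `K` lying in the `k`-dimensional subspace `X`:
`K` is a `k`-dimensional convex body in `X` and `C = K + Y` for some complement `Y` of `X`. -/
def IsCylinderWithBase {V : Type*} [AddCommGroup V] [Module ℝ V] [TopologicalSpace V]
    (k : ℕ) (C K : Set V) (X : Submodule ℝ V) : Prop :=
  Module.finrank ℝ X = k ∧ K ⊆ (X : Set V) ∧ IsCompact K ∧ Convex ℝ K ∧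
    (interior ((↑) ⁻¹' K : Set X)).Nonempty ∧
    ∃ Y : Submodule ℝ V, IsCompl X Y ∧ C = K + (Y : Set V)

/-- `C` is a `k`-cylinder. -/
def IsCylinder {V : Type*} [AddCommGroup V] [Module ℝ V] [TopologicalSpace V]
    (k : ℕ) (C : Set V) : Prop :=
  ∃ (K : Set V) (X : Submodule ℝ V), IsCylinderWithBase k C K X

/-- Two sets coincide near a subspace `X`. -/
def CoincideNear {V : Type*} [AddCommGroup V] [Module ℝ V] [TopologicalSpace V]
    (B₁ B₂ : Set V) (X : Submodule ℝ V) : Prop :=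
  ∃ U : Set V, IsOpen U ∧ (X : Set V) ⊆ U ∧ B₁ ∩ U = B₂ ∩ U

/-- `B` is locally cylindrical near `X`. -/
def IsLocallyCylindricalNear {V : Type*} [AddCommGroup V] [Module ℝ V] [TopologicalSpace V]
    (k : ℕ) (B : Set V) (X : Submodule ℝ V) : Prop :=
  ∃ C : Set V, IsCylinder k C ∧ CoincideNear B C X

/-- A Minkowski seminorm: nonnegative, positively 1-homogeneous and subadditive. -/
def IsMinkowskiSeminorm {V : Type*} [AddCommGroup V] [Module ℝ V] (Φ : V → ℝ) : Prop :=
  (∀ v, 0 ≤ Φ v) ∧ (∀ (c : ℝ) (v : V), 0 ≤ c → Φ (c • v) = c * Φ v) ∧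
    ∀ v w, Φ (v + w) ≤ Φ v + Φ w

/-- A Minkowski norm: a Minkowski seminorm positive outside the origin. -/
def IsMinkowskiNorm {V : Type*} [AddCommGroup V] [Module ℝ V] (Φ : V → ℝ) : Prop :=
  IsMinkowskiSeminorm Φ ∧ ∀ v : V, v ≠ 0 → 0 < Φ v

/-- `X` is `Φ`-contracting with contracting direction `Y`. -/
def IsContractingWithDirection {V : Type*} [AddCommGroup V] [Module ℝ V]
    (Φ : V → ℝ) (X Y : Submodule ℝ V) : Prop :=
  ∃ h : IsCompl X Y, ∀ v : V, Φ (X.linearProjOfIsCompl Y h v : V) ≤ Φ v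

/-- `X` is `Φ`-contracting: there is a linear projector of `V` onto `X`
that does not increase `Φ`. -/
def IsContracting {V : Type*} [AddCommGroup V] [Module ℝ V]
    (Φ : V → ℝ) (X : Submodule ℝ V) : Prop :=
  ∃ P : V →ₗ[ℝ] V, P ∘ₗ P = P ∧ LinearMap.range P = X ∧ ∀ v, Φ (P v) ≤ Φ v

/-- `K` is a 0-centered ellipsoid in the subspace `X`: the unit ball of an
inner product norm on `X`. -/
def IsEllipsoidIn {V : Type*} [AddCommGroup V] [Module ℝ V]
    (X : Submodule ℝ V) (K : Set V) : Prop :=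
  ∃ Q : QuadraticForm ℝ X, Q.PosDef ∧ K = (↑) '' {x : X | Q x ≤ 1}

section
set_option linter.unusedVariables false
set_option linter.unusedSectionVars false
set_option linter.unusedSimpArgs false
variable {E : Type*} [NormedAddCommGroup E] [NormedSpace ℝ E]

structure Subl (Φ : E → ℝ) (L : ℝ) : Prop where
  hom : ∀ (r : ℝ) v, 0 ≤ r → Φ (r • v) = r * Φ v
  sub : ∀ v w, Φ (v + w) ≤ Φ v + Φ w
  up : ∀ v, Φ v ≤ L * ‖v‖

namespace Subl
variable {Φ : E → ℝ} {L : ℝ} 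

theorem diff_le (h : Subl Φ L) (v w : E) : Φ v - Φ w ≤ L * ‖v - w‖ := by
  have := h.sub (v - w) w
  have := h.up (v - w)
  simp at *
  linarith

theorem lip (h : Subl Φ L) : LipschitzWith L.toNNReal Φ := by
  refine LipschitzWith.of_le_add_mul _ fun v w => ?_
  have h1 := h.diff_le v w
  rw [dist_eq_norm]
  have : L ≤ (L.toNNReal : ℝ) := Real.le_coe_toNNReal L
  nlinarith [norm_nonneg (v - w)]

theorem dense [FiniteDimensional ℝ E] (h : Subl Φ L) : Dense {p | DifferentiableAt ℝ Φ p} := by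
  let _ : MeasurableSpace E := borel E
  have : BorelSpace E := ⟨rfl⟩
  exact MeasureTheory.Measure.dense_of_ae (μ := MeasureTheory.Measure.addHaar)
    h.lip.ae_differentiableAt

theorem zero (h : Subl Φ L) : Φ 0 = 0 := by
  simpa using h.hom 0 0 le_rfl

/-- derivative along a line of a differentiable function -/
theorem hasDeriv_line {p v : E} (hd : DifferentiableAt ℝ Φ p) :
    HasDerivAt (fun t : ℝ => Φ (p + t • v)) (fderiv ℝ Φ p v) 0 := by
  have h1 : HasDerivAt (fun t : ℝ => p + t • v) v 0 := by
    simpa using ((hasDerivAt_id (0 : ℝ)).smul_const v).const_add p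
  have h2 : HasFDerivAt Φ (fderiv ℝ Φ p) (p + (0 : ℝ) • v) := by simpa using hd.hasFDerivAt
  exact h2.comp_hasDerivAt 0 h1

/-- if `f` supports at `p` then `f` is the derivative -/
theorem unique (h : Subl Φ L) {p : E} (hd : DifferentiableAt ℝ Φ p) (f : E →ₗ[ℝ] ℝ)
    (hf : ∀ v, f v ≤ Φ v) (hp : f p = Φ p) (v : E) : f v = fderiv ℝ Φ p v := by
  have h1 := hasDeriv_line (v := v) hd
  have h2 : HasDerivAt (fun t : ℝ => Φ (p + t • v) - t * f v) (fderiv ℝ Φ p v - f v) 0 := by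
    simpa using h1.fun_sub ((hasDerivAt_id (0 : ℝ)).mul_const (f v))
  have h3 : IsLocalMin (fun t : ℝ => Φ (p + t • v) - t * f v) 0 := by
    refine Filter.Eventually.of_forall fun t => ?_
    have := hf (p + t • v)
    simp [hp] at this ⊢
    linarith
  have := h3.hasDerivAt_eq_zero h2
  linarith

theorem fderiv_self (h : Subl Φ L) {p : E} (hd : DifferentiableAt ℝ Φ p) :
    fderiv ℝ Φ p p = Φ p := by
  have h1 := hasDeriv_line (v := p) hd
  have h2 : HasDerivAt (fun t : ℝ => (1 + t) * Φ p) (Φ p) 0 := by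
    simpa using ((hasDerivAt_id (0 : ℝ)).const_add 1).mul_const (Φ p)
  refine h1.unique (h2.congr_of_eventuallyEq ?_)
  have : ∀ᶠ t : ℝ in nhds 0, -1 < t := lt_mem_nhds (by norm_num)
  filter_upwards [this] with t ht
  rw [← h.hom _ _ (by linarith), add_smul, one_smul]

theorem fderiv_le (h : Subl Φ L) {p : E} (hd : DifferentiableAt ℝ Φ p) (v : E) :
    fderiv ℝ Φ p v ≤ Φ v := by
  have h1 := (hasDeriv_line (v := v) hd).tendsto_slope_zero_right
  refine le_of_tendsto h1 ?_
  filter_upwards [self_mem_nhdsWithin] with t ht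
  have ht : 0 < t := ht
  have := h.sub p (t • v)
  rw [h.hom _ _ ht.le] at this
  simp
  rw [inv_mul_le_iff₀ ht]
  linarith

theorem fderiv_eq_zero {p y : E} (hd : DifferentiableAt ℝ Φ p)
    (hy : ∀ t : ℝ, Φ p ≤ Φ (p + t • y)) : fderiv ℝ Φ p y = 0 := by
  have h3 : IsLocalMin (fun t : ℝ => Φ (p + t • y)) 0 :=
    Filter.Eventually.of_forall fun t => by simpa using hy t
  exact h3.hasDerivAt_eq_zero (hasDeriv_line hd)

/-- supporting functionals are bounded -/
theorem abs_le (h : Subl Φ L) (f : E →ₗ[ℝ] ℝ) (hf : ∀ v, f v ≤ Φ v) (v : E) : |f v| ≤ L * ‖v‖ := by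
  rw [_root_.abs_le]
  have h1 := (hf v).trans (h.up v)
  have h2 := (hf (-v)).trans (h.up (-v))
  simp at h2
  constructor <;> linarith
end Subl

section core
variable {V : Type*} [NormedAddCommGroup V] [NormedSpace ℝ V] [FiniteDimensional ℝ V]

structure Setup (Φ : V → ℝ) (L c : ℝ) (W : Set (V →L[ℝ] ℝ)) (y : (V →L[ℝ] ℝ) → V) : Prop where
  dim : finrank ℝ V = 3
  sl : Subl Φ L
  lo : ∀ v, c * ‖v‖ ≤ Φ v
  cpos : 0 < c
  op : IsOpen W
  y1 : ∀ ξ ∈ W, ξ (y ξ) = 1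
  y2 : ∀ ξ ∈ W, ∀ v, Φ (v - ξ v • y ξ) ≤ Φ v
  inj : ∀ ξ ∈ W, ∀ ξ' ∈ W, ∀ a : ℝ, a • y ξ = y ξ' → ∃ b : ℝ, b • ξ = ξ'

variable {Φ : V → ℝ} {L c : ℝ} {W : Set (V →L[ℝ] ℝ)} {y : (V →L[ℝ] ℝ) → V}

theorem Setup.pos (h : Setup Φ L c W y) {v : V} (hv : v ≠ 0) : 0 < Φ v :=
  lt_of_lt_of_le (mul_pos h.cpos (norm_pos_iff.2 hv)) (h.lo v)

theorem Setup.near (h : Setup Φ L c W y) {ξ : V →L[ℝ] ℝ} (hξ : ξ ∈ W) (η : V →L[ℝ] ℝ) :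
    ∃ ε > 0, ∀ t : ℝ, |t| < ε → ξ + t • η ∈ W := by
  have hc : ContinuousAt (fun t : ℝ => ξ + t • η) 0 := by fun_prop
  have := hc.preimage_mem_nhds (t := W) (by simpa using h.op.mem_nhds hξ)
  obtain ⟨ε, hε, hb⟩ := Metric.mem_nhds_iff.1 this
  exact ⟨ε, hε, fun t ht => hb (by simpa using ht)⟩

/-- functionals vanishing on the same two independent vectors are proportional -/
theorem prop_of_ker (hV : finrank ℝ V = 3) {u v : V} (huv : LinearIndependent ℝ ![u, v])
    (f g : V →ₗ[ℝ] ℝ) (hg : g ≠ 0) (fu : f u = 0) (fv : f v = 0) (gu : g u = 0) (gv : g v = 0) :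
    ∃ a : ℝ, f = a • g := by
  have hk : finrank ℝ (LinearMap.ker g) = 2 := by
    have := Module.Dual.finrank_ker_add_one_of_ne_zero (f := g) hg
    omega
  have hs : Submodule.span ℝ (Set.range ![u, v]) = LinearMap.ker g := by
    apply Submodule.eq_of_le_of_finrank_eq
    · rw [Submodule.span_le]
      rintro _ ⟨i, rfl⟩
      fin_cases i <;> simp [gu, gv]
    · rw [finrank_span_eq_card huv, hk]; simp
  have hle : LinearMap.ker g ≤ LinearMap.ker f := by
    rw [← hs, Submodule.span_le]
    rintro _ ⟨i, rfl⟩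
    fin_cases i <;> simp [fu, fv]
  have := mem_span_of_iInf_ker_le_ker (ι := Unit) (L := fun _ => g) (K := f) (by simpa using hle)
  simp [Submodule.mem_span_singleton] at this
  obtain ⟨a, ha⟩ := this
  exact ⟨a, ha.symm⟩

theorem Setup.indep (h : Setup Φ L c W y) {ξ ξ' : V →L[ℝ] ℝ} (hξ : ξ ∈ W) (hξ' : ξ' ∈ W)
    (hn : ∀ b : ℝ, b • ξ ≠ ξ') : LinearIndependent ℝ ![y ξ, y ξ'] := by
  rw [LinearIndependent.pair_iff' (by rintro h0; simpa [h0] using h.y1 ξ hξ)]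
  intro a ha
  obtain ⟨b, hb⟩ := h.inj ξ hξ ξ' hξ' a ha
  exact hn b hb

/-- Uniqueness of the contracting direction -/
theorem Setup.unique (h : Setup Φ L c W y) {ξ : V →L[ℝ] ℝ} (hξ : ξ ∈ W) (z : V)
    (z1 : ξ z = 1) (z2 : ∀ v, Φ (v - ξ v • z) ≤ Φ v) : z = y ξ := by
  by_contra hne
  set w : V := y ξ - z with hw
  have hw0 : w ≠ 0 := fun h0 => hne (sub_eq_zero.1 h0).symm
  have hyξ := h.y1 ξ hξ
  have hwX : ξ w = 0 := by simp [hw, z1, hyξ]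
  let X : Submodule ℝ V := LinearMap.ker (ξ : V →ₗ[ℝ] ℝ)
  let Ψ : X → ℝ := fun x => Φ x
  have hΨ : Subl Ψ L := ⟨fun r v hr => h.sl.hom r v hr, fun v w => h.sl.sub v w,
    fun v => h.sl.up v⟩
  let wX : X := ⟨w, hwX⟩
  -- a point of differentiability near w
  have hopen : IsOpen {p : X | L * ‖wX - p‖ < Ψ p} := by
    apply isOpen_lt
    · fun_prop
    · exact hΨ.lip.continuous
  obtain ⟨p, hpU, hpd⟩ := hΨ.dense.inter_open_nonempty _ hopen ⟨wX, by
    simpa [Ψ, wX] using h.pos hw0⟩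
  have hpU : L * ‖wX - p‖ < Ψ p := hpU
  have hpd : DifferentiableAt ℝ Ψ p := hpd
  set g := fderiv ℝ Ψ p with hg
  have gle := hΨ.fderiv_le hpd
  have gp := hΨ.fderiv_self hpd
  have gw : g wX ≠ 0 := by
    have h1 := hΨ.abs_le (g : X →ₗ[ℝ] ℝ) gle (wX - p)
    intro h0
    rw [ContinuousLinearMap.coe_coe, map_sub, h0, hg, gp, zero_sub, abs_neg] at h1
    have := le_abs_self (Ψ p)
    linarith
  have hp0 : (p : V) ≠ 0 := by
    intro h0
    have : p = 0 := by ext; exact h0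
    subst this
    rw [hΨ.zero] at hpU
    have : 0 ≤ L * ‖wX‖ := (abs_nonneg _).trans (hΨ.abs_le (g : X →ₗ[ℝ] ℝ) gle wX)
    rw [sub_zero] at hpU; linarith
  -- the two lifts
  have key : ∀ z : V, ξ z = 1 → (∀ v, Φ (v - ξ v • z) ≤ Φ v) →
      ∀ ξ' ∈ W, ξ' p = 0 → (∀ b : ℝ, b • ξ ≠ ξ') → ∀ q : X, (q : V) = y ξ' - ξ (y ξ') • z →
        g q = 0 := by
    intro z z1 z2 ξ' hξ' hp' hn q hq
    let Pr : V →ₗ[ℝ] X := LinearMap.codRestrict X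
      (LinearMap.id - (ξ : V →ₗ[ℝ] ℝ).smulRight z) (fun v => by simp [X, z1])
    have hPr : ∀ v, (Pr v : V) = v - ξ v • z := fun v => rfl
    have hPrX : ∀ v : X, Pr v = v := fun v => by
      ext; rw [hPr, show ξ v = 0 from v.2]; simp
    let f : V →ₗ[ℝ] ℝ := (g : X →ₗ[ℝ] ℝ) ∘ₗ Pr
    have hf : ∀ v, f v ≤ Φ v := fun v => by
      refine (gle (Pr v)).trans ?_
      have := z2 v
      rwa [← hPr] at this
    have hfX : ∀ v : X, f v = g v := fun v => by simp [f, hPrX]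
    let f' : X →ₗ[ℝ] ℝ := (f ∘ₗ (LinearMap.id - (ξ' : V →ₗ[ℝ] ℝ).smulRight (y ξ'))) ∘ₗ X.subtype
    have hf' : ∀ v : X, f' v = g v - ξ' v * f (y ξ') := fun v => by simp [f', hfX]
    have h1 := hΨ.unique hpd f' (fun v => by
      have e : f' v = f ((v : V) - ξ' v • y ξ') := by simp [f']
      rw [e]
      exact (hf _).trans (h.y2 ξ' hξ' v)) (by rw [hf', hp', gp]; simp)
    have h2 : ∀ v : X, ξ' v * f (y ξ') = 0 := fun v => by
      have := h1 v
      rw [hf'] at this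
      linarith
    have hfy : f (y ξ') = 0 := by
      by_contra hne
      have h3 : ∀ v : X, ξ' v = 0 := fun v => (mul_eq_zero.1 (h2 v)).resolve_right hne
      apply hn (ξ' z)
      ext v
      have := h3 (Pr v)
      rw [hPr] at this
      simp at this ⊢
      linarith
    have : Pr (y ξ') = q := by ext; rw [hPr, hq]
    rw [← this]
    exact hfy
  have key2 : ∀ ξ' ∈ W, ξ' p = 0 → (∀ b : ℝ, b • ξ ≠ ξ') → 
      ∃ q : X, (q : V) = y ξ' ∧ g q = 0 := by
    intro ξ' hξ' hp' hn
    have a1 := key _ hyξ (h.y2 ξ hξ) ξ' hξ' hp' hn ⟨y ξ' - ξ (y ξ') • y ξ, by simp [X, hyξ]⟩ rfl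
    have a2 := key _ z1 z2 ξ' hξ' hp' hn ⟨y ξ' - ξ (y ξ') • z, by simp [X, z1]⟩ rfl
    have a3 : g (ξ (y ξ') • wX) = 0 := by
      have : ξ (y ξ') • wX = (⟨y ξ' - ξ (y ξ') • z, by simp [X, z1]⟩ : X) -
        ⟨y ξ' - ξ (y ξ') • y ξ, by simp [X, hyξ]⟩ := by
        ext; simp [wX, hw, smul_sub]
      rw [this, map_sub, a1, a2, sub_zero]
    have a4 : ξ (y ξ') = 0 := by simpa [gw] using a3
    refine ⟨⟨y ξ', a4⟩, rfl, ?_⟩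
    convert a1 using 2
    simp [a4]
  -- other planes through p
  obtain ⟨η, hηp, r, hr, hηr⟩ : ∃ η : V →L[ℝ] ℝ, η p = 0 ∧ ∃ r, ξ r = 0 ∧ η r = 1 := by
    have hXd : finrank ℝ X = 2 := by
      have := Module.Dual.finrank_ker_add_one_of_ne_zero (f := (ξ : V →ₗ[ℝ] ℝ))
        (fun h0 => by
          have := congrArg (fun f => f (y ξ)) h0
          simp [hyξ] at this)
      rw [h.dim] at this
      change finrank ℝ X + 1 = 3 at this
      omega
    have : ∃ r : X, (r : V) ∉ Submodule.span ℝ {(p : V)} := by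
      by_contra hcon
      push Not at hcon
      have hle : X ≤ Submodule.span ℝ {(p : V)} := fun r hr => hcon ⟨r, hr⟩
      have := Submodule.finrank_mono hle
      rw [finrank_span_singleton hp0] at this
      omega
    obtain ⟨r, hr⟩ := this
    obtain ⟨f, hf1, hf2⟩ := Submodule.exists_dual_map_eq_bot_of_notMem hr inferInstance
    refine ⟨LinearMap.toContinuousLinearMap ((f r)⁻¹ • f), ?_, r, r.2, ?_⟩
    · have : f p ∈ (Submodule.span ℝ {(p : V)}).map f :=
        Submodule.mem_map_of_mem (Submodule.mem_span_singleton_self _)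
      rw [hf2] at this
      simp at this
      simp [this]
    · simp [hf1]
  obtain ⟨ε, hε, hW⟩ := h.near hξ η
  have hxp : ξ p = 0 := p.2
  have m1 : ξ + (ε / 2) • η ∈ W := hW _ (by rw [abs_of_pos] <;> linarith)
  have m2 : ξ + (ε / 4) • η ∈ W := hW _ (by rw [abs_of_pos] <;> linarith)
  obtain ⟨q1, hq1, gq1⟩ := key2 _ m1 (by simp [hxp, hηp]) (fun b hb => by
    have := congrArg (fun f => f r) hb
    simp [hr, hηr] at this
    linarith)
  obtain ⟨q2, hq2, gq2⟩ := key2 _ m2 (by simp [hxp, hηp]) (fun b hb => by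
    have := congrArg (fun f => f r) hb
    simp [hr, hηr] at this
    linarith)
  have hind := h.indep m1 m2 (fun b hb => by
    have e1 := congrArg (fun f => f r) hb
    have e2 := congrArg (fun f => f (y ξ)) hb
    simp [hr, hηr, hyξ] at e1 e2
    have : b = 1 / 2 := by
      apply mul_right_cancel₀ hε.ne'
      linarith
    subst this
    linarith)
  let G : V →ₗ[ℝ] ℝ := (g : X →ₗ[ℝ] ℝ) ∘ₗ LinearMap.codRestrict X
      (LinearMap.id - (ξ : V →ₗ[ℝ] ℝ).smulRight z) (fun v => by simp [X, z1])
  have hGX : ∀ v : X, G v = g v := fun v => by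
    simp only [G, LinearMap.comp_apply, ContinuousLinearMap.coe_coe]
    congr 1
    apply Subtype.ext
    change (v : V) - ξ v • z = v
    rw [show ξ v = 0 from v.2]
    simp
  obtain ⟨a, ha⟩ := prop_of_ker h.dim hind G (ξ : V →ₗ[ℝ] ℝ) (fun h0 => by
      have := congrArg (fun f => f (y ξ)) h0
      simp [hyξ] at this) (by rw [← hq1, hGX, gq1]) (by rw [← hq2, hGX, gq2])
      (by rw [← hq1]; exact q1.2) (by rw [← hq2]; exact q2.2)
  apply gw
  rw [← hGX, ha]
  simp [wX, hwX]
end core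

end

section core
variable {V : Type*} [NormedAddCommGroup V] [NormedSpace ℝ V] [FiniteDimensional ℝ V]
variable {Φ : V → ℝ} {L c : ℝ} {W : Set (V →L[ℝ] ℝ)} {y : (V →L[ℝ] ℝ) → V}

theorem tendsto_app {ι : Type*} {l : Filter ι} {f : ι → (V →L[ℝ] ℝ)} {v : ι → V}
    {f0 : V →L[ℝ] ℝ} {v0 : V} (hf : Filter.Tendsto f l (nhds f0))
    (hv : Filter.Tendsto v l (nhds v0)) :
    Filter.Tendsto (fun i => f i (v i)) l (nhds (f0 v0)) := by
  have hc : Continuous fun q : (V →L[ℝ] ℝ) × V => q.1 q.2 := by fun_prop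
  exact (hc.tendsto (f0, v0)).comp (hf.prodMk_nhds hv)

theorem Setup.cont (h : Setup Φ L c W y) {ξ : V →L[ℝ] ℝ} (hξ : ξ ∈ W) : ContinuousAt y ξ := by
  have hΦ : Continuous Φ := h.sl.lip.continuous
  have h1 := h.y1 ξ hξ
  -- local bound
  have hb : ∀ᶠ ζ in nhds ξ, y ζ ∈ Metric.closedBall (0 : V) (‖(2:ℝ) • y ξ‖ + Φ ((2:ℝ) • y ξ) / c) := by
    have e1 : ∀ᶠ ζ in nhds ξ, 1 / 2 < (ζ : V →L[ℝ] ℝ) (y ξ) := by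
      have : Continuous fun ζ : V →L[ℝ] ℝ => ζ (y ξ) := by fun_prop
      exact this.continuousAt.eventually (lt_mem_nhds (by
        change 1 / 2 < ξ (y ξ)
        rw [h1]; norm_num))
    filter_upwards [e1, h.op.mem_nhds hξ] with ζ h2 hζ
    have h3 := h.y2 ζ hζ ((ζ (y ξ))⁻¹ • y ξ)
    have hz : ζ (y ξ) ≠ 0 := by linarith
    have hinv : (ζ (y ξ))⁻¹ ≤ 2 := by
      rw [inv_le_comm₀ (by linarith) (by norm_num)]; linarith
    have hinv0 : 0 < (ζ (y ξ))⁻¹ := by rw [inv_pos]; linarith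
    have hne : y ξ ≠ 0 := fun h0 => by simp [h0] at h1
    have hpos := h.pos hne
    rw [map_smul, smul_eq_mul, inv_mul_cancel₀ hz, one_smul, h.sl.hom _ _ hinv0.le] at h3
    have h4 := h.lo ((ζ (y ξ))⁻¹ • y ξ - y ζ)
    have h5 : ‖(ζ (y ξ))⁻¹ • y ξ - y ζ‖ ≤ Φ ((2:ℝ) • y ξ) / c := by
      rw [le_div_iff₀ h.cpos, h.sl.hom _ _ (by norm_num)]
      nlinarith
    have h6 : ‖(ζ (y ξ))⁻¹ • y ξ‖ ≤ ‖(2:ℝ) • y ξ‖ := by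
      rw [norm_smul, norm_smul, Real.norm_of_nonneg hinv0.le, Real.norm_of_nonneg (by norm_num)]
      gcongr
    rw [mem_closedBall_zero_iff]
    have h7 := norm_sub_norm_le (y ζ) ((ζ (y ξ))⁻¹ • y ξ)
    rw [norm_sub_rev] at h7
    linarith
  refine (isCompact_closedBall (0 : V) _).tendsto_nhds_of_unique_mapClusterPt hb ?_
  intro z _ hz
  -- pass to an ultrafilter
  rw [mapClusterPt_iff_ultrafilter] at hz
  obtain ⟨U, hU, hUz⟩ := hz
  have hid : Filter.Tendsto (fun ζ : V →L[ℝ] ℝ => ζ) U (nhds ξ) := hU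
  have hWU : ∀ᶠ ζ in (U : Filter (V →L[ℝ] ℝ)), ζ ∈ W := hU (h.op.mem_nhds hξ)
  have happ : ∀ {v : (V →L[ℝ] ℝ) → V} {v0 : V}, Filter.Tendsto v U (nhds v0) →
      Filter.Tendsto (fun ζ : V →L[ℝ] ℝ => ζ (v ζ)) U (nhds (ξ v0)) := by
    intro v v0 hv
    exact tendsto_app hid hv
  refine h.unique hξ z ?_ ?_
  · refine tendsto_nhds_unique (happ hUz) (tendsto_const_nhds.congr' ?_)
    filter_upwards [hWU] with ζ hζ
    exact (h.y1 ζ hζ).symm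
  · intro v
    have : Filter.Tendsto (fun ζ : V →L[ℝ] ℝ => Φ (v - ζ v • y ζ)) U (nhds (Φ (v - ξ v • z))) :=
      (hΦ.tendsto _).comp (tendsto_const_nhds.sub ((happ tendsto_const_nhds).smul hUz))
    refine le_of_tendsto this ?_
    filter_upwards [hWU] with ζ hζ
    exact h.y2 ζ hζ v

/-- the collineation property -/
theorem Setup.support (h : Setup Φ L c W y) {p : V} (hp : p ≠ 0) :
    ∃ f : V →L[ℝ] ℝ, (∀ v, f v ≤ Φ v) ∧ f p = Φ p ∧ ∀ ξ ∈ W, ξ p = 0 → f (y ξ) = 0 := by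
  have hΦ : Continuous Φ := h.sl.lip.continuous
  have hcl : p ∈ closure {p | DifferentiableAt ℝ Φ p} := h.sl.dense p
  rw [mem_closure_iff_seq_limit] at hcl
  obtain ⟨q, hq, hqp⟩ := hcl
  have hL : 0 ≤ L := by
    have h1 := h.lo p
    have h2 := h.sl.up p
    have := norm_pos_iff.2 hp
    have := h.cpos
    by_contra hL
    nlinarith
  have hbd : ∀ n, fderiv ℝ Φ (q n) ∈ Metric.closedBall (0 : V →L[ℝ] ℝ) L := fun n => by
    rw [mem_closedBall_zero_iff]
    refine ContinuousLinearMap.opNorm_le_bound _ hL fun v => ?_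
    exact h.sl.abs_le (fderiv ℝ Φ (q n) : V →ₗ[ℝ] ℝ) (h.sl.fderiv_le (hq n)) v
  obtain ⟨f, -, k, hk, hf⟩ := (isCompact_closedBall (0 : V →L[ℝ] ℝ) L).tendsto_subseq hbd
  have hqk : Filter.Tendsto (fun n => q (k n)) Filter.atTop (nhds p) := hqp.comp hk.tendsto_atTop
  have hf : Filter.Tendsto (fun n => fderiv ℝ Φ (q (k n))) Filter.atTop (nhds f) := hf
  refine ⟨f, fun v => ?_, ?_, ?_⟩
  · refine le_of_tendsto (tendsto_app hf tendsto_const_nhds) ?_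
    exact Filter.Eventually.of_forall fun n => h.sl.fderiv_le (hq _) v
  · refine tendsto_nhds_unique (tendsto_app hf hqk) ?_
    refine ((hΦ.tendsto _).comp hqk).congr fun n => ?_
    exact (h.sl.fderiv_self (hq _)).symm
  · intro ξ hξ hξp
    obtain ⟨η, hη⟩ : ∃ η : V →L[ℝ] ℝ, η p = 1 := by
      obtain ⟨f, hf⟩ := SeparatingDual.exists_eq_one (R := ℝ) hp
      exact ⟨f, hf⟩
    let ζ : ℕ → (V →L[ℝ] ℝ) := fun n => ξ - (ξ (q (k n)) / η (q (k n))) • η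
    have hζ : Filter.Tendsto ζ Filter.atTop (nhds ξ) := by
      have a1 := (ξ.continuous.tendsto p).comp hqk
      have a2 := (η.continuous.tendsto p).comp hqk
      have a3 := (a1.div a2 (by rw [hη]; norm_num)).smul_const η
      have a4 := (tendsto_const_nhds (x := ξ)).sub a3
      simpa [hξp] using a4
    have hη0 : ∀ᶠ n in Filter.atTop, 0 < η (q (k n)) := by
      have a2 := (η.continuous.tendsto p).comp hqk
      exact a2.eventually (lt_mem_nhds (by rw [hη]; norm_num))
    refine tendsto_nhds_unique (tendsto_app hf ((h.cont hξ).tendsto.comp hζ))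
      (tendsto_const_nhds.congr' ?_)
    filter_upwards [hη0, hζ (h.op.mem_nhds hξ)] with n hn hW
    have hz : ζ n (q (k n)) = 0 := by
      simp [ζ, hn.ne']
    refine (Subl.fderiv_eq_zero (hq _) fun t => ?_).symm
    have := h.y2 _ hW (q (k n) + t • y (ζ n))
    have e : (ζ n) (q (k n) + t • y (ζ n)) = t := by simp [hz, h.y1 _ hW]
    rw [e] at this
    simpa using this

theorem Setup.factA (h : Setup Φ L c W y) {p : V} (hp : p ≠ 0) (g : V →ₗ[ℝ] ℝ) (hg : g ≠ 0)
    {ξ ξ' : V →L[ℝ] ℝ} (hξ : ξ ∈ W) (hξ' : ξ' ∈ W)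
    (hn : ∀ b : ℝ, b • ξ ≠ ξ') (h1 : ξ p = 0) (h2 : ξ' p = 0)
    (g1 : g (y ξ) = 0) (g2 : g (y ξ') = 0) :
    g p ≠ 0 ∧ ∀ ζ ∈ W, ζ p = 0 → g (y ζ) = 0 := by
  obtain ⟨f, f1, f2, f3⟩ := h.support hp
  have hpos := h.pos hp
  obtain ⟨a, ha⟩ := prop_of_ker h.dim (h.indep hξ hξ' hn) (f : V →ₗ[ℝ] ℝ) g hg
    (f3 _ hξ h1) (f3 _ hξ' h2) g1 g2
  have hfa : ∀ v, f v = a * g v := fun v => by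
    have := congrArg (fun f => f v) ha
    simpa using this
  have hgp : g p ≠ 0 := fun h0 => by
    rw [hfa, h0] at f2; linarith
  have ha0 : a ≠ 0 := fun h0 => by
    rw [hfa, h0] at f2; linarith
  refine ⟨hgp, fun ζ hζ hζp => ?_⟩
  have := f3 ζ hζ hζp
  rw [hfa] at this
  exact (mul_eq_zero.1 this).resolve_left ha0

theorem Setup.nondeg (h : Setup Φ L c W y) {ξ0 ξ1 ξ2 : V →L[ℝ] ℝ} (m0 : ξ0 ∈ W) (m1 : ξ1 ∈ W)
    (m2 : ξ2 ∈ W) {e0 e1 e2 : V} (h00 : ξ0 e0 = 1) (h01 : ξ0 e1 = 0) (h02 : ξ0 e2 = 0)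
    (h10 : ξ1 e0 = 0) (h11 : ξ1 e1 = 1) (h12 : ξ1 e2 = 0)
    (h20 : ξ2 e0 = 0) (h21 : ξ2 e1 = 0) (h22 : ξ2 e2 = 1)
    (g : V →ₗ[ℝ] ℝ) (hg : g ≠ 0) (g0 : g (y ξ0) = 0) (g1 : g (y ξ1) = 0) (g2 : g (y ξ2) = 0) :
    False := by
  have e1ne : e1 ≠ 0 := fun h0 => by simp [h0] at h11
  have e2ne : e2 ≠ 0 := fun h0 => by simp [h0] at h22
  obtain ⟨ge2, A2⟩ := h.factA e2ne g hg m0 m1 (fun b hb => by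
    have := congrArg (fun f => f e1) hb
    simp [h01, h11] at this) h02 h12 g0 g1
  obtain ⟨ge1, A1⟩ := h.factA e1ne g hg m0 m2 (fun b hb => by
    have := congrArg (fun f => f e2) hb
    simp [h02, h22] at this) h01 h21 g0 g2
  -- x = g e2 • e1 - g e1 • e2
  obtain ⟨ε, hε, hW⟩ := h.near m0 (g e1 • ξ1 + g e2 • ξ2)
  obtain ⟨ε', hε', hW'⟩ := h.near m0 (g e2 • ξ2)
  obtain ⟨t, ht0, ht, ht'⟩ : ∃ t : ℝ, 0 < t ∧ |t| < ε ∧ |t| < ε' := by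
    refine ⟨min ε ε' / 2, by positivity, ?_, ?_⟩ <;> rw [abs_of_pos (by positivity)]
    · have := min_le_left ε ε'; have : 0 < min ε ε' := by positivity
      linarith
    · have := min_le_right ε ε'; have : 0 < min ε ε' := by positivity
      linarith
  have k1 := hW t ht
  have k2 := hW' t ht'
  have b1 := A1 _ k2 (by simp [h01, h21])
  have b2 : g (y (ξ0 + t • (g e1 • ξ1 + g e2 • ξ2))) = 0 := by
    have pne : e2 - (t * g e2) • e0 ≠ 0 := fun h0 => by
      have := congrArg ξ2 h0
      simp [h22, h20] at this
    refine (h.factA pne g hg m1 k2 (fun b hb => ?_) ?_ ?_ g1 b1).2 _ k1 ?_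
    · have := congrArg (fun f => f e0) hb
      simp [h00, h10, h20] at this
    · simp [h12, h10]
    · simp [h02, h22, h00, h20]
    · simp [h02, h22, h00, h20, h12, h10]
  have xne : g e2 • e1 - g e1 • e2 ≠ 0 := fun h0 => by
    have := congrArg ξ1 h0
    simp [h11, h12] at this
    exact ge2 this
  refine (h.factA xne g hg m0 k1 (fun b hb => ?_) ?_ ?_ g0 b2).1 ?_
  · have := congrArg (fun f => f e1) hb
    simp [h01, h11, h21] at this
    exact (this.elim (fun h => ht0.ne h.symm) ge1)
  · simp [h01, h02]
  · simp [h01, h02, h11, h12, h21, h22]; ring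
  · simp; ring
end core

set_option linter.unusedSectionVars false

theorem oneDim {α : ℝ → ℝ} {ε : ℝ} (hε : 0 < ε) (hc : ContinuousOn α (Ioo (-ε) ε))
    (hi : InjOn α (Ioo (-ε) ε))
    (hf : ∀ m : ℝ, |m| < ε → ∃ A B : ℝ, A ≠ 0 ∧ ∀ s : ℝ, |s| < ε → |s + m| < ε →
      α (s + m) = A * α s + B) : ∃ d : ℝ, d ≠ 0 ∧ HasDerivAt α d 0 := by
  have hnh : ∀ s ∈ Ioo (-ε) ε, Ioo (-ε) ε ∈ nhds s := fun s hs => isOpen_Ioo.mem_nhds hs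
  have hex : ∃ s ∈ Ioo (-ε) ε, DifferentiableAt ℝ α s := by
    have hae : ∀ᵐ x, x ∈ Ioo (-ε) ε → DifferentiableWithinAt ℝ α (Ioo (-ε) ε) x := by
      rcases ContinuousOn.strictMonoOn_of_injOn_Ioo (by linarith) hc hi with h | h
      · exact h.monotoneOn.ae_differentiableWithinAt_of_mem
      · have h2 : MonotoneOn (fun x => - α x) (Ioo (-ε) ε) := h.antitoneOn.neg
        filter_upwards [h2.ae_differentiableWithinAt_of_mem] with x hx hxm
        simpa using (hx hxm).fun_neg
    have hd := MeasureTheory.Measure.dense_of_ae hae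
    obtain ⟨s, hs, hs'⟩ := hd.inter_open_nonempty _ (isOpen_Ioo (a := -ε) (b := ε))
      ⟨0, by constructor <;> linarith⟩
    exact ⟨s, hs, (hs' hs).differentiableAt (hnh s hs)⟩
  obtain ⟨s0, hs0, hd0⟩ := hex
  have hd : DifferentiableAt ℝ α 0 := by
    obtain ⟨A, B, hA, hAB⟩ := hf s0 (abs_lt.2 hs0)
    have h1 : DifferentiableAt ℝ (fun s => (α (s + s0) - B) / A) 0 := by
      have : DifferentiableAt ℝ (fun s => α (s + s0)) 0 := by
        apply DifferentiableAt.comp (g := α) (f := fun s : ℝ => s + s0)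
        · simpa using hd0
        · fun_prop
      exact (this.sub_const B).div_const A
    refine h1.congr_of_eventuallyEq ?_
    have c1 : ∀ᶠ s : ℝ in nhds 0, s ∈ Ioo (-ε) ε := hnh 0 (by constructor <;> linarith)
    have c2 : ∀ᶠ s : ℝ in nhds 0, s + s0 ∈ Ioo (-ε) ε := by
      have : ContinuousAt (fun s : ℝ => s + s0) 0 := by fun_prop
      exact this.preimage_mem_nhds (by simpa using hnh s0 hs0)
    filter_upwards [c1, c2] with s k1 k2
    rw [hAB s (abs_lt.2 k1) (abs_lt.2 k2)]
    field_simp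
    ring
  refine ⟨deriv α 0, fun h0 => ?_, hd.hasDerivAt⟩
  have hD : ∀ m ∈ Ioo (-ε) ε, HasDerivAt α 0 m := by
    intro m hm
    obtain ⟨A, B, hA, hAB⟩ := hf m (abs_lt.2 hm)
    have h1 : HasDerivAt (fun s => A * α (s - m) + B) 0 m := by
      have e : HasDerivAt α 0 (m - m) := by
        have := hd.hasDerivAt
        rw [h0] at this
        simpa using this
      have := e.comp_sub_const m m
      simpa using (this.const_mul A).add_const B
    refine h1.congr_of_eventuallyEq ?_
    have c1 : ∀ᶠ s : ℝ in nhds m, s ∈ Ioo (-ε) ε := hnh m hm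
    have c2 : ∀ᶠ s : ℝ in nhds m, s - m ∈ Ioo (-ε) ε := by
      have : ContinuousAt (fun s : ℝ => s - m) m := by fun_prop
      exact this.preimage_mem_nhds (by simpa using hnh 0 (by constructor <;> linarith))
    filter_upwards [c1, c2] with s k1 k2
    have := hAB (s - m) (abs_lt.2 k2) (by simpa using abs_lt.2 k1)
    simpa using this
  have z0 : (0 : ℝ) ∈ Ioo (-ε) ε := by constructor <;> linarith
  have z1 : ε / 2 ∈ Ioo (-ε) ε := by constructor <;> linarith
  have heq : α 0 = α (ε / 2) := by
    refine (convex_Ioo (-ε) ε).is_const_of_fderivWithin_eq_zero (𝕜 := ℝ) (f := α) ?_ ?_ z0 z1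
    · exact fun m hm => (hD m hm).differentiableAt.differentiableWithinAt
    · intro m hm
      rw [fderivWithin_of_isOpen isOpen_Ioo hm]
      ext
      simpa using (hD m hm).deriv
  have := hi z0 z1 heq
  linarith

section core
variable {V : Type*} [NormedAddCommGroup V] [NormedSpace ℝ V] [FiniteDimensional ℝ V]
variable {Φ : V → ℝ} {L c : ℝ} {W : Set (V →L[ℝ] ℝ)} {y : (V →L[ℝ] ℝ) → V}

theorem Setup.frame (h : Setup Φ L c W y) {ξ0 : V →L[ℝ] ℝ} (m0 : ξ0 ∈ W) :
    ∃ ξ1 ∈ W, ∃ ξ2 ∈ W, ∃ e0 e1 e2 : V, 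
    (ξ0 e0 = 1 ∧ ξ0 e1 = 0 ∧ ξ0 e2 = 0) ∧ (ξ1 e0 = 0 ∧ ξ1 e1 = 1 ∧ ξ1 e2 = 0) ∧
    (ξ2 e0 = 0 ∧ ξ2 e1 = 0 ∧ ξ2 e2 = 1) := by
  have hy := h.y1 _ m0
  have hXd : finrank ℝ (LinearMap.ker (ξ0 : V →ₗ[ℝ] ℝ)) = 2 := by
    have := Module.Dual.finrank_ker_add_one_of_ne_zero (f := (ξ0 : V →ₗ[ℝ] ℝ))
      (fun h0 => by
        have := congrArg (fun f => f (y ξ0)) h0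
        simp [hy] at this)
    rw [h.dim] at this
    omega
  let bX := finBasisOfFinrankEq ℝ (LinearMap.ker (ξ0 : V →ₗ[ℝ] ℝ)) hXd
  let b : Basis (Fin 3) ℝ V := Basis.mkFinCons (y ξ0) bX
    (fun a x hx h0 => by
      have hx : ξ0 x = 0 := hx
      have := congrArg ξ0 h0
      simpa [hx, hy] using this)
    (fun z => ⟨-ξ0 z, by simp [hy]⟩)
  have b0 : b 0 = y ξ0 := by simp [b]
  have b1 : ξ0 (b 1) = 0 := by
    have : b 1 = bX 0 := by
      simp only [b, Basis.coe_mkFinCons]; rfl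
    rw [this]; exact (bX 0).2
  have b2 : ξ0 (b 2) = 0 := by
    have : b 2 = bX 1 := by
      simp only [b, Basis.coe_mkFinCons]; rfl
    rw [this]; exact (bX 1).2
  rw [← b0] at hy
  let η1 : V →L[ℝ] ℝ := LinearMap.toContinuousLinearMap (b.coord 1)
  let η2 : V →L[ℝ] ℝ := LinearMap.toContinuousLinearMap (b.coord 2)
  obtain ⟨δ1, hδ1, H1⟩ := h.near m0 η1
  obtain ⟨δ2, hδ2, H2⟩ := h.near m0 η2
  have k1 := H1 (δ1 / 2) (by rw [abs_of_pos] <;> linarith)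
  have k2 := H2 (δ2 / 2) (by rw [abs_of_pos] <;> linarith)
  refine ⟨_, k1, _, k2, b 0 - (δ1 / 2)⁻¹ • b 1 - (δ2 / 2)⁻¹ • b 2, (δ1 / 2)⁻¹ • b 1,
    (δ2 / 2)⁻¹ • b 2, ?_, ?_, ?_⟩ <;> 
    simp [hy, b1, b2, η1, η2] <;> field_simp <;>
    simp [hδ1.ne', hδ2.ne']

theorem Setup.coords (hV : finrank ℝ V = 3) (w : Fin 3 → V) 
    (hw : ∀ g : V →ₗ[ℝ] ℝ, g ≠ 0 → g (w 0) = 0 → g (w 1) = 0 → g (w 2) = 0 → False) :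
    ∃ ω : Fin 3 → (V →L[ℝ] ℝ), (∀ v, v = ω 0 v • w 0 + ω 1 v • w 1 + ω 2 v • w 2) ∧
      ∀ i j, ω i (w j) = if i = j then 1 else 0 := by
  have hsp : Submodule.span ℝ (Set.range w) = ⊤ := by
    by_contra hne
    obtain ⟨g, hg, hle⟩ := Submodule.exists_le_ker_of_lt_top _ (lt_top_iff_ne_top.2 hne)
    have : ∀ i, g (w i) = 0 := fun i => hle (Submodule.subset_span ⟨i, rfl⟩)
    exact hw g hg (this 0) (this 1) (this 2)
  have hli : LinearIndependent ℝ w := 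
    linearIndependent_of_top_le_span_of_card_eq_finrank hsp.ge (by simp [hV])
  let b := Basis.mk hli hsp.ge
  have hb : ∀ i, b i = w i := fun i => by simp [b]
  refine ⟨fun i => LinearMap.toContinuousLinearMap (b.coord i), fun v => ?_, fun i j => ?_⟩
  · have := b.sum_repr v
    rw [Fin.sum_univ_three] at this
    simp only [hb] at this
    exact this.symm
  · rw [← hb]
    simp [Finsupp.single_apply, eq_comm]
end core

set_option linter.unusedSectionVars false
set_option linter.unusedSimpArgs false
section core
variable {V : Type*} [NormedAddCommGroup V] [NormedSpace ℝ V] [FiniteDimensional ℝ V]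
variable {Φ : V → ℝ} {L c : ℝ} {W : Set (V →L[ℝ] ℝ)} {y : (V →L[ℝ] ℝ) → V}

theorem Setup.derivation (h : Setup Φ L c W y) {ξ0 : V →L[ℝ] ℝ} (m0 : ξ0 ∈ W) :
    ∃ C : V →L[ℝ] V, (∀ x, ξ0 (C x) = 0) ∧ (∃ x, ξ0 x = 0 ∧ C x ≠ 0) ∧
      ∀ x, x ≠ 0 → ξ0 x = 0 → ∃ f : V →L[ℝ] ℝ, (∀ v, f v ≤ Φ v) ∧ f x = Φ x ∧ f (C x) = 0 := by
  obtain ⟨ξ1, m1, ξ2, m2, e0, e1, e2, ⟨h00, h01, h02⟩, ⟨h10, h11, h12⟩, ⟨h20, h21, h22⟩⟩ :=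
    h.frame m0
  obtain ⟨ω, hω, hωw⟩ := Setup.coords h.dim ![y ξ0, y ξ1, y ξ2] (fun g hg g0 g1 g2 =>
    h.nondeg m0 m1 m2 h00 h01 h02 h10 h11 h12 h20 h21 h22 g hg g0 g1 g2)
  set w0 := y ξ0 with hw0
  set w1 := y ξ1 with hw1
  set w2 := y ξ2 with hw2
  have hω : ∀ v, v = ω 0 v • w0 + ω 1 v • w1 + ω 2 v • w2 := hω
  have o00 : ω 0 w0 = 1 := by simpa using hωw 0 0
  have o10 : ω 1 w0 = 0 := by simpa using hωw 1 0
  have o20 : ω 2 w0 = 0 := by simpa using hωw 2 0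
  have o22 : ω 2 w2 = 1 := by simpa using hωw 2 2
  have o01 : ω 0 w1 = 0 := by simpa using hωw 0 1
  have o02 : ω 0 w2 = 0 := by simpa using hωw 0 2
  obtain ⟨ε, hε, hW⟩ : ∃ ε > 0, ∀ s t : ℝ, |s| < ε → |t| < ε → ξ0 + s • ξ1 + t • ξ2 ∈ W := by
    have hc : ContinuousAt (fun q : ℝ × ℝ => ξ0 + q.1 • ξ1 + q.2 • ξ2) (0, 0) := by fun_prop
    have := hc.preimage_mem_nhds (t := W) (by simpa using h.op.mem_nhds m0)
    obtain ⟨ε, hε, hb⟩ := Metric.mem_nhds_iff.1 this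
    refine ⟨ε, hε, fun s t hs ht => hb (a := (s, t)) ?_⟩
    rw [Metric.mem_ball, Prod.dist_eq]
    simpa using ⟨hs, ht⟩
  have abs0 : |(0 : ℝ)| < ε := by simpa using hε
  set Y : ℝ → ℝ → V := fun s t => y (ξ0 + s • ξ1 + t • ξ2) with hY
  have hfv : ∀ (f : V →L[ℝ] ℝ) (v : V), f v = ω 0 v * f w0 + ω 1 v * f w1 + ω 2 v * f w2 := by
    intro f v
    conv_lhs => rw [hω v]
    simp
  -- nonvanishing of the zeroth coordinate
  have hY0 : ∀ s t : ℝ, |s| < ε → |t| < ε → ω 0 (Y s t) ≠ 0 := by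
    intro s t hs ht h0
    refine h.nondeg (hW s t hs ht) m1 m2 (e0 := e0) (e1 := e1 - s • e0) (e2 := e2 - t • e0)
      ?_ ?_ ?_ ?_ ?_ ?_ ?_ ?_ ?_ (ω 0 : V →ₗ[ℝ] ℝ) (fun h1 => ?_) h0 o01 o02 <;>
      try simp [h00, h01, h02, h10, h11, h12, h20, h21, h22]
    have := congrArg (fun f => f w0) h1
    simp [o00] at this
  have hne : ∀ {p : V} {f : V →L[ℝ] ℝ}, p ≠ 0 → f p = Φ p →
      ¬ (f w0 = 0 ∧ f w1 = 0 ∧ f w2 = 0) := by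
    rintro p f hp hfp ⟨a0, a1, a2⟩
    have := hfv f p
    rw [a0, a1, a2, hfp] at this
    have := h.pos hp
    linarith
  set α : ℝ → ℝ := fun s => ω 1 (Y s 0) / ω 0 (Y s 0) with hα
  set β : ℝ → ℝ := fun t => ω 2 (Y 0 t) / ω 0 (Y 0 t) with hβ
  have hY1 : ∀ s t : ℝ, |s| < ε → |t| < ε → ω 1 (Y s t) = α s * ω 0 (Y s t) := by
    intro s t hs ht
    have pne : e1 - s • e0 ≠ 0 := fun h0 => by
      have := congrArg ξ1 h0
      simp [h11, h10] at this
    obtain ⟨f, f1, f2, f3⟩ := h.support pne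
    have a2 : f w2 = 0 := f3 _ m2 (by simp [h21, h20])
    have b1 : f (Y s t) = 0 := f3 _ (hW s t hs ht)
      (by simp [h00, h01, h10, h11, h20, h21])
    have b2 : f (Y s 0) = 0 := f3 _ (hW s 0 hs abs0)
      (by simp [h00, h01, h10, h11, h20, h21])
    rw [hfv, a2] at b1 b2
    have n1 := hY0 s t hs ht
    have n2 := hY0 s 0 hs abs0
    have a1 : f w1 ≠ 0 := fun h0 => by
      rw [h0] at b1
      have : f w0 = 0 := by simpa [n1] using b1
      exact hne pne f2 ⟨this, h0, a2⟩
    simp only [hα]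
    field_simp
    apply mul_right_cancel₀ a1
    linear_combination ω 0 (Y s 0) * b1 - ω 0 (Y s t) * b2
  have hY2 : ∀ s t : ℝ, |s| < ε → |t| < ε → ω 2 (Y s t) = β t * ω 0 (Y s t) := by
    intro s t hs ht
    have pne : e2 - t • e0 ≠ 0 := fun h0 => by
      have := congrArg ξ2 h0
      simp [h22, h20] at this
    obtain ⟨f, f1, f2, f3⟩ := h.support pne
    have a2 : f w1 = 0 := f3 _ m1 (by simp [h12, h10])
    have b1 : f (Y s t) = 0 := f3 _ (hW s t hs ht)
      (by simp [h00, h02, h10, h12, h20, h22])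
    have b2 : f (Y 0 t) = 0 := f3 _ (hW 0 t abs0 ht)
      (by simp [h00, h02, h10, h12, h20, h22])
    rw [hfv, a2] at b1 b2
    have n1 := hY0 s t hs ht
    have n2 := hY0 0 t abs0 ht
    have a1 : f w2 ≠ 0 := fun h0 => by
      rw [h0] at b1
      have : f w0 = 0 := by simpa [n1] using b1
      exact hne pne f2 ⟨this, a2, h0⟩
    simp only [hβ]
    field_simp
    apply mul_right_cancel₀ a1
    linear_combination ω 0 (Y 0 t) * b1 - ω 0 (Y s t) * b2
  have hYY : ∀ s t : ℝ, |s| < ε → |t| < ε → 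
      Y s t = ω 0 (Y s t) • (w0 + α s • w1 + β t • w2) := by
    intro s t hs ht
    conv_lhs => rw [hω (Y s t), hY1 s t hs ht, hY2 s t hs ht]
    module
  have hfY : ∀ (f : V →L[ℝ] ℝ) (s t : ℝ), |s| < ε → |t| < ε → f (Y s t) = 0 →
      f w0 + α s * f w1 + β t * f w2 = 0 := by
    intro f s t hs ht h0
    rw [hYY s t hs ht, map_smul, smul_eq_mul] at h0
    have := (mul_eq_zero.1 h0).resolve_left (hY0 s t hs ht)
    simpa using this
  have hinjY : ∀ s t s' t' : ℝ, |s| < ε → |t| < ε → |s'| < ε → |t'| < ε → α s = α s' → β t = β t' →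
      s = s' ∧ t = t' := by
    intro s t s' t' hs ht hs' ht' ha hb
    obtain ⟨b, hb⟩ := h.inj _ (hW s t hs ht) _ (hW s' t' hs' ht')
      (ω 0 (Y s' t') * (ω 0 (Y s t))⁻¹) (by
        change _ • Y s t = Y s' t'
        have q1 := hYY s t hs ht
        have q2 := hYY s' t' hs' ht'
        rw [← ha, ← hb] at q2
        refine ((congrArg (fun v => (ω 0 (Y s' t') * (ω 0 (Y s t))⁻¹) • v) q1).trans ?_).trans q2.symm
        rw [smul_smul, mul_assoc, inv_mul_cancel₀ (hY0 s t hs ht), mul_one])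
    have c0 := congrArg (fun f => f e0) hb
    have c1 := congrArg (fun f => f e1) hb
    have c2 := congrArg (fun f => f e2) hb
    simp [h00, h01, h02, h10, h11, h12, h20, h21, h22] at c0 c1 c2
    subst c0
    exact ⟨by linarith, by linarith⟩
  have αinj : ∀ s s' : ℝ, |s| < ε → |s'| < ε → α s = α s' → s = s' := fun s s' hs hs' ha =>
    (hinjY s 0 s' 0 hs abs0 hs' abs0 ha rfl).1
  have βinj : ∀ s s' : ℝ, |s| < ε → |s'| < ε → β s = β s' → s = s' := fun s s' hs hs' ha =>
    (hinjY 0 s 0 s' abs0 hs abs0 hs' rfl ha).2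
  -- slanted lines
  have hrel : ∀ m : ℝ, |m| < ε → ∃ A B : ℝ, A ≠ 0 ∧ ∀ s : ℝ, |s| < ε → |s + m| < ε →
      β (s + m) = A * α s + B := by
    intro m hm
    have pne : e2 - e1 - m • e0 ≠ 0 := fun h0 => by
      have := congrArg ξ2 h0
      simp [h22, h20, h21] at this
    obtain ⟨f, f1, f2, f3⟩ := h.support pne
    have hs : ∀ s : ℝ, |s| < ε → |s + m| < ε → f w0 + α s * f w1 + β (s + m) * f w2 = 0 := by
      intro s hs hsm
      refine hfY f s (s + m) hs hsm (f3 _ (hW s (s + m) hs hsm) ?_)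
      simp [h00, h01, h02, h10, h11, h12, h20, h21, h22]
    rw [abs_lt] at hm
    have r1 : |-m / 2| < ε := by rw [abs_lt]; constructor <;> linarith
    have r2 : |-m / 2 + m| < ε := by rw [abs_lt]; constructor <;> linarith
    have r3 : |-m / 2 + ε / 4| < ε := by rw [abs_lt]; constructor <;> linarith
    have r4 : |-m / 2 + ε / 4 + m| < ε := by rw [abs_lt]; constructor <;> linarith
    have s1 := hs _ r1 r2
    have s2 := hs _ r3 r4
    have n2 : f w2 ≠ 0 := fun h0 => by
      rw [h0] at s1 s2
      have t1 : (α (-m / 2) - α (-m / 2 + ε / 4)) * f w1 = 0 := by linear_combination s1 - s2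
      rcases mul_eq_zero.1 t1 with t1 | t1
      · have := αinj _ _ r1 r3 (sub_eq_zero.1 t1)
        linarith
      · rw [t1] at s1
        exact hne pne f2 ⟨by linarith, t1, h0⟩
    have n1 : f w1 ≠ 0 := fun h0 => by
      rw [h0] at s1 s2
      have t1 : (β (-m / 2 + m) - β (-m / 2 + ε / 4 + m)) * f w2 = 0 := by
        linear_combination s1 - s2
      rcases mul_eq_zero.1 t1 with t1 | t1
      · have := βinj _ _ r2 r4 (sub_eq_zero.1 t1)
        linarith
      · exact n2 t1
    refine ⟨- f w1 / f w2, - f w0 / f w2, by simp [n1, n2], fun s a1 a2 => ?_⟩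
    have := hs s a1 a2
    field_simp
    linear_combination this
  obtain ⟨A0, B0, hA0, hAB0⟩ := hrel 0 abs0
  simp only [add_zero] at hAB0
  have hcont : ContinuousOn α (Ioo (-ε) ε) := by
    intro s hs
    have hs : |s| < ε := abs_lt.2 hs
    have c1 : ContinuousAt (fun s => Y s 0) s := by
      have a1 : ContinuousAt y (ξ0 + s • ξ1 + (0 : ℝ) • ξ2) := h.cont (hW s 0 hs abs0)
      have a2 : ContinuousAt (fun s : ℝ => ξ0 + s • ξ1 + (0 : ℝ) • ξ2) s := by fun_prop
      exact ContinuousAt.comp (f := fun s : ℝ => ξ0 + s • ξ1 + (0 : ℝ) • ξ2) a1 a2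
    have c2 := (ω 1).continuous.continuousAt.comp c1
    have c3 := (ω 0).continuous.continuousAt.comp c1
    exact (c2.div c3 (hY0 s 0 hs abs0)).continuousWithinAt
  obtain ⟨d, hd, hαd⟩ := oneDim hε hcont (fun s hs s' hs' => αinj s s' (abs_lt.2 hs) (abs_lt.2 hs'))
    (fun m hm => by
      obtain ⟨A, B, hA, hAB⟩ := hrel m hm
      refine ⟨A / A0, (B - B0) / A0, div_ne_zero hA hA0, fun s a1 a2 => ?_⟩
      have := hAB s a1 a2
      rw [hAB0 _ a2 a2] at this
      field_simp
      linear_combination this)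
  have hβd : HasDerivAt β (A0 * d) 0 := by
    refine ((hαd.const_mul A0).add_const B0).congr_of_eventuallyEq ?_
    filter_upwards [isOpen_Ioo.mem_nhds (show (0 : ℝ) ∈ Ioo (-ε) ε by constructor <;> linarith)]
      with s hs
    exact hAB0 s (abs_lt.2 hs) (abs_lt.2 hs)
  -- the linear map
  let D : V →L[ℝ] V := (A0 * d) • ξ1.smulRight w2 - d • ξ2.smulRight w1
  let C : V →L[ℝ] V := D - (ξ0.comp D).smulRight w0
  have hD : ∀ x, D x = (A0 * d * ξ1 x) • w2 - (d * ξ2 x) • w1 := fun x => by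
    simp [D, smul_smul]
  have hC : ∀ x, C x = D x - ξ0 (D x) • w0 := fun x => by simp [C]
  refine ⟨C, fun x => ?_, ⟨e1, h01, fun h0 => ?_⟩, fun x hx hx0 => ?_⟩
  · rw [hC]; simp [hw0, h.y1 _ m0]
  · have := congrArg (ω 2) h0
    rw [hC, hD] at this
    simp [h11, h21, o20, o22] at this
    exact this.elim hA0 hd
  · obtain ⟨f, f1, f2, f3⟩ := h.support hx
    refine ⟨f, f1, f2, ?_⟩
    have a0 : f w0 = 0 := f3 _ m0 hx0
    have hα0 : α 0 = 0 := by simp [hα, hY, ← hw0, o10]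
    have hβ0 : β 0 = 0 := by simp [hβ, hY, ← hw0, o20]
    have hder : HasDerivAt (fun r : ℝ => α (r * -ξ2 x) * f w1 + β (r * ξ1 x) * f w2)
        (d * (-ξ2 x) * f w1 + A0 * d * (ξ1 x) * f w2) 0 := by
      have k1 : HasDerivAt (fun r : ℝ => r * -ξ2 x) (-ξ2 x) 0 := by
        simpa using (hasDerivAt_id (0 : ℝ)).mul_const (-ξ2 x)
      have k2 : HasDerivAt (fun r : ℝ => r * ξ1 x) (ξ1 x) 0 := by
        simpa using (hasDerivAt_id (0 : ℝ)).mul_const (ξ1 x)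
      have k3 := HasDerivAt.comp (h₂ := α) (h := fun r : ℝ => r * -ξ2 x) (0 : ℝ)
        (by simpa using hαd) k1
      have k4 := HasDerivAt.comp (h₂ := β) (h := fun r : ℝ => r * ξ1 x) (0 : ℝ)
        (by simpa using hβd) k2
      exact (k3.mul_const (f w1)).add (k4.mul_const (f w2))
    have hzero : HasDerivAt (fun r : ℝ => α (r * -ξ2 x) * f w1 + β (r * ξ1 x) * f w2) 0 0 := by
      refine (hasDerivAt_const (0 : ℝ) (0 : ℝ)).congr_of_eventuallyEq ?_
      have l1 : ∀ᶠ r : ℝ in nhds 0, |r * -ξ2 x| < ε := by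
        have : ContinuousAt (fun r : ℝ => |r * -ξ2 x|) 0 := by fun_prop
        exact this.eventually (gt_mem_nhds (by simpa using hε))
      have l2 : ∀ᶠ r : ℝ in nhds 0, |r * ξ1 x| < ε := by
        have : ContinuousAt (fun r : ℝ => |r * ξ1 x|) 0 := by fun_prop
        exact this.eventually (gt_mem_nhds (by simpa using hε))
      filter_upwards [l1, l2] with r r1 r2
      have := hfY f _ _ r1 r2 (f3 _ (hW _ _ r1 r2) (by simp [hx0]; ring))
      rw [a0] at this
      linarith
    have heq := hder.unique hzero
    rw [hC, hD]
    simp [a0]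
    linear_combination heq
end core

set_option linter.unusedSectionVars false
section core
variable {V : Type*} [NormedAddCommGroup V] [NormedSpace ℝ V] [FiniteDimensional ℝ V]
variable {Φ : V → ℝ} {L c : ℝ} 

theorem flow_const (sl : Subl Φ L) (C : V →L[ℝ] V) (γ : ℝ → V)
    (hγ : ∀ t, HasDerivAt γ (C (γ t)) t)
    (hf : ∀ t, ∃ f : V →L[ℝ] ℝ, (∀ v, f v ≤ Φ v) ∧ f (γ t) = Φ (γ t) ∧ f (C (γ t)) = 0) (t s : ℝ) :
    Φ (γ t) = Φ (γ s) := by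
  have key : ∀ t, HasDerivAt (fun t => Φ (γ t)) 0 t := by
    intro t
    rw [hasDerivAt_iff_isLittleO, Asymptotics.isLittleO_iff]
    intro ε hε
    have hcont : Continuous γ := continuous_iff_continuousAt.2 fun t => (hγ t).continuousAt
    set K := |L| + 1 with hK
    have hKp : 0 < K := by positivity
    have h1 := (hasDerivAt_iff_isLittleO.1 (hγ t))
    rw [Asymptotics.isLittleO_iff] at h1
    have h1 := h1 (c := ε / (2 * K)) (by positivity)
    have h2 : ∀ᶠ s in nhds t, ‖C (γ s) - C (γ t)‖ < ε / (2 * K) := by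
      have : ContinuousAt (fun s => ‖C (γ s) - C (γ t)‖) t := by fun_prop
      exact this.eventually (gt_mem_nhds (by simp; positivity))
    filter_upwards [h1, h2] with s s1 s2
    obtain ⟨f, f1, f2, f3⟩ := hf t
    obtain ⟨g, g1, g2, g3⟩ := hf s
    set R := γ s - γ t - (s - t) • C (γ t) with hR
    have e1 : f (γ s) = Φ (γ t) + f R := by
      rw [hR]; simp [f2, f3]
    have e2 : g (γ t) = Φ (γ s) - g R + (s - t) * g (C (γ s) - C (γ t)) := by
      rw [hR]; simp [g2, g3]; ring
    have i1 : |f R| ≤ K * ‖R‖ := (sl.abs_le (f : V →ₗ[ℝ] ℝ) f1 R).trans (by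
      have := le_abs_self L
      gcongr; linarith)
    have i2 : |g R| ≤ K * ‖R‖ := (sl.abs_le (g : V →ₗ[ℝ] ℝ) g1 R).trans (by
      have := le_abs_self L
      gcongr; linarith)
    have i3 : |g (C (γ s) - C (γ t))| ≤ K * ‖C (γ s) - C (γ t)‖ :=
      (sl.abs_le (g : V →ₗ[ℝ] ℝ) g1 _).trans (by
      have := le_abs_self L
      gcongr; linarith)
    have j1 : K * ‖R‖ ≤ ε / 2 * |s - t| := by
      rw [Real.norm_eq_abs] at s1
      calc K * ‖R‖ ≤ K * (ε / (2 * K) * |s - t|) := by gcongr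
        _ = _ := by field_simp
    have j2 : |(s - t) * g (C (γ s) - C (γ t))| ≤ ε / 2 * |s - t| := by
      rw [abs_mul]
      calc |s - t| * |g (C (γ s) - C (γ t))| ≤ |s - t| * (K * (ε / (2 * K))) := by
            gcongr; exact i3.trans (by gcongr)
        _ = _ := by field_simp
    have k1 := f1 (γ s)
    have k2 := g1 (γ t)
    simp only [smul_zero, sub_zero, Real.norm_eq_abs]
    have := abs_le.1 i1
    have := abs_le.1 i2
    have := abs_le.1 j2
    rw [abs_le]
    constructor <;> nlinarith [abs_nonneg (s - t)]
  exact is_const_of_deriv_eq_zero (fun t => (key t).differentiableAt) (fun t => (key t).deriv) t s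

end core

set_option linter.unusedSectionVars false
section core
variable {V : Type*} [NormedAddCommGroup V] [NormedSpace ℝ V] [FiniteDimensional ℝ V]
variable {Φ : V → ℝ} {L c : ℝ} 

theorem cayley2 (X : Submodule ℝ V) (hX : finrank ℝ X = 2) (C : V →L[ℝ] V) (hC : ∀ x ∈ X, C x ∈ X) :
    ∃ μ δ : ℝ, ∀ x ∈ X, C (C x) = (2 * μ) • C x + (δ - μ ^ 2) • x := by
  let b := finBasisOfFinrankEq ℝ X hX
  have hb : ∀ x : V, x ∈ X → ∃ s t : ℝ, x = s • (b 0 : V) + t • (b 1 : V) := by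
    intro x hx
    refine ⟨b.repr ⟨x, hx⟩ 0, b.repr ⟨x, hx⟩ 1, ?_⟩
    have := b.sum_repr ⟨x, hx⟩
    rw [Fin.sum_univ_two] at this
    exact (congrArg (Subtype.val) this).symm
  obtain ⟨p, q, hp⟩ := hb _ (hC _ (b 0).2)
  obtain ⟨r, s, hr⟩ := hb _ (hC _ (b 1).2)
  refine ⟨(p + s) / 2, ((p + s) / 2) ^ 2 - (p * s - q * r), fun x hx => ?_⟩
  obtain ⟨t, u, rfl⟩ := hb x hx
  simp only [map_add, map_smul, hp, hr]
  module

theorem exists_rotJ (sl : Subl Φ L) (lo : ∀ v, c * ‖v‖ ≤ Φ v) (cpos : 0 < c)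
    (X : Submodule ℝ V) (hX : finrank ℝ X = 2) (C : V →L[ℝ] V) (hC : ∀ x ∈ X, C x ∈ X)
    (hne : ∃ x ∈ X, C x ≠ 0)
    (hf : ∀ x ∈ X, ∃ f : V →L[ℝ] ℝ, (∀ v, f v ≤ Φ v) ∧ f x = Φ x ∧ f (C x) = 0) :
    ∃ J : V →L[ℝ] V, (∀ x ∈ X, J x ∈ X) ∧ (∀ x ∈ X, J (J x) = - x) ∧
      ∀ x ∈ X, ∀ θ : ℝ, Φ (Real.cos θ • x + Real.sin θ • J x) = Φ x := by
  have pos : ∀ x, x ≠ 0 → 0 < Φ x := fun x hx =>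
    lt_of_lt_of_le (mul_pos cpos (norm_pos_iff.2 hx)) (lo x)
  have flow : ∀ γ : ℝ → V, (∀ t, γ t ∈ X) → (∀ t, HasDerivAt γ (C (γ t)) t) → ∀ t s,
      Φ (γ t) = Φ (γ s) := fun γ h1 h2 t s => flow_const sl C γ h2 (fun t => hf _ (h1 t)) t s
  have eig : ∀ x ∈ X, ∀ l : ℝ, C x = l • x → x = 0 ∨ l = 0 := by
    intro x hx l hl
    by_cases h0 : x = 0
    · exact Or.inl h0
    right
    have := flow (fun t => Real.exp (l * t) • x) (fun t => X.smul_mem _ hx) (fun t => by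
      have h1 : HasDerivAt (fun t => Real.exp (l * t)) (Real.exp (l * t) * l) t := by
        simpa using ((hasDerivAt_id t).const_mul l).exp
      have := h1.smul_const x
      simpa [hl, smul_smul] using this) 1 0
    simp only [mul_one, mul_zero, Real.exp_zero, one_smul] at this
    rw [sl.hom _ _ (Real.exp_pos l).le] at this
    have h2 : Real.exp l = 1 := by
      have := pos x h0
      apply mul_right_cancel₀ this.ne'
      linarith
    simpa using h2
  obtain ⟨μ, δ, hCH⟩ := cayley2 X hX C hC
  obtain ⟨x0, hx0, hCx0⟩ := hne
  have x0ne : x0 ≠ 0 := fun h => hCx0 (by simp [h])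
  rcases le_or_gt 0 δ with hδ | hδ
  · exfalso
    obtain ⟨d, hd⟩ : ∃ d : ℝ, d ^ 2 = δ := ⟨√δ, Real.sq_sqrt hδ⟩
    have main : ∀ d : ℝ, d ^ 2 = δ → μ + d = 0 := by
      intro d hd
      rcases eig (C x0 + (d - μ) • x0) (X.add_mem (hC _ hx0) (X.smul_mem _ hx0)) (μ + d) (by
        rw [map_add, map_smul, hCH _ hx0, ← hd]
        module) with h1 | h1
      · have h2 : C x0 = (μ - d) • x0 := by
          rw [eq_neg_of_add_eq_zero_left h1]; module
        rcases eig x0 hx0 _ h2 with h3 | h3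
        · exact absurd h3 x0ne
        · rw [h3, zero_smul] at h2; exact absurd h2 hCx0
      · exact h1
    have a1 := main d hd
    have a2 := main (-d) (by rw [neg_sq, hd])
    have hμ : μ = 0 := by linarith
    have hd0 : d = 0 := by linarith
    have hδ0 : δ = 0 := by rw [← hd, hd0]; norm_num
    have hCC : C (C x0) = 0 := by rw [hCH _ hx0, hμ, hδ0]; simp
    have cst := fun t : ℝ => flow (fun t => x0 + t • C x0) (fun t => X.add_mem hx0 (X.smul_mem _ (hC _ hx0)))
      (fun t => by
        have := ((hasDerivAt_id t).smul_const (C x0)).const_add x0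
        simpa [hCC] using this) t 0
    simp only [zero_smul, add_zero] at cst
    have nC : 0 < ‖C x0‖ := norm_pos_iff.2 hCx0
    have b0 : ∀ t : ℝ, 0 ≤ t → c * (t * ‖C x0‖) ≤ Φ x0 + c * ‖x0‖ := by
      intro t ht
      have h1 := lo (x0 + t • C x0)
      rw [cst t] at h1
      have h2 : ‖t • C x0‖ ≤ ‖x0 + t • C x0‖ + ‖x0‖ := by
        have := norm_sub_le (x0 + t • C x0) x0
        simpa using this
      rw [norm_smul, Real.norm_of_nonneg ht] at h2
      nlinarith
    have hp := pos x0 x0ne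
    have := b0 ((Φ x0 + c * ‖x0‖ + 1) / (c * ‖C x0‖)) (by positivity)
    rw [show c * ((Φ x0 + c * ‖x0‖ + 1) / (c * ‖C x0‖) * ‖C x0‖) = Φ x0 + c * ‖x0‖ + 1 by
      field_simp] at this
    linarith
  · obtain ⟨ω, hω, hωδ⟩ : ∃ ω : ℝ, 0 < ω ∧ ω ^ 2 = - δ :=
      ⟨√(-δ), Real.sqrt_pos.2 (by linarith), Real.sq_sqrt (by linarith)⟩
    let J : V →L[ℝ] V := ω⁻¹ • (C - μ • ContinuousLinearMap.id ℝ V)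
    have hJ : ∀ x, J x = ω⁻¹ • (C x - μ • x) := fun x => by simp [J]
    have hCJ : ∀ x, C x = μ • x + ω • J x := fun x => by
      rw [hJ, smul_smul, mul_inv_cancel₀ hω.ne']; module
    have hJX : ∀ x ∈ X, J x ∈ X := fun x hx => by
      rw [hJ]; exact X.smul_mem _ (X.sub_mem (hC _ hx) (X.smul_mem _ hx))
    have hJJ : ∀ x ∈ X, J (J x) = - x := fun x hx => by
      rw [hJ (J x), hJ x, map_smul, map_sub, map_smul, hCH _ hx,
        show δ = - ω ^ 2 by linarith]
      match_scalars <;> field_simp <;> ring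
    have cst : ∀ x ∈ X, ∀ t : ℝ, Real.exp (μ * t) * Φ (Real.cos (ω * t) • x + Real.sin (ω * t) • J x) = Φ x := by
      intro x hx t
      have := flow (fun t => Real.exp (μ * t) • (Real.cos (ω * t) • x + Real.sin (ω * t) • J x))
        (fun t => X.smul_mem _ (X.add_mem (X.smul_mem _ hx) (X.smul_mem _ (hJX _ hx))))
        (fun t => by
          have h1 : HasDerivAt (fun t => Real.exp (μ * t)) (Real.exp (μ * t) * μ) t := by
            simpa using ((hasDerivAt_id t).const_mul μ).exp
          have h2 : HasDerivAt (fun t => Real.cos (ω * t)) (-Real.sin (ω * t) * ω) t := by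
            simpa using ((hasDerivAt_id t).const_mul ω).cos
          have h3 : HasDerivAt (fun t => Real.sin (ω * t)) (Real.cos (ω * t) * ω) t := by
            simpa using ((hasDerivAt_id t).const_mul ω).sin
          have := h1.smul ((h2.smul_const x).add (h3.smul_const (J x)))
          refine HasDerivAt.congr_deriv this ?_
          simp only [map_smul, map_add, Pi.add_apply]
          rw [hCJ (J x), hJJ x hx, hCJ x]
          module) t 0
      simp only [mul_zero, Real.exp_zero, Real.cos_zero, Real.sin_zero, one_smul, zero_smul, add_zero] at this
      rwa [sl.hom _ _ (Real.exp_pos _).le] at this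
    have hμ : μ = 0 := by
      have := cst x0 hx0 (2 * Real.pi / ω)
      rw [show ω * (2 * Real.pi / ω) = 2 * Real.pi by field_simp] at this
      simp only [Real.cos_two_pi, Real.sin_two_pi, one_smul, zero_smul, add_zero] at this
      have h2 : Real.exp (μ * (2 * Real.pi / ω)) = 1 := by
        have := pos x0 x0ne
        apply mul_right_cancel₀ this.ne'
        linarith
      rw [Real.exp_eq_one_iff] at h2
      have : 2 * Real.pi / ω ≠ 0 := by positivity
      exact (mul_eq_zero.1 h2).resolve_right this
    refine ⟨J, hJX, hJJ, fun x hx θ => ?_⟩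
    have := cst x hx (θ / ω)
    rw [hμ, show ω * (θ / ω) = θ by field_simp] at this
    simpa using this

theorem ellipse_of_rotation (sl : Subl Φ L) (lo : ∀ v, c * ‖v‖ ≤ Φ v) (cpos : 0 < c)
    (X : Submodule ℝ V) (hX : finrank ℝ X = 2) 
    (J : V →L[ℝ] V) (hJX : ∀ x ∈ X, J x ∈ X) (hJJ : ∀ x ∈ X, J (J x) = - x)
    (hrot : ∀ x ∈ X, ∀ θ : ℝ, Φ (Real.cos θ • x + Real.sin θ • J x) = Φ x) :
    ∃ Q : QuadraticForm ℝ X, Q.PosDef ∧ ∀ x : X, Q x ≤ 1 ↔ Φ x ≤ 1 := by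
  obtain ⟨e, he⟩ : ∃ e : X, e ≠ 0 := by
    have : Nontrivial X := Module.nontrivial_of_finrank_pos (R := ℝ) (by omega)
    exact exists_ne 0
  have heV : (e : V) ≠ 0 := fun h => he (Subtype.ext h)
  have hpos : 0 < Φ (e : V) := lt_of_lt_of_le (mul_pos cpos (norm_pos_iff.2 heV)) (lo _)
  have hli : LinearIndependent ℝ ![e, (⟨J e, hJX _ e.2⟩ : X)] := by
    rw [LinearIndependent.pair_iff]
    intro s t hst
    have h1 : s • (e : V) + t • J e = 0 := congrArg Subtype.val hst
    have h2 := congrArg J h1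
    rw [map_add, map_smul, map_smul, hJJ _ e.2, map_zero] at h2
    have h3 : (s ^ 2 + t ^ 2) • (e : V) = 0 := by
      have : (s ^ 2 + t ^ 2) • (e : V) = s • (s • (e : V) + t • J e) - t • (s • J e + t • -(e : V)) := by
        module
      rw [this, h1, h2]; simp
    have h4 := (smul_eq_zero.1 h3).resolve_right heV
    constructor <;> nlinarith [sq_nonneg s, sq_nonneg t]
  let b := basisOfLinearIndependentOfCardEqFinrank hli (by simp [hX])
  have b0 : b 0 = e := by simp [b]
  have b1 : b 1 = ⟨J e, hJX _ e.2⟩ := by simp [b]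
  have hx : ∀ x : X, (x : V) = b.coord 0 x • (e : V) + b.coord 1 x • J e := by
    intro x
    have := b.sum_repr x
    rw [Fin.sum_univ_two, b0, b1] at this
    exact (congrArg (Subtype.val) this).symm
  let Q : QuadraticForm ℝ X := (Φ (e : V)) ^ 2 •
    (QuadraticMap.linMulLin (b.coord 0) (b.coord 0) + QuadraticMap.linMulLin (b.coord 1) (b.coord 1))
  have hQ : ∀ x, Q x = (Φ (e : V)) ^ 2 * (b.coord 0 x ^ 2 + b.coord 1 x ^ 2) := fun x => by
    simp [Q, QuadraticMap.linMulLin_apply, sq]; ring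
  have hΦ : ∀ x : X, 0 ≤ Φ (x : V) ∧ Φ (x : V) ^ 2 = Q x := by
    intro x
    refine ⟨le_trans (by positivity) (lo x), ?_⟩
    let z : ℂ := ⟨b.coord 0 x, b.coord 1 x⟩
    have z1 : b.coord 0 x = ‖z‖ * Real.cos z.arg := (Complex.norm_mul_cos_arg z).symm
    have z2 : b.coord 1 x = ‖z‖ * Real.sin z.arg := (Complex.norm_mul_sin_arg z).symm
    have h1 : (x : V) = ‖z‖ • (Real.cos z.arg • (e : V) + Real.sin z.arg • J e) := by
      rw [hx x]
      generalize ‖z‖ = r at *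
      generalize z.arg = θ at *
      rw [z1, z2]; module
    rw [hQ, h1, sl.hom _ _ (norm_nonneg _), hrot _ e.2]
    rw [z1, z2]
    linear_combination (-(Φ (e : V)) ^ 2 * ‖z‖ ^ 2) * Real.cos_sq_add_sin_sq z.arg
  refine ⟨Q, fun x hx0 => ?_, fun x => ?_⟩
  · rw [← (hΦ x).2]
    have : (x : V) ≠ 0 := fun h => hx0 (Subtype.ext h)
    have : 0 < Φ (x : V) := lt_of_lt_of_le (mul_pos cpos (norm_pos_iff.2 this)) (lo _)
    positivity
  · rw [← (hΦ x).2]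
    exact sq_le_one_iff₀ (hΦ x).1
end core


section core
variable {V : Type*} [NormedAddCommGroup V] [NormedSpace ℝ V] [FiniteDimensional ℝ V]

theorem finrank_ker_two (hV : finrank ℝ V = 3) {ξ : V →L[ℝ] ℝ} (h : ξ ≠ 0) :
    finrank ℝ (LinearMap.ker (ξ : V →ₗ[ℝ] ℝ)) = 2 := by
  have h' : (ξ : V →ₗ[ℝ] ℝ) ≠ 0 := fun h0 => h (by ext v; exact congrArg (fun f => f v) h0)
  have := Module.Dual.finrank_ker_add_one_of_ne_zero (f := (ξ : V →ₗ[ℝ] ℝ)) h'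
  omega

theorem ne_zero_of_ker (hV : finrank ℝ V = 3) {ξ : V →L[ℝ] ℝ} {X : Gr 2 V}
    (h : LinearMap.ker (ξ : V →ₗ[ℝ] ℝ) = X.1) : ξ ≠ 0 := by
  rintro rfl
  have h1 := X.2
  rw [← h] at h1
  have : LinearMap.ker ((0 : V →L[ℝ] ℝ) : V →ₗ[ℝ] ℝ) = ⊤ := by ext; simp
  rw [this, finrank_top] at h1
  omega

theorem W_open (hV : finrank ℝ V = 3) (𝒰 : Set (Gr 2 V)) (h𝒰open : IsOpen 𝒰) :
    IsOpen {ξ : V →L[ℝ] ℝ | ∃ X ∈ 𝒰, LinearMap.ker (ξ : V →ₗ[ℝ] ℝ) = X.1} := by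
  rw [isOpen_iff_mem_nhds]
  rintro ξ0 ⟨X0, hX0, hk⟩
  have hne := ne_zero_of_ker hV hk
  obtain ⟨w, hw⟩ : ∃ w, ξ0 w ≠ 0 := by
    by_contra! h
    exact hne (by ext v; exact h v)
  have hO := isOpen_coinduced.1 h𝒰open
  obtain ⟨O, hOo, hO⟩ := isOpen_induced_iff.1 hO
  let b := finBasisOfFinrankEq ℝ X0.1 X0.2
  have hbk : ∀ i, ξ0 (b i : V) = 0 := fun i => by
    have : (b i : V) ∈ LinearMap.ker (ξ0 : V →ₗ[ℝ] ℝ) := by rw [hk]; exact (b i).2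
    exact this
  have hbli : LinearIndependent ℝ (fun i => (b i : V)) :=
    b.linearIndependent.map' X0.1.subtype (Submodule.ker_subtype _)
  have hbsp : Submodule.span ℝ (range fun i => (b i : V)) = X0.1 := by
    refine Submodule.eq_of_le_of_finrank_eq ?_ ?_
    · rw [Submodule.span_le]; rintro _ ⟨i, rfl⟩; exact (b i).2
    · rw [finrank_span_eq_card hbli, Fintype.card_fin, X0.2]
  let u : (V →L[ℝ] ℝ) → Fin 2 → V := fun ξ i => (b i : V) - (ξ (b i : V) / ξ w) • w
  have hu0 : u ξ0 = fun i => (b i : V) := by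
    funext i; simp [u, hbk i]
  have huli : ∀ ξ, LinearIndependent ℝ (u ξ) := by
    intro ξ
    rw [Fintype.linearIndependent_iff] at hbli ⊢
    intro g hg
    apply hbli g
    have h1 := congrArg ξ0 hg
    simp only [Fin.sum_univ_two, u, map_add, map_smul, map_sub, hbk, smul_eq_mul, map_zero] at h1 hg ⊢
    have h2 : (g 0 * (ξ (b 0 : V) / ξ w) + g 1 * (ξ (b 1 : V) / ξ w)) = 0 := by
      apply mul_right_cancel₀ hw
      linear_combination -h1
    have h3 : g 0 • (b 0 : V) + g 1 • (b 1 : V) =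
      (g 0 • ((b 0 : V) - (ξ (b 0 : V) / ξ w) • w) + g 1 • ((b 1 : V) - (ξ (b 1 : V) / ξ w) • w))
        + (g 0 * (ξ (b 0 : V) / ξ w) + g 1 * (ξ (b 1 : V) / ξ w)) • w := by module
    rw [h3, hg, h2]; simp
  have hmem : ∀ v : {v : Fin 2 → V // LinearIndependent ℝ v}, v.1 ∈ O ↔
      (⟨Submodule.span ℝ (Set.range v.1), by
          rw [finrank_span_eq_card v.2, Fintype.card_fin]⟩ : Gr 2 V) ∈ 𝒰 := fun v => by
    have := Set.ext_iff.1 hO v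
    exact this
  have hev : ∀ v : V, ContinuousAt (fun ξ : V →L[ℝ] ℝ => ξ v) ξ0 := fun v => by fun_prop
  have hcu : ContinuousAt u ξ0 := by
    rw [continuousAt_pi]
    intro i
    exact continuousAt_const.sub (((hev _).div (hev w) hw).smul continuousAt_const)
  have h0O : u ξ0 ∈ O := by
    rw [hmem ⟨u ξ0, huli ξ0⟩]
    convert hX0
    simp only [hu0]
    exact hbsp
  filter_upwards [hcu.preimage_mem_nhds (hOo.mem_nhds h0O), (hev w).eventually_ne hw] with ξ k1 k2
  refine ⟨_, (hmem ⟨u ξ, huli ξ⟩).1 k1, ?_⟩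
  symm
  refine Submodule.eq_of_le_of_finrank_eq ?_ ?_
  · simp only [Submodule.span_le]
    rintro _ ⟨i, rfl⟩
    simp only [SetLike.mem_coe, LinearMap.mem_ker, ContinuousLinearMap.coe_coe, u, map_sub, map_smul,
      smul_eq_mul]
    field_simp
    ring
  · rw [finrank_ker_two hV]
    · exact finrank_span_eq_card (huli ξ)
    · rintro rfl; simp at k2

end core

/-- **The injective case in dimension 3 gives ellipses.** -/
theorem ellipse_case_3d
    {V : Type*} [NormedAddCommGroup V] [NormedSpace ℝ V] [FiniteDimensional ℝ V]
    (hV : Module.finrank ℝ V = 3)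
    (B : Set V) (hB : IsConvexBody B) (h0 : 0 ∈ interior B)
    (𝒰 : Set (Gr 2 V)) (h𝒰open : IsOpen 𝒰) (h𝒰conn : IsConnected 𝒰)
    (φ : Gr 2 V → Submodule ℝ V)
    (hφ : ∀ X ∈ 𝒰, Module.finrank ℝ (φ X) = 1 ∧
      B ⊆ (B ∩ (X.1 : Set V)) + (φ X : Set V))
    (hinj : ∀ X₁ ∈ 𝒰, ∀ X₂ ∈ 𝒰, φ X₁ = φ X₂ → X₁ = X₂) :
    ∀ X ∈ 𝒰, IsEllipsoidIn X.1 (B ∩ (X.1 : Set V)) := by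
  obtain ⟨hBc, hBconv, -⟩ := hB
  have hB0 : B ∈ nhds (0 : V) := mem_interior_iff_mem_nhds.1 h0
  have habs : Absorbent ℝ B := absorbent_nhds_zero hB0
  have hone : ∀ v, gauge B v ≤ 1 ↔ v ∈ B := fun v => by
    rw [gauge_le_one_iff_mem_closure hBconv hB0, hBc.isClosed.closure_eq]
  obtain ⟨r, hr, hrB⟩ := Metric.mem_nhds_iff.1 hB0
  obtain ⟨R, hR, hRB⟩ : ∃ R > 0, B ⊆ Metric.closedBall 0 R := by
    obtain ⟨R, hR⟩ := hBc.isBounded.subset_closedBall 0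
    exact ⟨max R 1, by positivity, hR.trans (Metric.closedBall_subset_closedBall (le_max_left _ _))⟩
  have hsl : Subl (gauge B) r⁻¹ := by
    refine ⟨fun a v ha => ?_, fun v w => gauge_add_le hBconv habs v w, fun v => ?_⟩
    · rw [gauge_smul_of_nonneg ha, smul_eq_mul]
    · have := mul_gauge_le_norm (x := v) hrB
      rw [inv_mul_eq_div, le_div_iff₀ hr]; linarith
  have hlo : ∀ v, R⁻¹ * ‖v‖ ≤ gauge B v := fun v => by
    have := le_gauge_of_subset_closedBall (x := v) habs hR.le hRB
    rwa [inv_mul_eq_div]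
  have hpos : ∀ v, v ≠ 0 → 0 < gauge B v := fun v hv =>
    lt_of_lt_of_le (mul_pos (inv_pos.2 hR) (norm_pos_iff.2 hv)) (hlo v)
  have hyex : ∀ ξ : V →L[ℝ] ℝ, ∃ z : V, ∀ X ∈ 𝒰, LinearMap.ker (ξ : V →ₗ[ℝ] ℝ) = X.1 →
      ξ z = 1 ∧ φ X = Submodule.span ℝ {z} := by
    intro ξ
    by_cases hex : ∃ X ∈ 𝒰, LinearMap.ker (ξ : V →ₗ[ℝ] ℝ) = X.1
    swap
    · exact ⟨0, fun X hX hk => absurd ⟨X, hX, hk⟩ hex⟩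
    obtain ⟨X, hX, hk⟩ := hex
    obtain ⟨f1, f2⟩ := hφ X hX
    have hne := ne_zero_of_ker hV hk
    obtain ⟨v, -, hv⟩ := finrank_eq_one_iff'.1 f1
    have hξv : ξ (v : V) ≠ 0 := by
      intro h1
      have hBk : ∀ b ∈ B, ξ b = 0 := by
        intro b hb
        obtain ⟨p, ⟨-, hp⟩, q, hq, rfl⟩ := f2 hb
        obtain ⟨a, ha⟩ := hv ⟨q, hq⟩
        have ha : a • (v : V) = q := congrArg Subtype.val ha
        have hp : p ∈ LinearMap.ker (ξ : V →ₗ[ℝ] ℝ) := by rw [hk]; exact hp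
        have hp : ξ p = 0 := hp
        simp [hp, ← ha, h1]
      apply hne
      ext u
      by_cases hu : u = 0
      · simp [hu]
      have := hBk ((gauge B u)⁻¹ • u) (by
        rw [← hone, gauge_smul_of_nonneg (inv_nonneg.2 (hpos u hu).le), smul_eq_mul,
          inv_mul_cancel₀ (hpos u hu).ne'])
      simpa [(hpos u hu).ne'] using this
    refine ⟨(ξ (v : V))⁻¹ • (v : V), fun X' hX' hk' => ?_⟩
    have : X' = X := Subtype.ext (hk'.symm.trans hk)
    subst this
    refine ⟨by simp [hξv], ?_⟩
    apply le_antisymm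
    · intro q hq
      obtain ⟨a, ha⟩ := hv ⟨q, hq⟩
      have ha : a • (v : V) = q := congrArg Subtype.val ha
      rw [Submodule.mem_span_singleton]
      refine ⟨a * ξ v, ?_⟩
      rw [smul_smul, mul_assoc, mul_inv_cancel₀ hξv, mul_one, ha]
    · rw [Submodule.span_singleton_le_iff_mem]
      exact Submodule.smul_mem _ _ v.2
  choose y hy using hyex
  have hS : Setup (gauge B) r⁻¹ R⁻¹
      {ξ : V →L[ℝ] ℝ | ∃ X ∈ 𝒰, LinearMap.ker (ξ : V →ₗ[ℝ] ℝ) = X.1} y := by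
    refine ⟨hV, hsl, hlo, inv_pos.2 hR, W_open hV 𝒰 h𝒰open, ?_, ?_, ?_⟩
    · rintro ξ ⟨X, hX, hk⟩
      exact (hy ξ X hX hk).1
    · rintro ξ ⟨X, hX, hk⟩ v
      obtain ⟨y1, y2⟩ := hy ξ X hX hk
      by_cases hv : v = 0
      · simp [hv]
      have hp := hpos v hv
      have hm : (gauge B v)⁻¹ • v ∈ B := by
        rw [← hone, gauge_smul_of_nonneg (inv_nonneg.2 hp.le), smul_eq_mul,
          inv_mul_cancel₀ hp.ne']
      obtain ⟨p, ⟨hpB, hpX⟩, q, hq, hpq⟩ := (hφ X hX).2 hm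
      have hpX : p ∈ LinearMap.ker (ξ : V →ₗ[ℝ] ℝ) := by rw [hk]; exact hpX
      have hpX : ξ p = 0 := hpX
      have hq : q ∈ φ X := hq
      rw [y2, Submodule.mem_span_singleton] at hq
      obtain ⟨a, rfl⟩ := hq
      have hpq : p + a • y ξ = (gauge B v)⁻¹ • v := hpq
      have hv' : v = gauge B v • (p + a • y ξ) := by
        rw [hpq, smul_smul, mul_inv_cancel₀ hp.ne', one_smul]
      have e1 : v - ξ v • y ξ = gauge B v • p := by
        have e2 : ξ v = gauge B v * a := by
          have := congrArg ξ hv'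
          rw [map_smul, map_add, map_smul, hpX, y1] at this
          simpa using this
        rw [e2]
        generalize gauge B v = g at *
        rw [hv']; module
      rw [e1, gauge_smul_of_nonneg hp.le, smul_eq_mul]
      have := (hone p).2 hpB
      nlinarith
    · rintro ξ ⟨X, hX, hk⟩ ξ' ⟨X', hX', hk'⟩ a ha
      obtain ⟨y1, y2⟩ := hy ξ X hX hk
      obtain ⟨y1', y2'⟩ := hy ξ' X' hX' hk'
      have ha0 : a ≠ 0 := by
        rintro rfl
        rw [zero_smul] at ha
        rw [← ha] at y1'
        simp at y1'
      have : X = X' := by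
        apply hinj X hX X' hX'
        rw [y2, y2', ← ha]
        exact (Submodule.span_singleton_smul_eq (IsUnit.mk0 a ha0) _).symm
      subst this
      refine ⟨ξ' (y ξ), ?_⟩
      ext v
      have h1 : v - ξ v • y ξ ∈ LinearMap.ker (ξ' : V →ₗ[ℝ] ℝ) := by
        rw [hk', ← hk]
        simp [y1]
      have h2 : ξ' (v - ξ v • y ξ) = 0 := h1
      simp at h2 ⊢
      linarith
  intro X hX
  obtain ⟨ξ, hk⟩ : ∃ ξ : V →L[ℝ] ℝ, LinearMap.ker (ξ : V →ₗ[ℝ] ℝ) = X.1 := by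
    have hlt : X.1 < ⊤ := by
      rw [lt_top_iff_ne_top]
      intro h
      have := X.2
      rw [h, finrank_top] at this
      omega
    obtain ⟨f, hf, hle⟩ := Submodule.exists_le_ker_of_lt_top X.1 hlt
    let ξ : V →L[ℝ] ℝ := LinearMap.toContinuousLinearMap f
    have hξ : (ξ : V →ₗ[ℝ] ℝ) = f := by ext; simp [ξ]
    have hξ0 : ξ ≠ 0 := fun h => hf (by rw [← hξ, h]; rfl)
    refine ⟨ξ, ?_⟩
    symm
    refine Submodule.eq_of_le_of_finrank_eq (by rw [hξ]; exact hle) ?_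
    rw [finrank_ker_two hV hξ0, X.2]
  have hmem : ∀ x, x ∈ X.1 ↔ ξ x = 0 := fun x => by rw [← hk]; rfl
  obtain ⟨C, c1, ⟨x0, c2, c3⟩, c4⟩ := hS.derivation (ξ0 := ξ) ⟨X, hX, hk⟩
  obtain ⟨J, j1, j2, j3⟩ := exists_rotJ hsl hlo (inv_pos.2 hR) X.1 X.2 C (fun x _ => (hmem _).2 (c1 x))
    ⟨x0, (hmem _).2 c2, c3⟩ (fun x hx => by
      by_cases hx0 : x = 0
      · exact ⟨0, fun v => by simpa using gauge_nonneg v, by simp [hx0], by simp⟩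
      · exact c4 x hx0 ((hmem _).1 hx))
  obtain ⟨Q, hQ, hQ1⟩ := ellipse_of_rotation hsl hlo (inv_pos.2 hR) X.1 X.2 J j1 j2 j3
  refine ⟨Q, hQ, ?_⟩
  ext v
  constructor
  · rintro ⟨hvB, hvX⟩
    exact ⟨⟨v, hvX⟩, (hQ1 _).2 ((hone v).2 hvB), rfl⟩
  · rintro ⟨x, hx, rfl⟩
    exact ⟨(hone _).1 ((hQ1 x).1 hx), x.2⟩
end

section
/- Let k ≥ 2 and n ≥ k+1 be integers, V an n-dimensional real vector space, Φ a Minkowski norm on V, and B the unit ball of Φ. Let X₀ be a k-dimensional linear subspace of V such that every k-dimensional subspace X from some neighbourhood of X₀ in Gr_k V is Φ-contracting. Then at least one of the following holds: (1) B is locally cylindrical near X₀; (2) B ∩ X₀ is a 0-centered ellipsoid. -/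
open Module Set Pointwise

open Filter Topology

lemma mink_lip {F : Type*} [NormedAddCommGroup F] [NormedSpace ℝ F]
    {Φ : F → ℝ} (hΦ : IsMinkowskiNorm Φ) {C : ℝ} (hC : ∀ x, Φ x ≤ C * ‖x‖) (x y : F) :
    Φ x ≤ Φ y + C * ‖x - y‖ := by
  have := hΦ.1.2.2 y (x - y)
  rw [add_sub_cancel] at this
  linarith [hC (x - y)]

lemma mink_zero {F : Type*} [AddCommGroup F] [Module ℝ F]
    {Φ : F → ℝ} (hΦ : IsMinkowskiNorm Φ) : Φ 0 = 0 := by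
  simpa using hΦ.1.2.1 0 0 le_rfl

lemma mink_convex {F : Type*} [AddCommGroup F] [Module ℝ F]
    {Φ : F → ℝ} (hΦ : IsMinkowskiNorm Φ) : ConvexOn ℝ univ Φ := by
  refine ⟨convex_univ, fun x _ y _ a b ha hb _ => ?_⟩
  refine (hΦ.1.2.2 _ _).trans ?_
  rw [hΦ.1.2.1 a x ha, hΦ.1.2.1 b y hb]; simp

lemma mink_cont {F : Type*} [NormedAddCommGroup F] [NormedSpace ℝ F] [FiniteDimensional ℝ F]
    {Φ : F → ℝ} (hΦ : IsMinkowskiNorm Φ) : Continuous Φ :=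
  (mink_convex hΦ).locallyLipschitz.continuous

lemma mink_bounds {F : Type*} [NormedAddCommGroup F] [NormedSpace ℝ F] [FiniteDimensional ℝ F]
    {Φ : F → ℝ} (hΦ : IsMinkowskiNorm Φ) :
    ∃ c C : ℝ, 0 < c ∧ 0 < C ∧ (∀ x, c * ‖x‖ ≤ Φ x) ∧ ∀ x, Φ x ≤ C * ‖x‖ := by
  have hcont := mink_cont hΦ
  have := FiniteDimensional.proper_real F
  rcases subsingleton_or_nontrivial F with hs | hs
  · refine ⟨1, 1, one_pos, one_pos, fun x => ?_, fun x => ?_⟩ <;>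
      simp [Subsingleton.elim x 0, mink_zero hΦ]
  have hne : (Metric.sphere (0 : F) 1).Nonempty := NormedSpace.sphere_nonempty.2 zero_le_one
  obtain ⟨a, ha, hamin⟩ := (isCompact_sphere (0 : F) 1).exists_isMinOn hne hcont.continuousOn
  obtain ⟨b, hb, hbmax⟩ := (isCompact_sphere (0 : F) 1).exists_isMaxOn hne hcont.continuousOn
  have hp : ∀ x ∈ Metric.sphere (0 : F) 1, 0 < Φ x := fun x hx => hΦ.2 x (by
    rintro rfl; simp at hx)
  have key : ∀ x : F, x ≠ 0 → ‖x‖⁻¹ • x ∈ Metric.sphere (0 : F) 1 ∧ Φ x = ‖x‖ * Φ (‖x‖⁻¹ • x) := by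
    intro x hx
    have hx' : ‖x‖ ≠ 0 := norm_ne_zero_iff.2 hx
    refine ⟨by simp [norm_smul, hx'], ?_⟩
    rw [hΦ.1.2.1 _ _ (by positivity)]; field_simp
  refine ⟨Φ a, Φ b, hp a ha, hp b hb, fun x => ?_, fun x => ?_⟩
  · by_cases hx : x = 0
    · simp [hx, mink_zero hΦ]
    · rw [(key x hx).2, mul_comm]
      exact mul_le_mul_of_nonneg_left (hamin (key x hx).1) (norm_nonneg _)
  · by_cases hx : x = 0
    · simp [hx, mink_zero hΦ]
    · rw [(key x hx).2, mul_comm (Φ b)]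
      exact mul_le_mul_of_nonneg_left (hbmax (key x hx).1) (norm_nonneg _)

local notation "ip" => inner ℝ

/-- iteration lemma -/
lemma iter_contract {E : Type*} [NormedAddCommGroup E] [InnerProductSpace ℝ E]
    [FiniteDimensional ℝ E] {N : E → ℝ} (hN : IsMinkowskiNorm N) (h b : E)
    (hT : ∀ x, N (x - ip h x • b) ≤ N x) (hsm : |ip h b| < 1) :
    0 ≤ ip h b ∧ ∀ x, N (ip h b • x - ip h x • b) ≤ ip h b * N x := by
  set m : ℝ := ip h b with hm
  by_cases hb : b = 0
  · subst hb
    simp at hm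
    simp [hm, mink_zero hN]
  by_cases hh : h = 0
  · subst hh
    simp at hm
    simp [hm, mink_zero hN]
  have hcont := mink_cont hN
  obtain ⟨hm1, hm2⟩ := abs_lt.1 hsm
  -- iterates
  have hit : ∀ (n : ℕ) (x : E), ∃ y : E, N y ≤ N x ∧ ip h y = (1 - m) ^ n * ip h x ∧
      m • y = m • x - ((1 - (1 - m) ^ n) * ip h x) • b ∧
      (m = 0 → y = x - (n * ip h x) • b) := by
    intro n x
    induction n with
    | zero => exact ⟨x, le_rfl, by simp, by simp, by simp⟩
    | succ n ih =>
      obtain ⟨y, h1, h2, h3, h4⟩ := ih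
      refine ⟨y - ip h y • b, (hT y).trans h1, ?_, ?_, ?_⟩
      · rw [inner_sub_right, inner_smul_right, ← hm, h2]; ring
      · rw [smul_sub, h3, h2]; module
      · intro hm0
        have h2' : ip h y = ip h x := by rw [h2, hm0]; simp
        rw [h2', h4 hm0]; push_cast; module
  have hm0 : 0 ≤ m := by
    by_contra hneg
    push Not at hneg
    have hlim : Tendsto (fun n : ℕ => (1 - m) ^ n) atTop atTop :=
      tendsto_pow_atTop_atTop_of_one_lt (by linarith)
    obtain ⟨n, hn⟩ := (hlim.eventually_gt_atTop 1).exists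
    obtain ⟨y, h1, -, h3, -⟩ := hit n b
    have : y = (1 - m) ^ n • b := by
      have : m • y = m • ((1 - m) ^ n • b) := by rw [h3, ← hm]; module
      exact smul_right_injective E hneg.ne this
    rw [this, hN.1.2.1 _ _ (by positivity)] at h1
    nlinarith [hN.2 b hb]
  refine ⟨hm0, fun x => ?_⟩
  rcases hm0.eq_or_lt with hmz | hmp
  · exfalso
    obtain ⟨c, C, hc, hC, hlow, hup⟩ := mink_bounds hN
    have hhp : 0 < ip h h := by
      rw [real_inner_self_eq_norm_sq]; have := norm_pos_iff.2 hh; positivity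
    have hbp := norm_pos_iff.2 hb
    obtain ⟨n, hn⟩ := exists_nat_gt ((N h / c + ‖h‖) / (ip h h * ‖b‖))
    obtain ⟨y, h1, -, -, h4⟩ := hit n h
    have h4 := h4 hmz.symm
    have e1 : ‖(n * ip h h) • b‖ ≤ ‖h‖ + ‖y‖ := by
      have : (n * ip h h) • b = h - y := by rw [h4]; module
      rw [this]; exact norm_sub_le _ _
    rw [norm_smul, Real.norm_of_nonneg (by positivity)] at e1
    have e2 : ‖y‖ ≤ N h / c := by
      rw [le_div_iff₀ hc]; linarith [hlow y]
    rw [div_lt_iff₀ (by positivity)] at hn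
    nlinarith
  · have hlim : Tendsto (fun n : ℕ => N (m • x - ((1 - (1 - m) ^ n) * ip h x) • b)) atTop
        (𝓝 (N (m • x - ((1 - 0) * ip h x) • b))) := by
      have h0 : Tendsto (fun n : ℕ => (1 - m) ^ n) atTop (𝓝 0) :=
        tendsto_pow_atTop_nhds_zero_of_lt_one (by linarith) (by linarith)
      exact (hcont.tendsto _).comp
        (tendsto_const_nhds.sub (((tendsto_const_nhds.sub h0).mul_const _).smul_const b))
    have := le_of_tendsto' hlim (b := m * N x) (fun n => by
      obtain ⟨y, h1, -, h3, -⟩ := hit n x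
      rw [← h3, hN.1.2.1 _ _ hm0]
      exact mul_le_mul_of_nonneg_left h1 hm0)
    simpa using this

/-- approximate cone condition -/
def GoodDir {E : Type*} [NormedAddCommGroup E] [InnerProductSpace ℝ E]
    (φ : E → ℝ) (κ ε : ℝ) (h D : E) : Prop :=
  κ * (‖h‖ * ‖D‖) ≤ ip h D ∧
    ∀ x, φ (ip h D • x - ip h x • D) ≤ ip h D * (φ x + ε * ‖x‖)

lemma mink_graph {E : Type*} [NormedAddCommGroup E] [InnerProductSpace ℝ E]
    {Ψ : E × ℝ → ℝ} (hΨ : IsMinkowskiNorm Ψ) (g : E) :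
    IsMinkowskiNorm (fun x : E => Ψ (x, ip g x)) := by
  refine ⟨⟨fun x => hΨ.1.1 _, fun c x hc => ?_, fun x y => ?_⟩, fun x hx => hΨ.2 _ ?_⟩
  · show Ψ (c • x, ip g (c • x)) = c * Ψ (x, ip g x)
    rw [← hΨ.1.2.1 c _ hc]; simp [inner_smul_right]
  · have := hΨ.1.2.2 (x, ip g x) (y, ip g y)
    simpa [inner_add_right] using this
  · intro h; exact hx (congrArg Prod.fst h)

lemma comp_contract {E : Type*} [NormedAddCommGroup E] [InnerProductSpace ℝ E]
    {Ψ : E × ℝ → ℝ} (f g zf zg : E)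
    (hf : ∀ (x : E) (s : ℝ), Ψ (x + (s - ip f x) • zf, ip f (x + (s - ip f x) • zf)) ≤ Ψ (x, s))
    (hg : ∀ (x : E) (s : ℝ), Ψ (x + (s - ip g x) • zg, ip g (x + (s - ip g x) • zg)) ≤ Ψ (x, s))
    (x : E) :
    Ψ (x - ip (f - g) x • (zf - zg + ip (f - g) zf • zg),
      ip g (x - ip (f - g) x • (zf - zg + ip (f - g) zf • zg))) ≤ Ψ (x, ip g x) := by
  have h1 := hf x (ip g x)
  set y := x + (ip g x - ip f x) • zf with hy
  have h2 := hg y (ip f y)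
  have : y + (ip f y - ip g y) • zg =
      x - ip (f - g) x • (zf - zg + ip (f - g) zf • zg) := by
    rw [hy]
    simp only [inner_add_right, inner_smul_right, inner_sub_left]
    module
  rw [this] at h2
  exact h2.trans h1

lemma comp_alg {E : Type*} [NormedAddCommGroup E] [InnerProductSpace ℝ E]
    (f g zf zg wf wg : E) (hf : 1 - ip f zf ≠ 0) (hg : 1 - ip g zg ≠ 0)
    (hwf : wf = (1 - ip f zf)⁻¹ • zf) (hwg : wg = (1 - ip g zg)⁻¹ • zg) :
    zf - zg + ip (f - g) zf • zg = ((1 - ip f zf) * (1 - ip g zg)) •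
      ((1 + ip g wg) • (wf - wg) - ip g (wf - wg) • wg) := by
  subst hwf hwg
  simp only [inner_sub_left, inner_sub_right, inner_smul_right]
  match_scalars <;> field_simp <;> ring

set_option maxHeartbeats 2000000 in
lemma approx_cone {E : Type*} [NormedAddCommGroup E] [InnerProductSpace ℝ E]
    [FiniteDimensional ℝ E] {Ψ : E × ℝ → ℝ} (hΨ : IsMinkowskiNorm Ψ) {δ : ℝ} (hδ : 0 < δ)
    (z : E → E) (hz : ∀ f : E, ‖f‖ < δ → ∀ (x : E) (s : ℝ),
      Ψ (x + (s - ip f x) • z f, ip f (x + (s - ip f x) • z f)) ≤ Ψ (x, s)) :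
    ∃ δ₁ M κ : ℝ, 0 < δ₁ ∧ δ₁ ≤ δ ∧ 0 < κ ∧
      (∀ f : E, ‖f‖ < δ₁ → 1 / 2 ≤ 1 - ip f (z f) ∧ ‖(1 - ip f (z f))⁻¹ • z f‖ ≤ M) ∧
      ∀ ε > 0, ∃ ρ : ℝ, 0 < ρ ∧ ρ ≤ δ₁ ∧ ∀ f g : E, ‖f‖ < ρ → ‖g‖ < ρ →
        GoodDir (fun x => Ψ (x, 0)) κ ε (f - g)
          ((1 - ip f (z f))⁻¹ • z f - (1 - ip g (z g))⁻¹ • z g) := by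
  obtain ⟨c, C, hc, hC, hlow, hup⟩ := mink_bounds hΨ
  set M := C / c with hM
  have hMp : 0 < M := by positivity
  have hcM : c * M = C := by rw [hM]; field_simp
  have hzb : ∀ f : E, ‖f‖ < δ → ‖z f‖ ≤ M := by
    intro f hf
    have h1 := hz f hf 0 1
    simp only [inner_zero_right, sub_zero, one_smul, zero_add] at h1
    have h2 := hlow (z f, ip f (z f))
    have h3 := hup ((0 : E), (1 : ℝ))
    have h4 : ‖z f‖ ≤ ‖(z f, (ip f (z f) : ℝ))‖ := norm_fst_le (z f, (ip f (z f) : ℝ))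
    have h5 : ‖((0 : E), (1 : ℝ))‖ = 1 := by simp [Prod.norm_def]
    rw [h5] at h3
    rw [hM, le_div_iff₀ hc]
    nlinarith
  set δ₁ := min (min δ 1) (1 / (8 * (M + 1))) with hδ₁
  have hδ₁p : 0 < δ₁ := by positivity
  have hd1 : δ₁ ≤ δ := (min_le_left _ _).trans (min_le_left _ _)
  have hd2 : δ₁ ≤ 1 := (min_le_left _ _).trans (min_le_right _ _)
  have hd3 : δ₁ * (8 * (M + 1)) ≤ 1 := by
    rw [← le_div_iff₀ (by positivity)]; exact min_le_right _ _
  set w : E → E := fun f => (1 - ip f (z f))⁻¹ • z f with hw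
  have hsm : ∀ f : E, ‖f‖ < δ₁ → |ip f (z f)| ≤ 1 / 8 := by
    intro f hf
    refine (abs_real_inner_le_norm _ _).trans ?_
    have := hzb f (hf.trans_le hd1)
    have := mul_le_mul hf.le this (norm_nonneg _) hδ₁p.le
    nlinarith
  have hhalf : ∀ f : E, ‖f‖ < δ₁ → 1 / 2 ≤ 1 - ip f (z f) := by
    intro f hf
    have := (abs_le.1 (hsm f hf)).2
    linarith
  have hwb : ∀ f : E, ‖f‖ < δ₁ → ‖w f‖ ≤ 2 * M := by
    intro f hf
    have h1 := hhalf f hf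
    have h2 := hzb f (hf.trans_le hd1)
    simp only [hw]
    rw [norm_smul, norm_inv, Real.norm_of_nonneg (by linarith)]
    have : (1 - (ip f (z f) : ℝ))⁻¹ ≤ 2 := by
      rw [inv_le_comm₀ (by linarith) (by norm_num)]; linarith
    exact mul_le_mul this h2 (norm_nonneg _) (by norm_num)
  set κ₀ := c / (C + c) with hκ₀
  have hκ₀p : 0 < κ₀ := by positivity
  have hκ₀1 : κ₀ ≤ 1 := by rw [hκ₀, div_le_one (by positivity)]; linarith
  refine ⟨δ₁, 2 * M, κ₀ / 2, hδ₁p, hd1, by positivity, fun f hf => ⟨hhalf f hf, hwb f hf⟩, ?_⟩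
  intro ε hε
  -- choose rho
  set ρ := min δ₁ (min (κ₀ / (16 * (M + 1))) (ε * κ₀ / (16 * C * (4 * M + 1)))) with hρ
  have hρp : 0 < ρ := by positivity
  have hρ1 : ρ ≤ δ₁ := min_le_left _ _
  have hρ2 : ρ * (16 * (M + 1)) ≤ κ₀ := by
    rw [← le_div_iff₀ (by positivity)]; exact (min_le_right _ _).trans (min_le_left _ _)
  have hρ3 : ρ * (16 * C * (4 * M + 1)) ≤ ε * κ₀ := by
    rw [← le_div_iff₀ (by positivity)]; exact (min_le_right _ _).trans (min_le_right _ _)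
  refine ⟨ρ, hρp, hρ1, fun f g hf hg => ?_⟩
  set h := f - g with hh
  set D := w f - w g with hD
  show GoodDir _ _ _ h D
  have hf1 := hf.trans_le hρ1
  have hg1 := hg.trans_le hρ1
  set b' := (1 + ip g (w g)) • D - ip g D • w g with hb'
  have hcomp := comp_contract f g (z f) (z g) (hz f (hf1.trans_le hd1)) (hz g (hg1.trans_le hd1))
  have halg := comp_alg f g (z f) (z g) (w f) (w g) (by linarith [hhalf f hf1])
    (by linarith [hhalf g hg1]) rfl rfl
  set b := z f - z g + ip h (z f) • z g with hb
  set p := (1 - (ip f (z f) : ℝ)) * (1 - ip g (z g)) with hp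
  have hpp : 0 < p := mul_pos (by linarith [hhalf f hf1]) (by linarith [hhalf g hg1])
  have hhn : ‖h‖ ≤ 2 * δ₁ := (norm_sub_le _ _).trans (by linarith)
  have hzf := hzb f (hf1.trans_le hd1)
  have hzg := hzb g (hg1.trans_le hd1)
  have hbn : |ip h b| < 1 := by
    refine (abs_real_inner_le_norm _ _).trans_lt ?_
    have e1 : ‖b‖ ≤ 3 * M := by
      have e2 : |ip h (z f)| ≤ 1 := by
        refine (abs_real_inner_le_norm _ _).trans ?_
        have := mul_le_mul hhn hzf (norm_nonneg _) (by positivity)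
        nlinarith
      have e3 : ‖ip h (z f) • z g‖ ≤ 1 * M := by
        rw [norm_smul]; exact mul_le_mul e2 hzg (norm_nonneg _) zero_le_one
      have e4 := norm_add_le (z f - z g) (ip h (z f) • z g)
      have e5 := norm_sub_le (z f) (z g)
      rw [hb]; linarith
    have := mul_le_mul hhn e1 (norm_nonneg _) (by positivity)
    nlinarith
  obtain ⟨hm0, hmain⟩ := iter_contract (mink_graph hΨ g) h b hcomp hbn
  have hib : ip h b = p * ip h b' := by rw [halg, inner_smul_right]
  have hib0 : 0 ≤ ip h b' := by
    rw [hib] at hm0; exact nonneg_of_mul_nonneg_right hm0 hpp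
  have hmain' : ∀ x, Ψ (ip h b' • x - ip h x • b', ip g (ip h b' • x - ip h x • b'))
      ≤ ip h b' * Ψ (x, ip g x) := by
    intro x
    have h1 := hmain x
    have e1 : ip h b • x - ip h x • b = p • (ip h b' • x - ip h x • b') := by
      rw [hib, halg]; module
    rw [e1, inner_smul_right, hib] at h1
    have e2 := hΨ.1.2.1 p (ip h b' • x - ip h x • b', ip g (ip h b' • x - ip h x • b')) hpp.le
    simp only [Prod.smul_mk, smul_eq_mul] at e2
    rw [e2] at h1
    have : p * Ψ (ip h b' • x - ip h x • b', ip g (ip h b' • x - ip h x • b')) ≤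
      p * (ip h b' * Ψ (x, ip g x)) := by linarith
    exact le_of_mul_le_mul_left this hpp
  -- norms
  set θ := 4 * M * ρ with hθ
  have hθp : 0 < θ := by positivity
  have hθκ : θ ≤ κ₀ / 4 := by nlinarith
  have hwg := hwb g hg1
  have hgw : ‖g‖ * ‖w g‖ ≤ 2 * M * ρ := by
    have := mul_le_mul hg.le hwg (norm_nonneg _) hρp.le
    linarith
  have hdiff : ‖b' - D‖ ≤ θ * ‖D‖ := by
    have e1 : b' - D = ip g (w g) • D - ip g D • w g := by rw [hb']; module
    rw [e1]
    refine (norm_sub_le _ _).trans ?_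
    rw [norm_smul, norm_smul]
    have e2 := mul_le_mul_of_nonneg_right (norm_inner_le_norm (𝕜 := ℝ) g (w g)) (norm_nonneg D)
    have e3 := mul_le_mul_of_nonneg_right (norm_inner_le_norm (𝕜 := ℝ) g D) (norm_nonneg (w g))
    have e4 := mul_le_mul_of_nonneg_right hgw (norm_nonneg D)
    nlinarith
  set H := ‖h‖ * ‖D‖ with hH
  have hH0 : 0 ≤ H := by positivity
  have hinn : |ip h b' - ip h D| ≤ θ * H := by
    rw [← inner_sub_right]
    refine (abs_real_inner_le_norm _ _).trans ?_
    have := mul_le_mul_of_nonneg_left hdiff (norm_nonneg h)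
    rw [hH]; linarith
  obtain ⟨hinn1, hinn2⟩ := abs_le.1 hinn
  have hg1' : ‖g‖ ≤ 1 := by linarith
  have hgr : ∀ x : E, ‖(x, (ip g x : ℝ))‖ ≤ ‖x‖ := by
    intro x
    rw [Prod.norm_def]
    refine max_le le_rfl ((norm_inner_le_norm (𝕜 := ℝ) g x).trans ?_)
    exact mul_le_of_le_one_left (norm_nonneg x) hg1'
  -- coercivity
  have hco : κ₀ * (‖h‖ * ‖b'‖) ≤ ip h b' := by
    by_cases h0 : h = 0
    · rw [h0]; simp
    have hhp := norm_pos_iff.2 h0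
    have e1 := hmain' h
    have e2 := hlow (ip h b' • h - ip h h • b', ip g (ip h b' • h - ip h h • b'))
    have e3 : ‖ip h b' • h - ip h h • b'‖ ≤ ‖(ip h b' • h - ip h h • b', (ip g (ip h b' • h - ip h h • b') : ℝ))‖ :=
      norm_fst_le (ip h b' • h - ip h h • b', (ip g (ip h b' • h - ip h h • b') : ℝ))
    have e4 : ‖h‖ ^ 2 * ‖b'‖ - ip h b' * ‖h‖ ≤ ‖ip h b' • h - ip h h • b'‖ := by
      have := norm_sub_norm_le (ip h h • b') (ip h b' • h)
      rw [norm_sub_rev, norm_smul, norm_smul, real_inner_self_eq_norm_sq, Real.norm_of_nonneg hib0,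
        Real.norm_of_nonneg (by positivity)] at this
      rw [real_inner_self_eq_norm_sq]; exact this
    have e5 := (hup (h, ip g h)).trans (mul_le_mul_of_nonneg_left (hgr h) hC.le)
    have e6 := mul_le_mul_of_nonneg_left e5 hib0
    have e7 := mul_le_mul_of_nonneg_left (e4.trans e3) hc.le
    have e8 : ‖h‖ * (c * (‖h‖ * ‖b'‖)) ≤ ‖h‖ * (ip h b' * (C + c)) := by nlinarith
    have e9 := le_of_mul_le_mul_left e8 hhp
    rw [hκ₀, div_mul_eq_mul_div, div_le_iff₀ (by positivity)]
    exact e9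
  have hbD : ‖D‖ * (1 - θ) ≤ ‖b'‖ := by
    have := norm_sub_norm_le D b'
    have h2 : ‖D - b'‖ = ‖b' - D‖ := norm_sub_rev D b'
    linarith
  have hbD2 : ‖b'‖ ≤ 2 * ‖D‖ := by
    have := norm_sub_norm_le b' D
    nlinarith [norm_nonneg D]
  have hcoD : κ₀ / 2 * H ≤ ip h D := by
    have e1 : H * (1 - θ) ≤ ‖h‖ * ‖b'‖ := by
      have := mul_le_mul_of_nonneg_left hbD (norm_nonneg h)
      rw [hH]; linarith
    have e2 := mul_le_mul_of_nonneg_left e1 hκ₀p.le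
    nlinarith [mul_nonneg hH0 hκ₀p.le, mul_le_mul_of_nonneg_right hθκ hH0]
  refine ⟨hcoD, fun x => ?_⟩
  show Ψ (ip h D • x - ip h x • D, 0) ≤ ip h D * (Ψ (x, 0) + ε * ‖x‖)
  set y := ip h D • x - ip h x • D with hy
  set y' := ip h b' • x - ip h x • b' with hy'
  have hyy : ‖y - y'‖ ≤ 2 * θ * H * ‖x‖ := by
    have e1 : y - y' = (ip h D - ip h b') • x + ip h x • (b' - D) := by rw [hy, hy']; module
    rw [e1]
    refine (norm_add_le _ _).trans ?_
    rw [norm_smul, norm_smul, Real.norm_eq_abs, abs_sub_comm]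
    have e2 := mul_le_mul_of_nonneg_right hinn (norm_nonneg x)
    have e3 := mul_le_mul (norm_inner_le_norm (𝕜 := ℝ) h x) hdiff (norm_nonneg _) (by positivity)
    rw [hH] at *
    linarith
  have hy'n : ‖y'‖ ≤ 4 * H * ‖x‖ := by
    refine (norm_sub_le _ _).trans ?_
    rw [norm_smul, norm_smul]
    have e2 := mul_le_mul_of_nonneg_right (norm_inner_le_norm (𝕜 := ℝ) h b') (norm_nonneg x)
    have e3 := mul_le_mul_of_nonneg_right (norm_inner_le_norm (𝕜 := ℝ) h x) (norm_nonneg b')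
    have e4 := mul_le_mul_of_nonneg_left hbD2 (mul_nonneg (norm_nonneg h) (norm_nonneg x))
    rw [hH]
    linarith
  have hd0 : ∀ (x : E) (s : ℝ), ‖((x, (0 : ℝ)) - (x, s) : E × ℝ)‖ = |s| := by
    intro x s; simp [Prod.norm_def]
  have s1 : Ψ (y, 0) ≤ Ψ (y', 0) + C * (2 * θ * H * ‖x‖) := by
    have := mink_lip hΨ hup (y, 0) (y', 0)
    have e : ‖((y, (0 : ℝ)) - (y', 0) : E × ℝ)‖ = ‖y - y'‖ := by simp [Prod.norm_def]
    rw [e] at this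
    linarith [mul_le_mul_of_nonneg_left hyy hC.le]
  have gb : ∀ x : E, |(ip g x : ℝ)| ≤ ρ * ‖x‖ := fun x =>
    (abs_real_inner_le_norm g x).trans (mul_le_mul_of_nonneg_right hg.le (norm_nonneg _))
  have s2 : Ψ (y', 0) ≤ Ψ (y', ip g y') + C * (ρ * (4 * H * ‖x‖)) := by
    have := mink_lip hΨ hup (y', 0) (y', ip g y')
    rw [hd0] at this
    have e := (gb y').trans (mul_le_mul_of_nonneg_left hy'n hρp.le)
    linarith [mul_le_mul_of_nonneg_left e hC.le]
  have s3 : Ψ (x, ip g x) ≤ Ψ (x, 0) + C * (ρ * ‖x‖) := by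
    have := mink_lip hΨ hup (x, ip g x) (x, 0)
    rw [norm_sub_rev, hd0] at this
    linarith [mul_le_mul_of_nonneg_left (gb x) hC.le]
  have s4 : Ψ (x, 0) ≤ C * ‖x‖ := by
    have := hup (x, 0)
    simpa [Prod.norm_def] using this
  have s5 := hmain' x
  have s6 : ip h b' ≤ 2 * H := by
    refine (real_inner_le_norm _ _).trans ?_
    have := mul_le_mul_of_nonneg_left hbD2 (norm_nonneg h)
    rw [hH]; linarith
  have hx0 := norm_nonneg x
  have hCx : 0 ≤ C * (ρ * ‖x‖) := by positivity
  have s7 : ip h b' * Ψ (x, ip g x) ≤ ip h b' * Ψ (x, 0) + 2 * H * (C * (ρ * ‖x‖)) := by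
    have e1 := mul_le_mul_of_nonneg_left s3 hib0
    have e2 := mul_le_mul_of_nonneg_right s6 hCx
    linarith
  have s8 : ip h b' * Ψ (x, 0) ≤ ip h D * Ψ (x, 0) + θ * H * (C * ‖x‖) := by
    have e1 : ip h b' * Ψ (x, 0) ≤ (ip h D + θ * H) * Ψ (x, 0) :=
      mul_le_mul_of_nonneg_right (by linarith) (hΨ.1.1 _)
    have e2 := mul_le_mul_of_nonneg_left s4 (mul_nonneg hθp.le hH0)
    linarith
  have s9 : C * (2 * θ * H * ‖x‖) + C * (ρ * (4 * H * ‖x‖)) + 2 * H * (C * (ρ * ‖x‖))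
      + θ * H * (C * ‖x‖) ≤ ip h D * (ε * ‖x‖) := by
    have e1 : C * (2 * θ * H * ‖x‖) + C * (ρ * (4 * H * ‖x‖)) + 2 * H * (C * (ρ * ‖x‖))
      + θ * H * (C * ‖x‖) = (C * (3 * θ + 6 * ρ)) * (H * ‖x‖) := by ring
    have e2 : C * (3 * θ + 6 * ρ) ≤ ε * (κ₀ / 2) := by
      rw [hθ]
      nlinarith [mul_pos hC hρp, mul_pos (mul_pos hC hρp) hMp]
    have e3 := mul_le_mul_of_nonneg_right hcoD (mul_nonneg hε.le hx0)
    have e4 := mul_le_mul_of_nonneg_right e2 (mul_nonneg hH0 hx0)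
    rw [e1]
    linarith
  linarith

lemma cont_of_mono {E : Type*} [NormedAddCommGroup E] [InnerProductSpace ℝ E]
    [FiniteDimensional ℝ E] (hE : 2 ≤ Module.finrank ℝ E) (w : E → E) {ρ κ M : ℝ} (hκ : 0 < κ)
    (hb : ∀ f : E, ‖f‖ < ρ → ‖w f‖ ≤ M)
    (hm : ∀ f g : E, ‖f‖ < ρ → ‖g‖ < ρ → κ * (‖f - g‖ * ‖w f - w g‖) ≤ ip (f - g) (w f - w g))
    (g : E) (hg : ‖g‖ < ρ) : ContinuousAt w g := by
  have hev : ∀ᶠ f in 𝓝 g, ‖f‖ < ρ := continuous_norm.continuousAt.eventually_lt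
    continuousAt_const hg
  have hcomp : ∀ U : Ultrafilter E, (U : Filter E) ≤ 𝓝 g → ∃ q, Tendsto w U (𝓝 q) := by
    intro U hU
    have h1 : ∀ᶠ f in (U : Filter E), w f ∈ Metric.closedBall (0 : E) M :=
      (hev.filter_mono hU).mono fun f hf => by simpa using hb f hf
    obtain ⟨q, -, hq⟩ := isCompact_iff_ultrafilter_le_nhds.1 (isCompact_closedBall (0 : E) M)
      (U.map w) (by
        simp only [le_principal_iff]; exact h1)
    exact ⟨q, hq⟩
  -- ray ultrafilter
  let T : Ultrafilter ℝ := Ultrafilter.of (𝓝[>] (0 : ℝ))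
  have hT : (T : Filter ℝ) ≤ 𝓝[>] (0 : ℝ) := Ultrafilter.of_le _
  have hray : ∀ u : E, Tendsto (fun t : ℝ => g + t • u) T (𝓝 g) := by
    intro u
    have : Tendsto (fun t : ℝ => g + t • u) (𝓝 0) (𝓝 (g + (0 : ℝ) • u)) := by
      apply Continuous.tendsto; fun_prop
    simp only [zero_smul, add_zero] at this
    exact this.mono_left (hT.trans nhdsWithin_le_nhds)
  have hex : ∀ u : E, ∃ p, Tendsto (fun t : ℝ => w (g + t • u)) T (𝓝 p) := fun u =>
    hcomp (T.map (fun t : ℝ => g + t • u)) (hray u)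
  choose p hp using hex
  have key : ∀ (U : Ultrafilter E) (q : E), (U : Filter E) ≤ 𝓝 g → Tendsto w U (𝓝 q) →
      ∀ u : E, ‖u‖ = 1 → κ * ‖p u - q‖ ≤ ip u (p u - q) := by
    intro U q hU hq u hu
    have h1 : ∀ᶠ t in (T : Filter ℝ), κ * ‖w (g + t • u) - q‖ ≤ ip u (w (g + t • u) - q) := by
      have hpos : ∀ᶠ t in (T : Filter ℝ), 0 < t :=
        (self_mem_nhdsWithin : Ioi (0 : ℝ) ∈ 𝓝[>] 0) |> fun h => hT h
      filter_upwards [hpos, (hray u).eventually hev] with t ht htρ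
      have hid : Tendsto (fun f : E => f) U (𝓝 g) := hU
      have l1 : Tendsto (fun f => κ * (‖g + t • u - f‖ * ‖w (g + t • u) - w f‖)) U
          (𝓝 (κ * (‖g + t • u - g‖ * ‖w (g + t • u) - q‖))) :=
        ((tendsto_const_nhds.sub hid).norm.mul (tendsto_const_nhds.sub hq).norm).const_mul κ
      have l2 : Tendsto (fun f => (ip (g + t • u - f) (w (g + t • u) - w f) : ℝ)) U
          (𝓝 (ip (g + t • u - g) (w (g + t • u) - q))) :=
        (tendsto_const_nhds.sub hid).inner (tendsto_const_nhds.sub hq)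
      have h2 := le_of_tendsto_of_tendsto l1 l2
        ((hev.filter_mono hU).mono fun f hf => hm _ f htρ hf)
      rw [add_sub_cancel_left, norm_smul, hu, inner_smul_left, Real.norm_of_nonneg ht.le] at h2
      simp only [mul_one, conj_trivial] at h2
      exact le_of_mul_le_mul_left (by linarith) ht
    exact le_of_tendsto_of_tendsto (((hp u).sub_const q).norm.const_mul κ)
      (tendsto_const_nhds.inner ((hp u).sub_const q)) h1
  have key2 : ∀ u u' : E, ‖u‖ = 1 → ‖u'‖ = 1 → κ * ‖p u - p u'‖ ≤ ip u (p u - p u') :=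
    fun u u' hu _ => key (T.map (fun t : ℝ => g + t • u')) (p u') (hray u') (hp u') u hu
  have hloc : ∀ u u' : E, ‖u‖ = 1 → ‖u'‖ = 1 → ‖u - u'‖ < 2 * κ → p u = p u' := by
    intro u u' hu hu' hd
    have h1 := key2 u u' hu hu'
    have h2 := key2 u' u hu' hu
    have h3 : ip (u - u') (p u - p u') = ip u (p u - p u') + ip u' (p u' - p u) := by
      rw [inner_sub_left, ← neg_sub (p u) (p u'), inner_neg_right]; ring
    have h4 := real_inner_le_norm (u - u') (p u - p u')
    rw [norm_sub_rev] at h2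
    by_contra hne
    have : 0 < ‖p u - p u'‖ := norm_pos_iff.2 (sub_ne_zero.2 hne)
    nlinarith
  have hconn : IsPreconnected (Metric.sphere (0 : E) 1) := isPreconnected_sphere (by
    rw [← Module.finrank_eq_rank]; exact_mod_cast hE) 0 1
  have hconst : ∀ u u' : E, ‖u‖ = 1 → ‖u'‖ = 1 → p u = p u' := by
    intro u u' hu hu'
    let F : Metric.sphere (0 : E) 1 → E := fun u => p u.1
    have hF : IsLocallyConstant F := by
      rw [IsLocallyConstant.iff_eventually_eq]
      intro a
      filter_upwards [Metric.ball_mem_nhds a (by positivity : 0 < 2 * κ)] with y hy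
      have hy' : ‖y.1 - a.1‖ < 2 * κ := by
        have := hy; rw [Metric.mem_ball, Subtype.dist_eq, dist_eq_norm] at this; exact this
      exact hloc y.1 a.1 (by simpa using y.2) (by simpa using a.2) hy'
    have := isPreconnected_iff_preconnectedSpace.1 hconn
    exact hF.apply_eq_of_isPreconnected isPreconnected_univ
      (x := ⟨u, by simpa using hu⟩) (y := ⟨u', by simpa using hu'⟩) trivial trivial
  have hnt : Nontrivial E := Module.nontrivial_of_finrank_pos (R := ℝ) (by omega)
  obtain ⟨u, hu⟩ := exists_norm_eq E (zero_le_one)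
  have hall : ∀ (U : Ultrafilter E) (q : E), (U : Filter E) ≤ 𝓝 g → Tendsto w U (𝓝 q) →
      q = p u := by
    intro U q hU hq
    have hun : ‖-u‖ = 1 := by rw [norm_neg, hu]
    have h1 := key U q hU hq u hu
    have h2 := key U q hU hq (-u) hun
    rw [hconst (-u) u hun hu, inner_neg_left] at h2
    have h3 : κ * ‖p u - q‖ ≤ 0 := by linarith
    have h4 : ‖p u - q‖ ≤ 0 := by
      by_contra hc; push Not at hc; nlinarith
    exact (sub_eq_zero.1 (norm_le_zero_iff.1 h4)).symm
  have hgp : w g = p u := hall (pure g) (w g) (pure_le_nhds g) (tendsto_pure_nhds w g)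
  rw [ContinuousAt, tendsto_iff_ultrafilter]
  intro U hU
  obtain ⟨q, hq⟩ := hcomp U hU
  rw [hgp, ← hall U q hU hq]
  exact hq

lemma good_smul_right {E : Type*} [NormedAddCommGroup E] [InnerProductSpace ℝ E]
    {φ : E → ℝ} (hφ : IsMinkowskiNorm φ) {κ ε : ℝ} {h D : E} {c : ℝ} (hc : 0 ≤ c)
    (H : GoodDir φ κ ε h D) : GoodDir φ κ ε h (c • D) := by
  refine ⟨?_, fun x => ?_⟩
  · rw [norm_smul, inner_smul_right, Real.norm_of_nonneg hc]
    have := mul_le_mul_of_nonneg_left H.1 hc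
    linarith
  · have e : ip h (c • D) • x - ip h x • (c • D) = c • (ip h D • x - ip h x • D) := by
      rw [inner_smul_right]; module
    rw [e, hφ.1.2.1 _ _ hc, inner_smul_right]
    have := mul_le_mul_of_nonneg_left (H.2 x) hc
    linarith

lemma good_smul_left {E : Type*} [NormedAddCommGroup E] [InnerProductSpace ℝ E]
    {φ : E → ℝ} (hφ : IsMinkowskiNorm φ) {κ ε : ℝ} {h D : E} {t : ℝ} (ht : 0 < t)
    (H : GoodDir φ κ ε (t • h) D) : GoodDir φ κ ε h D := by
  refine ⟨?_, fun x => ?_⟩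
  · have := H.1
    rw [norm_smul, inner_smul_left, Real.norm_of_nonneg ht.le, conj_trivial] at this
    exact le_of_mul_le_mul_left (by linarith) ht
  · have := H.2 x
    have e : ip (t • h) D • x - ip (t • h) x • D = t • (ip h D • x - ip h x • D) := by
      rw [inner_smul_left, inner_smul_left, conj_trivial]; module
    rw [e, hφ.1.2.1 _ _ ht.le, inner_smul_left, conj_trivial] at this
    exact le_of_mul_le_mul_left (by linarith) ht

lemma good_convex {E : Type*} [NormedAddCommGroup E] [InnerProductSpace ℝ E]
    {φ : E → ℝ} (hφ : IsMinkowskiNorm φ) {κ ε : ℝ} (hκ : 0 ≤ κ) (h : E) :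
    Convex ℝ {D | GoodDir φ κ ε h D} := by
  have hadd : ∀ D D', GoodDir φ κ ε h D → GoodDir φ κ ε h D' → GoodDir φ κ ε h (D + D') := by
    intro D D' H H'
    refine ⟨?_, fun x => ?_⟩
    · have := mul_le_mul_of_nonneg_left
        (mul_le_mul_of_nonneg_left (norm_add_le D D') (norm_nonneg h)) hκ
      rw [inner_add_right]
      linarith [H.1, H'.1]
    · have e : ip h (D + D') • x - ip h x • (D + D') =
        (ip h D • x - ip h x • D) + (ip h D' • x - ip h x • D') := by
        rw [inner_add_right]; module
      rw [e, inner_add_right]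
      linarith [hφ.1.2.2 (ip h D • x - ip h x • D) (ip h D' • x - ip h x • D'), H.2 x, H'.2 x]
  intro D H D' H' a b ha hb _
  exact hadd _ _ (good_smul_right hφ ha H) (good_smul_right hφ hb H')

lemma good_closed {E : Type*} [NormedAddCommGroup E] [InnerProductSpace ℝ E]
    [FiniteDimensional ℝ E]
    {φ : E → ℝ} (hφ : IsMinkowskiNorm φ) (κ ε : ℝ) (h : E) :
    IsClosed {D | GoodDir φ κ ε h D} := by
  have hc := mink_cont hφ
  have e : {D | GoodDir φ κ ε h D} = {D | κ * (‖h‖ * ‖D‖) ≤ ip h D} ∩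
    ⋂ x, {D | φ (ip h D • x - ip h x • D) ≤ ip h D * (φ x + ε * ‖x‖)} := by
    ext D; simp [GoodDir]
  rw [e]
  refine (isClosed_le (by fun_prop) (by fun_prop)).inter (isClosed_iInter fun x => ?_)
  exact isClosed_le (hc.comp (by fun_prop)) (by fun_prop)

open MeasureTheory Convolution in
lemma mollify {E : Type*} [NormedAddCommGroup E] [InnerProductSpace ℝ E]
    [FiniteDimensional ℝ E] {φ : E → ℝ} (hφ : IsMinkowskiNorm φ) {κ ε ρ : ℝ} (hκ : 0 ≤ κ)
    (w : E → E) (hc : ∀ f : E, ‖f‖ < ρ → ContinuousAt w f)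
    (hgood : ∀ f g : E, ‖f‖ < ρ → ‖g‖ < ρ → GoodDir φ κ ε (f - g) (w f - w g))
    (p q : E) (hp : ‖p‖ < ρ) (hq : ‖q‖ < ρ) (hpq : w p ≠ w q) :
    ∃ β : E →L[ℝ] E, β ≠ 0 ∧ ∀ u, GoodDir φ κ ε u (β u) := by
  borelize E
  let μ : Measure E := volume
  set r := max ‖p‖ ‖q‖ with hr
  have hrρ : r < ρ := max_lt hp hq
  set s := (ρ - r) / 3 with hs
  have hsp : 0 < s := by rw [hs]; linarith
  set R := r + 2 * s with hR
  have hRρ : R < ρ := by rw [hR, hs]; linarith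
  set wt : E → E := indicator (Metric.closedBall 0 R) w with hwt
  have hwt_eq : ∀ x : E, ‖x‖ ≤ R → wt x = w x := fun x hx =>
    indicator_of_mem (by simpa using hx) _
  have hint : Integrable wt μ := by
    rw [hwt, integrable_indicator_iff Metric.isClosed_closedBall.measurableSet]
    refine ContinuousOn.integrableOn_compact (isCompact_closedBall _ _) fun x hx => ?_
    exact (hc x (by rw [mem_closedBall_zero_iff] at hx; linarith)).continuousWithinAt
  set η := ‖w p - w q‖ / 3 with hη
  have hηp : 0 < η := by
    have := norm_pos_iff.2 (sub_ne_zero.2 hpq); positivity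
  have hcont : ∀ x : E, ‖x‖ ≤ r → ∃ σ > 0, σ ≤ s ∧ ∀ y ∈ Metric.ball x σ, dist (wt y) (wt x) ≤ η := by
    intro x hx
    obtain ⟨σ, hσ, h⟩ := Metric.continuousAt_iff.1 (hc x (by linarith)) η hηp
    refine ⟨min σ s, lt_min hσ hsp, min_le_right _ _, fun y hy => ?_⟩
    have hy1 : dist y x < σ := lt_of_lt_of_le hy (min_le_left _ _)
    have hy2 : dist y x < s := lt_of_lt_of_le hy (min_le_right _ _)
    rw [dist_eq_norm] at hy2
    have hyn : ‖y‖ ≤ ‖x‖ + ‖y - x‖ := by simpa using norm_add_le x (y - x)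
    rw [hwt_eq y (by linarith), hwt_eq x (by linarith)]
    exact (h hy1).le
  obtain ⟨σ₁, hσ₁, hσ₁s, h₁⟩ := hcont p (le_max_left _ _)
  obtain ⟨σ₂, hσ₂, hσ₂s, h₂⟩ := hcont q (le_max_right _ _)
  set σ := min σ₁ σ₂ with hσ
  have hσp : 0 < σ := lt_min hσ₁ hσ₂
  let bp : ContDiffBump (0 : E) := ⟨σ / 2, σ, by positivity, by linarith⟩
  set F : E → E := (bp.normed μ ⋆[ContinuousLinearMap.lsmul ℝ ℝ, μ] wt) with hF
  have hFp : dist (F p) (wt p) ≤ η := bp.dist_normed_convolution_le hint.aestronglyMeasurable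
    fun x hx => h₁ x (Metric.ball_subset_ball (min_le_left _ _) hx)
  have hFq : dist (F q) (wt q) ≤ η := bp.dist_normed_convolution_le hint.aestronglyMeasurable
    fun x hx => h₂ x (Metric.ball_subset_ball (min_le_right _ _) hx)
  have hFne : F p ≠ F q := by
    intro heq
    rw [hwt_eq p (by linarith [le_max_left ‖p‖ ‖q‖])] at hFp
    rw [hwt_eq q (by linarith [le_max_right ‖p‖ ‖q‖]), ← heq, dist_comm] at hFq
    have h3 := dist_triangle_left (w p) (w q) (F p)
    rw [dist_comm] at hFq
    rw [dist_eq_norm] at h3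
    have : ‖w p - w q‖ = 3 * η := by rw [hη]; ring
    linarith
  have hsm : ContDiff ℝ 1 F := by
    have := bp.hasCompactSupport_normed (μ := μ) |>.contDiff_convolution_left
      (n := 1) (ContinuousLinearMap.lsmul ℝ ℝ) (bp.contDiff_normed (n := 1)) hint.locallyIntegrable
    exact_mod_cast this
  have hdiff : Differentiable ℝ F := hsm.differentiable one_ne_zero
  set O := Metric.ball (0 : E) (r + s) with hO
  have hex : ∃ x ∈ O, fderiv ℝ F x ≠ 0 := by
    by_contra hcon
    push Not at hcon
    refine hFne (Metric.isOpen_ball.is_const_of_fderiv_eq_zero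
      (convex_ball (0 : E) (r + s)).isPreconnected hdiff.differentiableOn (fun x hx => hcon x hx) ?_ ?_)
    · rw [mem_ball_zero_iff]; linarith [le_max_left ‖p‖ ‖q‖]
    · rw [mem_ball_zero_iff]; linarith [le_max_right ‖p‖ ‖q‖]
  have hconv : ∀ x, Integrable (fun t => bp.normed μ t • wt (x - t)) μ := by
    intro x
    have := (bp.hasCompactSupport_normed (μ := μ)).convolutionExists_left
      (ContinuousLinearMap.lsmul ℝ ℝ) (bp.contDiff_normed (n := 0)).continuous
      hint.locallyIntegrable x
    exact this
  have hmem : ∀ x ∈ O, ∀ y ∈ O, GoodDir φ κ ε (x - y) (F x - F y) := by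
    intro x hx y hy
    rw [mem_ball_zero_iff] at hx hy
    have e1 : F x - F y = ∫ t, bp.normed μ t • (wt (x - t) - wt (y - t)) ∂μ := by
      simp only [smul_sub]
      rw [integral_sub (hconv x) (hconv y)]
      rfl
    set S := Metric.closedBall (0 : E) σ with hS
    have e2 : ∫ t, bp.normed μ t • (wt (x - t) - wt (y - t)) ∂μ =
        ∫ t in S, bp.normed μ t • (wt (x - t) - wt (y - t)) ∂μ := by
      rw [setIntegral_eq_integral_of_forall_compl_eq_zero]
      intro t ht
      have : bp.normed μ t = 0 := by
        have h3 : t ∉ Function.support (bp.normed μ) := by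
          rw [bp.support_normed_eq]
          exact fun h => ht (Metric.ball_subset_closedBall h)
        simpa using h3
      rw [this, zero_smul]
    have h0 : μ S ≠ 0 := (Metric.measure_closedBall_pos μ _ hσp).ne'
    have ht : μ S ≠ ⊤ := measure_closedBall_lt_top.ne
    have e3 : (⨍ t in S, bp.normed μ t • (wt (x - t) - wt (y - t)) ∂μ) ∈
        {D | GoodDir φ κ ε (x - y) D} := by
      refine (good_convex hφ hκ (x - y)).set_average_mem (good_closed hφ κ ε (x - y)) h0 ht ?_ ?_
      · refine (ae_restrict_iff' Metric.isClosed_closedBall.measurableSet).2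
          (Eventually.of_forall fun t htS => ?_)
        refine good_smul_right hφ (bp.nonneg_normed t) ?_
        rw [mem_closedBall_zero_iff] at htS
        have hσs : σ ≤ s := (min_le_left _ _).trans hσ₁s
        have hx' := norm_sub_le x t
        have hy' := norm_sub_le y t
        rw [hwt_eq _ (by linarith), hwt_eq _ (by linarith)]
        have := hgood (x - t) (y - t) (by linarith) (by linarith)
        rwa [sub_sub_sub_cancel_right] at this
      · refine Integrable.integrableOn ?_
        simp only [smul_sub]
        exact (hconv x).sub (hconv y)
    rw [setAverage_eq] at e3
    have e4 := good_smul_right hφ (c := μ.real S) measureReal_nonneg e3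
    rw [smul_smul, mul_inv_cancel₀, one_smul, ← e2, ← e1] at e4
    · exact e4
    · rw [Measure.real]; exact (ENNReal.toReal_pos h0 ht).ne'
  obtain ⟨x, hx, hβ⟩ := hex
  refine ⟨fderiv ℝ F x, hβ, fun u => ?_⟩
  have hline : HasDerivAt (fun t : ℝ => F (x + t • u)) (fderiv ℝ F x u) 0 :=
    (hdiff x).hasFDerivAt.hasLineDerivAt u
  have hlim := hline.tendsto_slope_zero_right
  refine (good_closed hφ κ ε u).mem_of_tendsto hlim ?_
  have hev : ∀ᶠ t : ℝ in 𝓝[>] 0, x + t • u ∈ O := by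
    refine Filter.Eventually.filter_mono nhdsWithin_le_nhds ?_
    have hcn : ContinuousAt (fun t : ℝ => x + t • u) 0 := by fun_prop
    exact hcn (Metric.isOpen_ball.mem_nhds (by
      show x + (0:ℝ) • u ∈ O; rw [zero_smul, add_zero]; exact hx))
  filter_upwards [hev, self_mem_nhdsWithin] with t ht htp
  have htp : 0 < t := htp
  simp only [zero_add, zero_smul, add_zero]
  refine good_smul_right hφ (by positivity) ?_
  have := hmem _ ht _ hx
  rw [add_sub_cancel_left] at this
  exact good_smul_left hφ htp this

theorem circ_step {E : Type*} [NormedAddCommGroup E] [InnerProductSpace ℝ E]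
    {φ : E → ℝ} (hφ : IsMinkowskiNorm φ) (q : E →ₗ[ℝ] E →ₗ[ℝ] ℝ)
    (hq : ∀ x y, φ (q y y • x - q y x • y) ≤ q y y * φ x)
    {x z : E} {a : ℝ} (hx : q x x = 1) (hz : q z z = 1) (hzx : q z x = a) (hxz : q x z = -a)
    (θ ε : ℝ) :
    (Real.cos ε + a * Real.sin ε) * φ (Real.cos θ • x + Real.sin θ • z) ≤
      φ (Real.cos (θ + ε) • x + Real.sin (θ + ε) • z) := by
  by_cases hneg : Real.cos ε + a * Real.sin ε < 0
  · exact (mul_nonpos_of_nonpos_of_nonneg hneg.le (hφ.1.1 _)).trans (hφ.1.1 _)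
  push Not at hneg
  have hcs := Real.sin_sq_add_cos_sq θ
  set c := Real.cos θ with hc
  set s := Real.sin θ with hs
  set C := Real.cos ε
  set S := Real.sin ε
  have h := hq (Real.cos (θ + ε) • x + Real.sin (θ + ε) • z)
    ((-a * c - s) • x + (-a * s + c) • z)
  rw [Real.cos_add, Real.sin_add] at *
  have hyy : q ((-a * c - s) • x + (-a * s + c) • z) ((-a * c - s) • x + (-a * s + c) • z)
      = a ^ 2 + 1 := by
    simp only [map_add, LinearMap.add_apply, map_smul, LinearMap.smul_apply, smul_eq_mul, hx, hz,
      hzx, hxz]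
    linear_combination (a^2+1) * hcs
  have hyx : q ((-a * c - s) • x + (-a * s + c) • z) ((c * C - s * S) • x + (s * C + c * S) • z)
      = S * (a ^ 2 + 1) := by
    simp only [map_add, LinearMap.add_apply, map_smul, LinearMap.smul_apply, smul_eq_mul, hx, hz,
      hzx, hxz]
    linear_combination S*(a^2+1) * hcs
  rw [hyy, hyx] at h
  have e : (a ^ 2 + 1) • ((c * C - s * S) • x + (s * C + c * S) • z) -
      (S * (a ^ 2 + 1)) • ((-a * c - s) • x + (-a * s + c) • z) =
      (a ^ 2 + 1) • ((C + a * S) • (c • x + s • z)) := by module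
  rw [e, hφ.1.2.1 _ _ (by positivity), hφ.1.2.1 _ _ hneg] at h
  exact le_of_mul_le_mul_left h (by positivity)

theorem circ_const {E : Type*} [NormedAddCommGroup E] [InnerProductSpace ℝ E]
    [FiniteDimensional ℝ E]
    {φ : E → ℝ} (hφ : IsMinkowskiNorm φ) (q : E →ₗ[ℝ] E →ₗ[ℝ] ℝ)
    (hq : ∀ x y, φ (q y y • x - q y x • y) ≤ q y y * φ x)
    {x z : E} (hx : q x x = 1) (hz : q z z = 1) (hxz : q x z + q z x = 0)
    (θ : ℝ) : φ (Real.cos θ • x + Real.sin θ • z) = φ x := by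
  have hstep := circ_step hφ q hq hx hz rfl (by linarith : q x z = - q z x)
  set a := q z x
  set R : ℝ → ℝ := fun θ => φ (Real.cos θ • x + Real.sin θ • z) with hR
  have hstep : ∀ θ ε, (Real.cos ε + a * Real.sin ε) * R θ ≤ R (θ + ε) := hstep
  have hcont : Continuous R := (mink_cont hφ).comp (by fun_prop)
  have hper : Function.Periodic R (2 * Real.pi) := fun t => by simp [hR]
  obtain ⟨t0, -, ht0⟩ := (isCompact_Icc (a := (0:ℝ)) (b := 2 * Real.pi)).exists_isMaxOn
    ⟨0, by simp; positivity⟩ hcont.continuousOn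
  have hmax : ∀ t, R t ≤ R t0 := fun t => by
    obtain ⟨y, hy, hy2⟩ := hper.exists_mem_Ico₀ (by positivity) t
    rw [hy2]; exact ht0 (Ico_subset_Icc_self hy)
  have hRpos : 0 < R t0 := by
    refine hφ.2 _ fun h0 => ?_
    have : q (Real.cos t0 • x + Real.sin t0 • z) (Real.cos t0 • x + Real.sin t0 • z) = 1 := by
      simp only [map_add, LinearMap.add_apply, map_smul, LinearMap.smul_apply, smul_eq_mul, hx, hz]
      linear_combination Real.sin_sq_add_cos_sq t0 + Real.cos t0 * Real.sin t0 * hxz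
    rw [h0] at this; simp at this
  have ha : a = 0 := by
    by_contra hne
    have h1 : ∀ ε, Real.cos ε + a * Real.sin ε ≤ 1 := fun ε => by
      have := (hstep t0 ε).trans (hmax _)
      nlinarith
    have hd : HasDerivAt (fun ε => Real.cos ε + a * Real.sin ε) (-Real.sin 0 + a * Real.cos 0) 0 :=
      (Real.hasDerivAt_cos 0).add ((Real.hasDerivAt_sin 0).const_mul a)
    have hm : IsLocalMax (fun ε => Real.cos ε + a * Real.sin ε) 0 :=
      Filter.Eventually.of_forall fun ε => by simpa using h1 ε
    have := hm.hasDerivAt_eq_zero hd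
    simp at this; exact hne this
  simp only [ha, zero_mul, add_zero] at hstep
  have hlow : ∀ t ε, R t - R (t + ε) ≤ R t0 / 2 * ε ^ 2 := fun t ε => by
    have h1 := hstep t ε
    have h2 := Real.one_sub_sq_div_two_le_cos (x := ε)
    have h3 := hmax t
    have h4 : 0 ≤ R t := hφ.1.1 _
    nlinarith [sq_nonneg ε, mul_nonneg h4 (sub_nonneg.2 h2), mul_nonneg (sub_nonneg.2 h3) (sq_nonneg ε)]
  have habs : ∀ t t', |R t' - R t| ≤ R t0 / 2 * (t' - t) ^ 2 := fun t t' => by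
    have h1 := hlow t (t' - t)
    have h2 := hlow t' (t - t')
    simp only [add_sub_cancel] at h1 h2
    rw [abs_le]; constructor <;> nlinarith
  have hder : ∀ t, HasDerivAt R 0 t := fun t => by
    rw [hasDerivAt_iff_isLittleO]
    simp only [smul_zero, sub_zero]
    have hO : (fun t' => R t' - R t) =O[𝓝 t] fun t' => (t' - t) ^ 2 :=
      Asymptotics.IsBigO.of_bound (R t0 / 2) (Filter.Eventually.of_forall fun t' => by
        rw [Real.norm_eq_abs, Real.norm_eq_abs, abs_of_nonneg (sq_nonneg (t' - t))]; exact habs t t')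
    refine hO.trans_isLittleO ?_
    have : (fun t' => (t' - t) ^ 2) =o[𝓝 t] fun t' => (t' - t) ^ 1 :=
      (Asymptotics.isLittleO_pow_pow (one_lt_two)).comp_tendsto
        (by simpa using (tendsto_id.sub_const t : Tendsto (fun t' => t' - t) (𝓝 t) (𝓝 (t - t))))
    simpa using this
  have := is_const_of_deriv_eq_zero (fun t => (hder t).differentiableAt) (fun t => (hder t).deriv) θ 0
  simpa [hR] using this

theorem euclid_of_form {E : Type*} [NormedAddCommGroup E] [InnerProductSpace ℝ E]
    [FiniteDimensional ℝ E] (hE : 2 ≤ finrank ℝ E)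
    {φ : E → ℝ} (hφ : IsMinkowskiNorm φ) (q : E →ₗ[ℝ] E →ₗ[ℝ] ℝ)
    (hpos : ∀ x, x ≠ 0 → 0 < q x x)
    (hq : ∀ x y, φ (q y y • x - q y x • y) ≤ q y y * φ x) :
    ∃ Q : QuadraticForm ℝ E, Q.PosDef ∧ ∀ x, φ x ≤ 1 ↔ Q x ≤ 1 := by
  have hnorm : ∀ w, w ≠ 0 → q ((√(q w w))⁻¹ • w) ((√(q w w))⁻¹ • w) = 1 := fun w hw => by
    have h := hpos w hw
    have h2 := Real.sq_sqrt h.le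
    have h3 : 0 < √(q w w) := Real.sqrt_pos.2 h
    simp only [map_smul, LinearMap.smul_apply, smul_eq_mul]
    field_simp
    exact h2.symm
  have hunit : ∀ x y, q x x = 1 → q y y = 1 → φ y = φ x := by
    intro x y hx hy
    have horth : ∀ w, q x (w - ((q x w + q w x) / 2) • x) + q (w - ((q x w + q w x) / 2) • x) x = 0 := by
      intro w
      simp only [map_sub, map_smul, LinearMap.sub_apply, LinearMap.smul_apply, smul_eq_mul, hx]; ring
    have key : ∃ (z : E) (s t : ℝ), q z z = 1 ∧ q x z + q z x = 0 ∧ y = s • x + t • z := by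
      by_cases hw : y - ((q x y + q y x) / 2) • x = 0
      · have : ∃ v, v ∉ Submodule.span ℝ {x} := by
          by_contra hcon
          push Not at hcon
          have htop : Submodule.span ℝ {x} = ⊤ := by rw [eq_top_iff]; exact fun v _ => hcon v
          have hx0 : x ≠ 0 := fun h => by rw [h] at hx; simp at hx
          have := finrank_span_singleton (K := ℝ) hx0
          rw [htop, finrank_top] at this
          omega
        obtain ⟨v, hv⟩ := this
        set w := v - ((q x v + q v x) / 2) • x with hwdef
        have hw0 : w ≠ 0 := fun h => hv (by
          rw [hwdef, sub_eq_zero] at h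
          rw [h]; exact Submodule.smul_mem _ _ (Submodule.mem_span_singleton_self x))
        refine ⟨(√(q w w))⁻¹ • w, (q x y + q y x) / 2, 0, hnorm w hw0, ?_, ?_⟩
        · have := horth v
          rw [← hwdef] at this
          simp only [map_smul, LinearMap.smul_apply, smul_eq_mul]
          rw [← mul_add, this, mul_zero]
        · rw [sub_eq_zero] at hw; simpa using hw
      · set w := y - ((q x y + q y x) / 2) • x with hwdef
        have h3 : √(q w w) ≠ 0 := (Real.sqrt_pos.2 (hpos w hw)).ne'
        refine ⟨(√(q w w))⁻¹ • w, (q x y + q y x) / 2, √(q w w), hnorm w hw, ?_, ?_⟩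
        · have := horth y
          rw [← hwdef] at this
          simp only [map_smul, LinearMap.smul_apply, smul_eq_mul]
          rw [← mul_add, this, mul_zero]
        · rw [smul_smul, mul_inv_cancel₀ h3, one_smul, hwdef]; abel
    obtain ⟨z, s, t, hz, hxz, rfl⟩ := key
    have hst : s ^ 2 + t ^ 2 = 1 := by
      simp only [map_add, LinearMap.add_apply, map_smul, LinearMap.smul_apply, smul_eq_mul, hx, hz] at hy
      linear_combination hy - s * t * hxz
    have hn : ‖(⟨s, t⟩ : ℂ)‖ = 1 := by
      rw [Complex.norm_eq_sqrt_sq_add_sq]; simp [hst]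
    have hcs : Real.cos (Complex.arg ⟨s, t⟩) = s := by
      have := Complex.norm_mul_cos_arg ⟨s, t⟩; rwa [hn, one_mul] at this
    have hsn : Real.sin (Complex.arg ⟨s, t⟩) = t := by
      have := Complex.norm_mul_sin_arg ⟨s, t⟩; rwa [hn, one_mul] at this
    have := circ_const hφ q hq hx hz hxz (Complex.arg ⟨s, t⟩)
    rwa [hcs, hsn] at this
  have : Nontrivial E := Module.nontrivial_of_finrank_pos (R := ℝ) (by omega)
  obtain ⟨e, he⟩ := exists_ne (0 : E)
  set x0 := (√(q e e))⁻¹ • e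
  have hx0 : q x0 x0 = 1 := hnorm e he
  have hx00 : x0 ≠ 0 := fun h => by rw [h] at hx0; simp at hx0
  set c := φ x0
  have hc : 0 < c := hφ.2 _ hx00
  have hformula : ∀ x, φ x = √(q x x) * c := fun x => by
    by_cases hx : x = 0
    · simp [hx, mink_zero hφ]
    have h1 := hunit x0 _ hx0 (hnorm x hx)
    have h3 : 0 < √(q x x) := Real.sqrt_pos.2 (hpos x hx)
    rw [hφ.1.2.1 _ _ (by positivity)] at h1
    show φ x = √(q x x) * φ x0
    rw [← h1, ← mul_assoc, mul_inv_cancel₀ h3.ne', one_mul]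
  refine ⟨c ^ 2 • LinearMap.BilinMap.toQuadraticMap q, fun x hx => ?_, fun x => ?_⟩
  · simp only [_root_.smul_apply, LinearMap.BilinMap.toQuadraticMap_apply, smul_eq_mul]
    have := hpos x hx
    positivity
  · simp only [_root_.smul_apply, LinearMap.BilinMap.toQuadraticMap_apply, smul_eq_mul]
    have h0 : 0 ≤ q x x := by
      by_cases hx : x = 0
      · simp [hx]
      · exact (hpos x hx).le
    have h : c ^ 2 * q x x = φ x ^ 2 := by
      rw [hformula, mul_pow, Real.sq_sqrt h0]; ring
    rw [h]
    exact (sq_le_one_iff₀ (hφ.1.1 x)).symm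

theorem euclid_of_beta {E : Type*} [NormedAddCommGroup E] [InnerProductSpace ℝ E]
    [FiniteDimensional ℝ E] (hE : 2 ≤ finrank ℝ E)
    {φ : E → ℝ} (hφ : IsMinkowskiNorm φ) {κ : ℝ} (hκ : 0 < κ) (β : E →L[ℝ] E) (hβ : β ≠ 0)
    (hg : ∀ u, GoodDir φ κ 0 u (β u)) :
    ∃ Q : QuadraticForm ℝ E, Q.PosDef ∧ ∀ x, φ x ≤ 1 ↔ Q x ≤ 1 := by
  have hinj : Function.Injective β := by
    rw [injective_iff_map_eq_zero]
    intro u hu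
    by_contra hu0
    apply hβ
    ext u'
    by_contra hb
    have hb : β u' ≠ 0 := hb
    have hbp : 0 < ‖β u'‖ := norm_pos_iff.2 hb
    have hup : 0 < ‖u‖ := norm_pos_iff.2 hu0
    have hN : ∀ N : ℝ, 0 ≤ N → κ * ‖β u'‖ * ‖u‖ * N ≤ ip u' (β u') := by
      intro N hN
      have h1 := (hg (u' + N • u)).1
      have h2 := (hg (u' - N • u)).1
      simp only [map_add, map_sub, map_smul, hu, smul_zero, add_zero, sub_zero, inner_add_left,
        inner_sub_left] at h1 h2
      have h3 : 2 * (N * ‖u‖) ≤ ‖u' + N • u‖ + ‖u' - N • u‖ := by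
        have := norm_sub_le (u' + N • u) (u' - N • u)
        rw [show u' + N • u - (u' - N • u) = (2 * N) • u by module, norm_smul, Real.norm_eq_abs,
          abs_of_nonneg (by positivity)] at this
        linarith
      have h4 := mul_le_mul_of_nonneg_left h3 (by positivity : 0 ≤ κ * ‖β u'‖)
      nlinarith
    have hpos : 0 < κ * ‖β u'‖ * ‖u‖ := by positivity
    have h0 := hN 0 le_rfl
    have := hN (ip u' (β u') / (κ * ‖β u'‖ * ‖u‖) + 1) (by
      simp only [mul_zero] at h0; positivity)
    rw [mul_add, mul_div_cancel₀ _ hpos.ne'] at this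
    linarith
  set e := LinearEquiv.ofInjectiveEndo (β : E →ₗ[ℝ] E) hinj
  have he : ∀ y, β (e.symm y) = y := fun y => e.apply_symm_apply y
  refine euclid_of_form hE hφ ((innerₗ E).comp (e.symm : E →ₗ[ℝ] E)) (fun x hx => ?_) (fun x y => ?_)
  · have := (hg (e.symm x)).1
    rw [he] at this
    have h2 : e.symm x ≠ 0 := by simpa using hx
    have h3 : 0 < κ * (‖e.symm x‖ * ‖x‖) := by
      have := norm_pos_iff.2 hx
      have := norm_pos_iff.2 h2
      positivity
    exact h3.trans_le this
  · have := (hg (e.symm y)).2 x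
    rw [he, zero_mul, add_zero] at this
    exact this

theorem beta_limit {E : Type*} [NormedAddCommGroup E] [InnerProductSpace ℝ E]
    [FiniteDimensional ℝ E]
    {φ : E → ℝ} (hφ : IsMinkowskiNorm φ) {κ : ℝ}
    (h : ∀ ε > 0, ∃ β : E →L[ℝ] E, β ≠ 0 ∧ ∀ u, GoodDir φ κ ε u (β u)) :
    ∃ β : E →L[ℝ] E, β ≠ 0 ∧ ∀ u, GoodDir φ κ 0 u (β u) := by
  have h' : ∀ n : ℕ, ∃ β : E →L[ℝ] E, ‖β‖ = 1 ∧ ∀ u, GoodDir φ κ (1 / ((n : ℝ) + 1)) u (β u) := by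
    intro n
    obtain ⟨β, hβ, hg⟩ := h (1 / ((n : ℝ) + 1)) (by positivity)
    have hp : 0 < ‖β‖ := norm_pos_iff.2 hβ
    refine ⟨‖β‖⁻¹ • β, ?_, fun u => ?_⟩
    · rw [norm_smul, norm_inv, norm_norm, inv_mul_cancel₀ hp.ne']
    · exact good_smul_right hφ (by positivity) (hg u)
  choose β hβ hg using h'
  have : ProperSpace (E →L[ℝ] E) := FiniteDimensional.proper ℝ _
  obtain ⟨b, hb, ψ, hψ, hlim⟩ := (isCompact_sphere (0 : E →L[ℝ] E) 1).tendsto_subseq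
    (x := β) (fun n => by simp [hβ n])
  refine ⟨b, fun h0 => ?_, fun u => ⟨?_, fun x => ?_⟩⟩
  · simp [h0] at hb
  · have hu : Tendsto (fun n => β (ψ n) u) atTop (𝓝 (b u)) :=
      ((ContinuousLinearMap.apply ℝ E u).continuous.tendsto b).comp hlim
    exact le_of_tendsto_of_tendsto' ((tendsto_const_nhds.mul hu.norm).const_mul κ)
      (tendsto_const_nhds.inner hu) (fun n => (hg (ψ n) u).1)
  · have hu : Tendsto (fun n => β (ψ n) u) atTop (𝓝 (b u)) :=
      ((ContinuousLinearMap.apply ℝ E u).continuous.tendsto b).comp hlim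
    have hi : Tendsto (fun n => ip u (β (ψ n) u)) atTop (𝓝 (ip u (b u))) :=
      tendsto_const_nhds.inner hu
    have he : Tendsto (fun n => 1 / (((ψ n : ℕ) : ℝ) + 1)) atTop (𝓝 0) :=
      tendsto_one_div_add_atTop_nhds_zero_nat.comp hψ.tendsto_atTop
    refine le_of_tendsto_of_tendsto'
      (((mink_cont hφ).tendsto _).comp ((hi.smul_const x).sub (hu.const_smul (ip u x))))
      (hi.mul ((he.mul_const ‖x‖).const_add (φ x))) (fun n => (hg (ψ n) u).2 x)

theorem core {E : Type*} [NormedAddCommGroup E] [InnerProductSpace ℝ E]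
    [FiniteDimensional ℝ E] (hE : 2 ≤ finrank ℝ E)
    {Ψ : E × ℝ → ℝ} (hΨ : IsMinkowskiNorm Ψ) {δ : ℝ} (hδ : 0 < δ)
    (hc : ∀ f : E, ‖f‖ < δ → ∃ z : E, ∀ x s,
      Ψ (x + (s - ip f x) • z, ip f (x + (s - ip f x) • z)) ≤ Ψ (x, s))
    (h0 : ∀ x s, Ψ (x, 0) ≤ Ψ (x, s)) :
    (∃ δ' > 0, ∀ x s, |s| ≤ δ' * ‖x‖ → Ψ (x, s) ≤ Ψ (x, 0)) ∨
      ∃ Q : QuadraticForm ℝ E, Q.PosDef ∧ ∀ x, Ψ (x, 0) ≤ 1 ↔ Q x ≤ 1 := by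
  have hc' : ∀ f : E, ∃ z : E, (f = 0 → z = 0) ∧ (‖f‖ < δ → ∀ x s,
      Ψ (x + (s - ip f x) • z, ip f (x + (s - ip f x) • z)) ≤ Ψ (x, s)) := by
    intro f
    by_cases hf0 : f = 0
    · refine ⟨0, fun _ => rfl, fun _ x s => ?_⟩
      subst hf0
      simpa using h0 x s
    by_cases hf : ‖f‖ < δ
    · obtain ⟨z, hz⟩ := hc f hf
      exact ⟨z, fun h => absurd h hf0, fun _ => hz⟩
    · exact ⟨0, fun _ => rfl, fun h => absurd h hf⟩
  choose z hz0 hz using hc'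
  obtain ⟨δ₁, M, κ, hδ₁, hδ₁δ, hκ, hb, hcone⟩ := approx_cone hΨ hδ z hz
  set w : E → E := fun f => (1 - ip f (z f))⁻¹ • z f with hw
  have hw0 : w 0 = 0 := by simp [hw, hz0 0 rfl]
  have hφ : IsMinkowskiNorm (fun x : E => Ψ (x, 0)) := by
    have := mink_graph hΨ (0 : E)
    simpa using this
  by_cases hconst : ∃ ρ, 0 < ρ ∧ ρ ≤ δ₁ ∧ ∀ f, ‖f‖ < ρ → w f = 0
  · left
    obtain ⟨ρ, hρ, hρδ, hwc⟩ := hconst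
    refine ⟨ρ / 2, by positivity, fun x s hs => ?_⟩
    by_cases hx : x = 0
    · subst hx
      have : s = 0 := by simpa using hs
      rw [this]
    have hxp : 0 < ‖x‖ := norm_pos_iff.2 hx
    set f : E := (s / ‖x‖ ^ 2) • x with hf
    have hfn : ‖f‖ < ρ := by
      rw [hf, norm_smul, Real.norm_eq_abs, abs_div, abs_of_nonneg (sq_nonneg ‖x‖)]
      calc |s| / ‖x‖ ^ 2 * ‖x‖ = |s| / ‖x‖ := by field_simp
        _ ≤ ρ / 2 := by rw [div_le_iff₀ hxp]; exact hs
        _ < ρ := by linarith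
    have hfx : ip f x = s := by
      rw [hf, real_inner_smul_left, real_inner_self_eq_norm_sq]; field_simp
    have hzf : z f = 0 := by
      have h1 := hwc f hfn
      have h2 := (hb f (by linarith)).1
      rcases smul_eq_zero.1 h1 with h | h
      · rw [inv_eq_zero] at h; linarith
      · exact h
    have := hz f (by linarith) x 0
    rw [hzf] at this
    simpa [hfx] using this
  · right
    push Not at hconst
    obtain ⟨β, hβ, hg⟩ := beta_limit hφ (κ := κ) (fun ε hε => by
      obtain ⟨ρ, hρ, hρδ, hgood⟩ := hcone ε hε
      obtain ⟨p, hp, hpw⟩ := hconst ρ hρ hρδ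
      refine mollify hφ hκ.le w (ρ := ρ) (fun f hf => ?_) (fun f g hf hg => hgood f g hf hg) p 0 hp
        (by simpa using hρ) (by rw [hw0]; exact hpw)
      exact cont_of_mono hE w hκ (fun f hf => (hb f (by linarith)).2)
        (fun f g hf hg => (hgood f g hf hg).1) f hf)
    exact euclid_of_beta hE hφ hκ β hβ hg

theorem grass_dir {V : Type*} [NormedAddCommGroup V] [NormedSpace ℝ V] [FiniteDimensional ℝ V]
    (k : ℕ) (hk : 2 ≤ k)
    (Φ : V → ℝ) (hΦ : IsMinkowskiNorm Φ)
    (X₀ : Gr k V) (𝒰 : Set (Gr k V)) (h𝒰open : IsOpen 𝒰) (hX₀ : X₀ ∈ 𝒰)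
    (hcontr : ∀ X ∈ 𝒰, IsContracting Φ X.1)
    (P₀ : V →ₗ[ℝ] V) (hP₀ : ∀ x ∈ X₀.1, P₀ x = x) (hP₀c : ∀ v, Φ (P₀ v) ≤ Φ v)
    (v : V) (hv0 : v ≠ 0) (hv : P₀ v = 0) :
    (∃ ε > 0, ∀ x ∈ X₀.1, Φ x ≤ 1 → ∀ τ : ℝ, |τ| ≤ ε → Φ (x + τ • v) ≤ 1) ∨
      ∃ Q : QuadraticForm ℝ X₀.1, Q.PosDef ∧ ∀ x : X₀.1, Φ x ≤ 1 ↔ Q x ≤ 1 := by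
  set E := EuclideanSpace ℝ (Fin k)
  have hE : finrank ℝ E = k := by simp [E]
  let e : E ≃ₗ[ℝ] X₀.1 := LinearEquiv.ofFinrankEq _ _ (hE.trans X₀.2.symm)
  let F : E → E →ₗ[ℝ] V := fun f => X₀.1.subtype ∘ₗ e.toLinearMap + (innerₗ E f).smulRight v
  have hF : ∀ f x, F f x = (e x : V) + (ip f x : ℝ) • v := fun f x => rfl
  have hPF : ∀ f x, P₀ (F f x) = e x := fun f x => by
    rw [hF, map_add, map_smul, hv, smul_zero, add_zero, hP₀ _ (e x).2]
  have hFinj : ∀ f, LinearMap.ker (F f) = ⊥ := fun f => by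
    rw [LinearMap.ker_eq_bot']
    intro x hx
    have := hPF f x
    rw [hx, map_zero] at this
    have h2 : e x = 0 := Subtype.ext this.symm
    simpa using h2
  let eb := (EuclideanSpace.basisFun (Fin k) ℝ).toBasis
  have hli : ∀ f, LinearIndependent ℝ (F f ∘ eb) := fun f => eb.linearIndependent.map' (F f) (hFinj f)
  have hspan : ∀ f, Submodule.span ℝ (range (F f ∘ eb)) = LinearMap.range (F f) := fun f => by
    rw [range_comp, ← Submodule.map_span, eb.span_eq, Submodule.map_top]
  let T : E → {v : Fin k → V // LinearIndependent ℝ v} := fun f => ⟨F f ∘ eb, hli f⟩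
  have hT : Continuous T := by
    refine Continuous.subtype_mk ?_ _
    refine continuous_pi fun i => ?_
    show Continuous fun f => (e (eb i) : V) + (ip f (eb i) : ℝ) • v
    fun_prop
  have hopen : IsOpen (T ⁻¹' ((fun v : {v : Fin k → V // LinearIndependent ℝ v} =>
      (⟨Submodule.span ℝ (Set.range v.1), by
          rw [finrank_span_eq_card v.2, Fintype.card_fin]⟩ : Gr k V)) ⁻¹' 𝒰)) :=
    (isOpen_coinduced.1 h𝒰open).preimage hT
  have hmem0 : (0 : E) ∈ (T ⁻¹' ((fun v : {v : Fin k → V // LinearIndependent ℝ v} =>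
      (⟨Submodule.span ℝ (Set.range v.1), by
          rw [finrank_span_eq_card v.2, Fintype.card_fin]⟩ : Gr k V)) ⁻¹' 𝒰)) := by
    show (⟨Submodule.span ℝ (range (F 0 ∘ eb)), _⟩ : Gr k V) ∈ 𝒰
    convert hX₀
    show Submodule.span ℝ (range (F 0 ∘ eb)) = X₀.1
    rw [hspan]
    ext y
    constructor
    · rintro ⟨x, rfl⟩
      rw [hF]; simp
    · intro hy
      refine ⟨e.symm ⟨y, hy⟩, ?_⟩
      rw [hF]; simp
  obtain ⟨δ, hδ, hball⟩ := Metric.isOpen_iff.1 hopen 0 hmem0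
  have hcf : ∀ f, ‖f‖ < δ → IsContracting Φ (LinearMap.range (F f)) := fun f hf => by
    have h1 := hcontr _ (hball (by simpa using hf : f ∈ Metric.ball (0:E) δ))
    have h2 : IsContracting Φ (Submodule.span ℝ (range (F f ∘ eb))) := h1
    rwa [hspan] at h2
  let Ψ : E × ℝ → ℝ := fun p => Φ ((e p.1 : V) + p.2 • v)
  have hΨ : IsMinkowskiNorm Ψ := by
    refine ⟨⟨fun p => hΦ.1.1 _, fun c p hc => ?_, fun p p' => ?_⟩, fun p hp => hΦ.2 _ fun h => hp ?_⟩
    · show Φ ((e (c • p.1) : V) + (c * p.2) • v) = c * Φ ((e p.1 : V) + p.2 • v)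
      rw [← hΦ.1.2.1 _ _ hc]
      congr 1
      rw [map_smul, smul_add, mul_smul]; rfl
    · show Φ ((e (p.1 + p'.1) : V) + (p.2 + p'.2) • v) ≤ _
      refine le_trans (le_of_eq ?_) (hΦ.1.2.2 _ _)
      congr 1
      rw [map_add, Submodule.coe_add, add_smul]; abel
    · have h1 := congrArg P₀ h
      rw [map_add, map_smul, hv, smul_zero, add_zero, hP₀ _ (e p.1).2, map_zero] at h1
      have h2 : e p.1 = 0 := Subtype.ext h1
      rw [h1, zero_add] at h
      have h3 := (smul_eq_zero.1 h).resolve_right hv0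
      exact Prod.ext (by simpa using h2) h3
  have hc : ∀ f : E, ‖f‖ < δ → ∃ z : E, ∀ x s,
      Ψ (x + (s - ip f x) • z, ip f (x + (s - ip f x) • z)) ≤ Ψ (x, s) := by
    intro f hf
    obtain ⟨P, hPP, hPr, hPc⟩ := hcf f hf
    obtain ⟨z, hz⟩ : P v ∈ LinearMap.range (F f) := hPr ▸ LinearMap.mem_range_self P v
    refine ⟨z, fun x s => ?_⟩
    have hfix : ∀ y, P (F f y) = F f y := fun y => by
      obtain ⟨y', hy'⟩ : F f y ∈ LinearMap.range P := hPr ▸ LinearMap.mem_range_self (F f) y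
      rw [← hy']
      exact LinearMap.congr_fun hPP y'
    have h := hPc ((e x : V) + s • v)
    have e1 : (e x : V) + s • v = F f x + (s - ip f x) • v := by rw [hF]; module
    have e2 : P ((e x : V) + s • v) = F f (x + (s - ip f x) • z) := by
      rw [e1, map_add, map_smul, hfix, ← hz, map_add, map_smul]
    rw [e2] at h
    exact h
  have h0 : ∀ x s, Ψ (x, 0) ≤ Ψ (x, s) := fun x s => by
    have h := hP₀c ((e x : V) + s • v)
    rw [map_add, map_smul, hv, smul_zero, add_zero, hP₀ _ (e x).2] at h
    show Φ ((e x : V) + (0:ℝ) • v) ≤ _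
    rw [zero_smul, add_zero]; exact h
  have hΨ0 : ∀ x, Ψ (x, 0) = Φ (e x) := fun x => by
    show Φ ((e x : V) + (0:ℝ) • v) = _
    rw [zero_smul, add_zero]
  rcases core (hE.symm ▸ hk) hΨ hδ hc h0 with ⟨δ', hδ', hl⟩ | ⟨Q, hQ, hQ1⟩
  · left
    obtain ⟨c, C, hcp, hCp, -, hC⟩ := mink_bounds hΨ
    refine ⟨1 / (C * (1 / δ' + 1)), by positivity, fun x hx hx1 τ hτ => ?_⟩
    obtain ⟨y, hy⟩ := e.surjective ⟨x, hx⟩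
    have hey : (e y : V) = x := by rw [hy]
    rw [← hey] at hx1 ⊢
    show Ψ (y, τ) ≤ 1
    by_cases hcase : |τ| ≤ δ' * ‖y‖
    · refine (hl y τ hcase).trans ?_
      rw [hΨ0]; exact hx1
    · push Not at hcase
      have h1 : ‖y‖ ≤ 1 / δ' * |τ| := by
        rw [one_div, inv_mul_eq_div, le_div_iff₀ hδ']; linarith
      have h2 : ‖(y, τ)‖ ≤ (1 / δ' + 1) * |τ| := by
        rw [Prod.norm_def]
        have : 0 ≤ 1 / δ' * |τ| := by positivity
        refine max_le ?_ ?_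
        · nlinarith [abs_nonneg τ]
        · rw [Real.norm_eq_abs]; nlinarith
      calc Ψ (y, τ) ≤ C * ‖(y, τ)‖ := hC _
        _ ≤ C * ((1 / δ' + 1) * |τ|) := by gcongr
        _ ≤ C * ((1 / δ' + 1) * (1 / (C * (1 / δ' + 1)))) := by gcongr
        _ = 1 := by field_simp
  · right
    refine ⟨Q.comp (e.symm : X₀.1 →ₗ[ℝ] E), fun x hx => hQ _ (by simpa using hx), fun x => ?_⟩
    have := hQ1 (e.symm x)
    rw [hΨ0, e.apply_symm_apply] at this
    exact this

/-- **Local Kakutani proposition.** If all `k`-dimensional subspaces from a neighbourhood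
of `X₀` are `Φ`-contracting, then the unit ball `B` is locally cylindrical near `X₀` or
`B ∩ X₀` is a 0-centered ellipsoid. -/
theorem local_kakutani
    {V : Type*} [NormedAddCommGroup V] [NormedSpace ℝ V] [FiniteDimensional ℝ V]
    (n k : ℕ) (hk : 2 ≤ k) (hn : k + 1 ≤ n) (hV : Module.finrank ℝ V = n)
    (Φ : V → ℝ) (hΦ : IsMinkowskiNorm Φ) (B : Set V) (hB : B = {v | Φ v ≤ 1})
    (X₀ : Gr k V) (𝒰 : Set (Gr k V)) (h𝒰open : IsOpen 𝒰) (hX₀ : X₀ ∈ 𝒰)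
    (hcontr : ∀ X ∈ 𝒰, IsContracting Φ X.1) :
    IsLocallyCylindricalNear k B X₀.1 ∨ IsEllipsoidIn X₀.1 (B ∩ (X₀.1 : Set V)) := by
  subst hB
  obtain ⟨P₀, hPP, hPr, hPc⟩ := hcontr X₀ hX₀
  have hfix : ∀ x ∈ X₀.1, P₀ x = x := fun x hx => by
    rw [← hPr] at hx
    obtain ⟨y, rfl⟩ := hx
    exact LinearMap.congr_fun hPP y
  have hPmem : ∀ v, P₀ v ∈ X₀.1 := fun v => hPr ▸ LinearMap.mem_range_self P₀ v
  by_cases hell : ∃ Q : QuadraticForm ℝ X₀.1, Q.PosDef ∧ ∀ x : X₀.1, Φ x ≤ 1 ↔ Q x ≤ 1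
  · right
    obtain ⟨Q, hQ, hQ1⟩ := hell
    refine ⟨Q, hQ, ?_⟩
    ext x
    constructor
    · rintro ⟨h1, h2⟩
      exact ⟨⟨x, h2⟩, (hQ1 ⟨x, h2⟩).1 h1, rfl⟩
    · rintro ⟨y, hy, rfl⟩
      exact ⟨(hQ1 y).2 hy, y.2⟩
  left
  have hdir : ∀ v, P₀ v = 0 → ∃ ε > 0, ∀ x ∈ X₀.1, Φ x ≤ 1 → ∀ τ : ℝ, |τ| ≤ ε →
      Φ (x + τ • v) ≤ 1 := by
    intro v hv
    by_cases hv0 : v = 0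
    · exact ⟨1, one_pos, fun x _ hx1 τ _ => by simpa [hv0] using hx1⟩
    · exact (grass_dir k hk Φ hΦ X₀ 𝒰 h𝒰open hX₀ hcontr P₀ hfix hPc v hv0 hv).resolve_right hell
  set Y₀ := LinearMap.ker P₀ with hY₀
  have hconv : Convex ℝ {v | Φ v ≤ 1} := by
    have := (mink_convex hΦ).convex_le 1
    simpa using this
  have hr : ∃ r > 0, ∀ y, P₀ y = 0 → ‖y‖ < r → ∀ a ∈ X₀.1, Φ a ≤ 1 → Φ (a + y) ≤ 1 := by
    let bb := finBasis ℝ Y₀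
    set m := finrank ℝ Y₀
    choose ε hε hεd using fun i => hdir (bb i) (bb i).2
    have hopen : IsOpen {y : Y₀ | ∀ i, |(m : ℝ) * bb.coord i y| < ε i} := by
      rw [ofPred_forall]
      refine isOpen_iInter_of_finite fun i => ?_
      have hcc : Continuous (bb.coord i) := LinearMap.continuous_of_finiteDimensional _
      exact isOpen_lt (by fun_prop) continuous_const
    obtain ⟨r, hr, hball⟩ := Metric.isOpen_iff.1 hopen 0 (by
      intro i; simpa using hε i)
    refine ⟨r, hr, fun y hy hyr a ha ha1 => ?_⟩
    have hmem := hball (by simpa using hyr : (⟨y, hy⟩ : Y₀) ∈ Metric.ball (0 : Y₀) r)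
    have hsum : ∑ i, bb.coord i ⟨y, hy⟩ • (bb i : V) = y := by
      have := congrArg (Subtype.val) (bb.sum_repr ⟨y, hy⟩)
      rw [Submodule.coe_sum] at this
      exact this
    by_cases hm : m = 0
    · have : IsEmpty (Fin m) := by rw [hm]; infer_instance
      rw [Finset.univ_eq_empty, Finset.sum_empty] at hsum
      rw [← hsum, add_zero]; exact ha1
    have hmR : (m : ℝ) ≠ 0 := by exact_mod_cast hm
    have hs := hconv.sum_mem (t := Finset.univ) (w := fun _ : Fin m => (m : ℝ)⁻¹)
      (z := fun i => a + ((m : ℝ) * bb.coord i ⟨y, hy⟩) • (bb i : V))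
      (fun i _ => by positivity)
      (by rw [Finset.sum_const, Finset.card_univ, Fintype.card_fin, nsmul_eq_mul,
            mul_inv_cancel₀ hmR])
      (fun i _ => hεd i a ha ha1 _ (hmem i).le)
    have he : ∑ i : Fin m, (m : ℝ)⁻¹ • (a + ((m : ℝ) * bb.coord i ⟨y, hy⟩) • (bb i : V)) = a + y := by
      simp only [smul_add, Finset.sum_add_distrib, smul_smul, inv_mul_cancel_left₀ hmR]
      rw [hsum, Finset.sum_const, Finset.card_univ, Fintype.card_fin, ← Nat.cast_smul_eq_nsmul ℝ,
        smul_smul, mul_inv_cancel₀ hmR, one_smul]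
    rw [he] at hs
    exact hs
  obtain ⟨r, hr0, hr⟩ := hr
  have hPcont : Continuous P₀ := LinearMap.continuous_of_finiteDimensional _
  have hΦc := mink_cont hΦ
  obtain ⟨c, C, hc, hC, hcl, -⟩ := mink_bounds hΦ
  have hcompl : IsCompl X₀.1 Y₀ := by
    refine IsCompl.of_eq ?_ ?_
    · rw [eq_bot_iff]
      rintro x ⟨h1, h2⟩
      have := hfix x h1
      rw [LinearMap.mem_ker.1 h2] at this
      exact this.symm
    · rw [eq_top_iff]
      intro x _
      rw [Submodule.mem_sup]
      refine ⟨P₀ x, hPmem x, x - P₀ x, ?_, by abel⟩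
      rw [hY₀, LinearMap.mem_ker, map_sub, hfix _ (hPmem x), sub_self]
  refine ⟨({v | Φ v ≤ 1} ∩ X₀.1) + (Y₀ : Set V), ⟨{v | Φ v ≤ 1} ∩ X₀.1, X₀.1, X₀.2,
    inter_subset_right, ?_, hconv.inter X₀.1.convex, ?_, Y₀, hcompl, rfl⟩,
    {u | ‖u - P₀ u‖ < r}, ?_, ?_, ?_⟩
  · have hclosed : IsClosed ({v | Φ v ≤ 1} ∩ (X₀.1 : Set V)) :=
      (isClosed_le hΦc continuous_const).inter X₀.1.closed_of_finiteDimensional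
    have : ProperSpace V := FiniteDimensional.proper ℝ V
    refine (isCompact_closedBall (0 : V) (1 / c)).of_isClosed_subset hclosed ?_
    rintro x ⟨hx, -⟩
    rw [mem_closedBall_zero_iff, le_div_iff₀ hc, mul_comm]
    exact (hcl x).trans hx
  · refine ⟨0, mem_interior.2 ⟨{x : X₀.1 | Φ x < 1}, ?_, ?_, ?_⟩⟩
    · intro x hx
      have hx : Φ x < 1 := hx
      exact ⟨hx.le, x.2⟩
    · exact isOpen_lt (hΦc.comp continuous_subtype_val) continuous_const
    · show Φ ((0 : X₀.1) : V) < 1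
      rw [Submodule.coe_zero, mink_zero hΦ]; exact one_pos
  · exact isOpen_lt (by fun_prop) continuous_const
  · intro x hx
    show ‖x - P₀ x‖ < r
    rw [hfix x hx, sub_self, norm_zero]; exact hr0
  · ext u
    constructor
    · rintro ⟨h1, h2⟩
      refine ⟨mem_add.2 ⟨P₀ u, ⟨(hPc u).trans h1, hPmem u⟩, u - P₀ u, ?_, by abel⟩, h2⟩
      show u - P₀ u ∈ Y₀
      rw [hY₀, LinearMap.mem_ker, map_sub, hfix _ (hPmem u), sub_self]
    · rintro ⟨h1, h2⟩
      obtain ⟨a, ⟨ha1, haX⟩, y, hy, rfl⟩ := mem_add.1 h1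
      have hy : P₀ y = 0 := hy
      have h2 : ‖a + y - P₀ (a + y)‖ < r := h2
      refine ⟨?_, h2⟩
      rw [map_add, hfix a haX, hy, add_zero, add_sub_cancel_left] at h2
      exact hr y hy h2 a haX ha1
end

section
/- Let X be a 2-dimensional real vector space and K ⊂ X a convex body with 0 in its interior. Let R : X* → Hom(X, X) be a linear map such that for every λ ∈ X* the operator R_λ = R(λ) satisfies tr R_λ = 0 and: for every p ∈ ∂K ∩ ker λ, the vector R_λ(p) is tangent to ∂K at p. Then R_λ(p) is tangent to ∂K at p for all p ∈ ∂K and all λ ∈ X*. -/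
open Module Set Pointwise

open Filter Topology

lemma tqf_globalMin {X : Type*} [AddCommGroup X] [Module ℝ X] (Φ : X → ℝ)
    (hadd : ∀ x y, Φ (x + y) ≤ Φ x + Φ y)
    (hsmul : ∀ (c : ℝ) (x : X), 0 ≤ c → Φ (c • x) = c * Φ x)
    (p v : X) (h : HasDerivAt (fun t : ℝ => Φ (p + t • v)) 0 0) (s : ℝ) :
    Φ p ≤ Φ (p + s • v) := by
  by_contra hlt
  push Not at hlt
  have h2 : HasDerivAt (fun t : ℝ => Φ (p + (t * s) • v)) 0 0 := by
    have h' : HasDerivAt (fun t : ℝ => Φ (p + t • v)) 0 (0 * s) := by simpa using h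
    have := HasDerivAt.comp (0 : ℝ) h' ((hasDerivAt_id (0 : ℝ)).mul_const s)
    simpa [Function.comp_def] using this
  rw [hasDerivAt_iff_isLittleO] at h2
  have h3 := h2.def (c := (Φ p - Φ (p + s • v)) / 2) (by linarith)
  rw [Metric.eventually_nhds_iff] at h3
  obtain ⟨ε, hε, h3⟩ := h3
  set t : ℝ := min (ε / 2) 1 with ht
  have ht0 : 0 < t := by positivity
  have ht1 : t ≤ 1 := min_le_right _ _
  have htε : t < ε := lt_of_le_of_lt (min_le_left _ _) (by linarith)
  have h4 := h3 (y := t) (by simpa [abs_of_pos ht0] using htε)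
  simp only [zero_mul, zero_smul, add_zero, smul_zero, sub_zero, Real.norm_eq_abs,
    abs_of_pos ht0] at h4
  have h5 : Φ (p + (t * s) • v) ≤ (1 - t) * Φ p + t * Φ (p + s • v) := by
    have : p + (t * s) • v = (1 - t) • p + t • (p + s • v) := by module
    rw [this, ← hsmul _ _ (by linarith), ← hsmul _ _ ht0.le]
    exact hadd _ _
  have h6 := (abs_le.1 h4).1
  nlinarith

lemma tqf_upper {X : Type*} [AddCommGroup X] [Module ℝ X] (Φ : X → ℝ)
    (hadd : ∀ x y, Φ (x + y) ≤ Φ x + Φ y)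
    (hsmul : ∀ (c : ℝ) (x : X), 0 ≤ c → Φ (c • x) = c * Φ x)
    (W : X →ₗ[ℝ] X) (hT : ∀ p s, Φ p ≤ Φ (p + (s : ℝ) • W p)) (p : X) (t : ℝ) :
    Φ (p + t • W p) ≤ Φ p + t ^ 2 * Φ (-W (W p)) := by
  have h1 := hT (p + t • W p) (-t)
  have h2 : p + t • W p + (-t) • W (p + t • W p) = p + (t ^ 2) • (-W (W p)) := by
    simp only [map_add, map_smul]; module
  rw [h2] at h1
  have h3 := hadd p ((t ^ 2) • (-W (W p)))
  rw [hsmul _ _ (sq_nonneg t)] at h3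
  linarith

lemma tqf_deriv {X : Type*} [AddCommGroup X] [Module ℝ X] (Φ : X → ℝ)
    (hadd : ∀ x y, Φ (x + y) ≤ Φ x + Φ y)
    (hsmul : ∀ (c : ℝ) (x : X), 0 ≤ c → Φ (c • x) = c * Φ x)
    (W : X →ₗ[ℝ] X) (hT : ∀ p s, Φ p ≤ Φ (p + (s : ℝ) • W p)) (p : X) :
    HasDerivAt (fun t : ℝ => Φ (p + t • W p)) 0 0 := by
  rw [hasDerivAt_iff_isLittleO]
  have h1 : (fun t : ℝ => Φ (p + t • W p) - Φ (p + (0 : ℝ) • W p) - (t - 0) • (0 : ℝ))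
      =O[𝓝 0] (fun t : ℝ => t ^ 2) := by
    refine Asymptotics.IsBigO.of_bound (Φ (-W (W p))) (Eventually.of_forall fun t => ?_)
    have a := hT p t
    have b := tqf_upper Φ hadd hsmul W hT p t
    simp only [zero_smul, add_zero, smul_zero, sub_zero, Real.norm_eq_abs]
    rw [abs_of_nonneg (by linarith), abs_of_nonneg (sq_nonneg t)]
    linarith
  refine h1.trans_isLittleO ?_
  simpa using (Asymptotics.isLittleO_pow_id (𝕜 := ℝ) (n := 2) (by norm_num))

lemma tqf_real (c τ δ : ℝ) (h : ∀ s : ℝ, (1 + τ * s + δ * s ^ 2) ^ 2 ≤ (1 + c * s ^ 2) ^ 4) :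
    τ = 0 := by
  have hd : HasDerivAt (fun s : ℝ => (1 + c * s ^ 2) ^ 4 - (1 + τ * s + δ * s ^ 2) ^ 2)
      (-2 * τ) 0 := by
    have hi := hasDerivAt_id (0 : ℝ)
    have h1 := (((hi.pow 2).const_mul c).const_add 1).pow 4
    have h2 := (((hi.const_mul τ).const_add 1).add ((hi.pow 2).const_mul δ)).pow 2
    have h3 := h1.sub h2
    refine HasDerivAt.congr_deriv (f := fun s : ℝ => (1 + c * s ^ 2) ^ 4 - (1 + τ * s + δ * s ^ 2) ^ 2) h3 ?_
    simp
  have hm : IsLocalMin (fun s : ℝ => (1 + c * s ^ 2) ^ 4 - (1 + τ * s + δ * s ^ 2) ^ 2) 0 := by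
    refine Eventually.of_forall fun s => ?_
    have := h s
    simp only
    norm_num
    linarith
  have := hm.hasDerivAt_eq_zero hd
  linarith

lemma tqf_trace {X : Type*} [NormedAddCommGroup X] [NormedSpace ℝ X] [FiniteDimensional ℝ X]
    (Φ : X → ℝ)
    (hadd : ∀ x y, Φ (x + y) ≤ Φ x + Φ y)
    (hsmul : ∀ (c : ℝ) (x : X), 0 ≤ c → Φ (c • x) = c * Φ x)
    (hpos : ∀ x, x ≠ 0 → 0 < Φ x) (hnn : ∀ x, 0 ≤ Φ x)
    (K : Set X) (hK : IsCompact K) (hmem : ∀ x, x ∈ K ↔ Φ x ≤ 1)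
    (p0 p1 : X) (l0 l1 : X →ₗ[ℝ] ℝ) (h00 : l0 p0 = 1) (h01 : l0 p1 = 0)
    (h10 : l1 p0 = 0) (h11 : l1 p1 = 1) (hx : ∀ x, x = l0 x • p0 + l1 x • p1)
    (W : X →ₗ[ℝ] X) (hT : ∀ p s, Φ p ≤ Φ (p + (s : ℝ) • W p)) :
    l0 (W p0) + l1 (W p1) = 0 := by
  obtain ⟨a, ha⟩ : ∃ a, a = l0 (W p0) := ⟨_, rfl⟩
  obtain ⟨c, hc⟩ : ∃ c, c = l1 (W p0) := ⟨_, rfl⟩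
  obtain ⟨b, hb⟩ : ∃ b, b = l0 (W p1) := ⟨_, rfl⟩
  obtain ⟨d, hd⟩ : ∃ d, d = l1 (W p1) := ⟨_, rfl⟩
  have hW0 : ∀ x, l0 (W x) = a * l0 x + b * l1 x := by
    intro x
    conv_lhs => rw [hx x]
    simp only [map_add, map_smul, smul_eq_mul, ← ha, ← hb]; ring
  have hW1 : ∀ x, l1 (W x) = c * l0 x + d * l1 x := by
    intro x
    conv_lhs => rw [hx x]
    simp only [map_add, map_smul, smul_eq_mul, ← hc, ← hd]; ring
  rw [← ha, ← hd]
  obtain ⟨Q, hQ⟩ : ∃ Q : X → ℝ, Q = fun x => l0 x * l1 (W x) - l1 x * l0 (W x) := ⟨_, rfl⟩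
  have hQs : ∀ (r : ℝ) x, Q (r • x) = r ^ 2 * Q x := by
    intro r x
    simp only [hQ, map_smul, smul_eq_mul]; ring
  have hQc : Continuous Q := by
    have c0 := l0.continuous_of_finiteDimensional
    have c1 := l1.continuous_of_finiteDimensional
    have cW := W.continuous_of_finiteDimensional
    rw [hQ]; fun_prop
  have hQW : ∀ x (s : ℝ), Q (x + s • W x) = (1 + (a + d) * s + (a * d - b * c) * s ^ 2) * Q x := by
    intro x s
    simp only [hQ, map_add, map_smul, smul_eq_mul, hW0, hW1]; ring
  have h0K : (0 : X) ∈ K := by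
    rw [hmem]
    have := hsmul 0 0 le_rfl
    simp at this
    rw [this]; norm_num
  obtain ⟨p, hpK, hpM⟩ := hK.exists_isMaxOn ⟨0, h0K⟩ (hQc.pow 2).continuousOn
  by_cases hQp : Q p = 0
  · have hQ0 : ∀ x, Q x = 0 := by
      intro x
      by_cases hx0 : x = 0
      · have := hQs 0 x
        simp at this
        rw [hx0]; exact this
      have hp := hpos x hx0
      have : (Φ x)⁻¹ • x ∈ K := by
        rw [hmem, hsmul _ _ (by positivity), inv_mul_cancel₀ hp.ne']
      have h1 := hpM this
      simp only [mem_setOf_eq, Pi.pow_apply, hQp, hQs] at h1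
      have h2 : ((Φ x)⁻¹ ^ 2 * Q x) = 0 := by nlinarith [sq_nonneg ((Φ x)⁻¹ ^ 2 * Q x)]
      have h3 : (Φ x)⁻¹ ^ 2 ≠ 0 := by positivity
      exact (mul_eq_zero.1 h2).resolve_left h3
    have q0 := hQ0 p0
    have q1 := hQ0 p1
    have q2 := hQ0 (p0 + p1)
    simp only [hQ, hW0, hW1, map_add, h00, h01, h10, h11] at q0 q1 q2
    have hcz : c = 0 := by linarith
    have hbz : b = 0 := by linarith
    have had : d = a := by nlinarith
    have hWp : W p0 = a • p0 := by
      rw [hx (W p0), ← ha, ← hc, hcz]; simp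
    have hp0 : p0 ≠ 0 := by
      rintro rfl
      simp at h00
    by_contra hne
    have ha0 : a ≠ 0 := by
      rintro rfl
      apply hne; rw [had]; ring
    have h1 := hT p0 (-a⁻¹)
    rw [hWp, smul_smul, neg_mul, inv_mul_cancel₀ ha0, neg_one_smul, add_neg_cancel] at h1
    have h2 := (hmem 0).1 h0K
    have := hsmul 0 0 le_rfl
    simp at this
    have := hpos p0 hp0
    linarith
  · refine tqf_real (Φ (-W (W p))) (a + d) (a * d - b * c) fun s => ?_
    have hc0 := hnn (-W (W p))
    set C := Φ (-W (W p)) with hC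
    have hpos1 : 0 < 1 + C * s ^ 2 := by positivity
    have hin : (1 + C * s ^ 2)⁻¹ • (p + s • W p) ∈ K := by
      rw [hmem, hsmul _ _ (by positivity), inv_mul_le_iff₀ hpos1]
      have := tqf_upper Φ hadd hsmul W hT p s
      have := (hmem p).1 hpK
      linarith
    have h1 := hpM hin
    simp only [mem_setOf_eq, Pi.pow_apply, hQs, hQW] at h1
    have hq : 0 < Q p ^ 2 := by positivity
    have h2 : ((1 + C * s ^ 2)⁻¹ ^ 2 * ((1 + (a + d) * s + (a * d - b * c) * s ^ 2) * Q p)) ^ 2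
        = ((1 + (a + d) * s + (a * d - b * c) * s ^ 2) ^ 2 / (1 + C * s ^ 2) ^ 4) * Q p ^ 2 := by
      field_simp
    rw [h2] at h1
    have h3 := (mul_le_iff_le_one_left hq).1 h1
    rwa [div_le_one (by positivity)] at h3

lemma tqf_basis {X : Type*} [AddCommGroup X] [Module ℝ X]
    (hX : Module.finrank ℝ X = 2)
    (R : (X →ₗ[ℝ] ℝ) →ₗ[ℝ] (X →ₗ[ℝ] X)) :
    ∃ (p0 p1 : X) (l0 l1 : X →ₗ[ℝ] ℝ), l0 p0 = 1 ∧ l0 p1 = 0 ∧ l1 p0 = 0 ∧ l1 p1 = 1 ∧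
      (∀ x, x = l0 x • p0 + l1 x • p1) ∧ l1 (R l1 p0) = 0 ∧
      ∀ A : X →ₗ[ℝ] X, LinearMap.trace ℝ X A = l0 (A p0) + l1 (A p1) := by
  have : FiniteDimensional ℝ X := Module.finite_of_finrank_eq_succ hX
  let e := Module.finBasisOfFinrankEq ℝ X hX
  obtain ⟨u, hu⟩ : ∃ u, u = e 0 := ⟨_, rfl⟩
  obtain ⟨v, hv⟩ : ∃ v, v = e 1 := ⟨_, rfl⟩
  obtain ⟨f, hf⟩ : ∃ f, f = e.coord 0 := ⟨_, rfl⟩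
  obtain ⟨g, hg⟩ : ∃ g, g = e.coord 1 := ⟨_, rfl⟩
  have fu : f u = 1 := by simp [hf, hu]
  have fv : f v = 0 := by simp [hf, hv]
  have gu : g u = 0 := by simp [hg, hu]
  have gv : g v = 1 := by simp [hg, hv]
  have hx : ∀ x, x = f x • u + g x • v := by
    intro x
    have := e.sum_repr x
    rw [Fin.sum_univ_two] at this
    simpa [hf, hg, hu, hv] using this.symm
  have htr : ∀ A : X →ₗ[ℝ] X, LinearMap.trace ℝ X A = f (A u) + g (A v) := by
    intro A
    rw [LinearMap.trace_eq_matrix_trace ℝ e, Matrix.trace, Fin.sum_univ_two]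
    simp [LinearMap.toMatrix_apply, hf, hg, hu, hv]
  let P : ℝ → X := fun θ => Real.cos θ • u + Real.sin θ • v
  let L : ℝ → (X →ₗ[ℝ] ℝ) := fun θ => (-Real.sin θ) • f + Real.cos θ • g
  have hcont : Continuous fun θ => L θ (R (L θ) (P θ)) := by
    simp only [L, P, map_add, map_smul, LinearMap.add_apply, LinearMap.smul_apply, smul_eq_mul]
    fun_prop
  have h0 : L Real.pi (R (L Real.pi) (P Real.pi)) = - L 0 (R (L 0) (P 0)) := by
    simp [L, P]
  have hz : ∃ θ, L θ (R (L θ) (P θ)) = 0 := by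
    have := mem_range_of_exists_le_of_exists_ge hcont (c := 0)
    rcases le_total (L 0 (R (L 0) (P 0))) 0 with h | h
    · exact this ⟨_, h⟩ ⟨Real.pi, by rw [h0]; linarith⟩
    · exact this ⟨Real.pi, by rw [h0]; linarith⟩ ⟨_, h⟩
  obtain ⟨θ, hθ⟩ := hz
  have hcs := Real.sin_sq_add_cos_sq θ
  refine ⟨P θ, (-Real.sin θ) • u + Real.cos θ • v, Real.cos θ • f + Real.sin θ • g, L θ,
    ?_, ?_, ?_, ?_, ?_, hθ, ?_⟩
  · simp [P, fu, fv, gu, gv]; linarith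
  · simp [fu, fv, gu, gv]; ring
  · simp [P, L, fu, fv, gu, gv]; ring
  · simp [L, fu, fv, gu, gv]; linarith
  · intro x
    conv_lhs => rw [hx x]
    simp only [P, L, LinearMap.add_apply, LinearMap.smul_apply, smul_eq_mul]
    have h1 : f x = (Real.sin θ ^ 2 + Real.cos θ ^ 2) * f x := by rw [hcs, one_mul]
    have h2 : g x = (Real.sin θ ^ 2 + Real.cos θ ^ 2) * g x := by rw [hcs, one_mul]
    conv_lhs => rw [h1, h2]
    module
  · intro A
    rw [htr]
    simp only [P, L, map_add, map_smul, LinearMap.add_apply, LinearMap.smul_apply, smul_eq_mul]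
    linear_combination (-(f (A u) + g (A v))) * hcs

/-- **Tangency of the quadratic family (k = 2).** If for every `λ ∈ X*` the traceless
operator `R λ` sends each point `p ∈ ∂K ∩ ker λ` to a vector tangent to `∂K` at `p`,
then `R λ p` is tangent to `∂K` at `p` for all `p ∈ ∂K` and all `λ`.
Tangency of `v` at `p` means the gauge (Minkowski functional) of `K` has zero derivative
at `t = 0` along `t ↦ p + t • v`. -/
theorem tangent_quadratic_family
    {X : Type*} [NormedAddCommGroup X] [NormedSpace ℝ X]
    (hX : Module.finrank ℝ X = 2)
    (K : Set X) (hK : IsConvexBody K) (h0 : 0 ∈ interior K)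
    (R : (X →ₗ[ℝ] ℝ) →ₗ[ℝ] (X →ₗ[ℝ] X))
    (htr : ∀ l : X →ₗ[ℝ] ℝ, LinearMap.trace ℝ X (R l) = 0)
    (htan : ∀ l : X →ₗ[ℝ] ℝ, ∀ p ∈ frontier K, l p = 0 →
      HasDerivAt (fun t : ℝ => gauge K (p + t • (R l) p)) 0 0) :
    ∀ l : X →ₗ[ℝ] ℝ, ∀ p ∈ frontier K,
      HasDerivAt (fun t : ℝ => gauge K (p + t • (R l) p)) 0 0 := by
  have : FiniteDimensional ℝ X := Module.finite_of_finrank_eq_succ hX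
  obtain ⟨hKc, hKx, -⟩ := hK
  have hn : K ∈ 𝓝 (0 : X) := mem_interior_iff_mem_nhds.1 h0
  have habs : Absorbent ℝ K := absorbent_nhds_zero hn
  have hbd : Bornology.IsVonNBounded ℝ K := (NormedSpace.isVonNBounded_iff ℝ).2 hKc.isBounded
  have hadd : ∀ x y, gauge K (x + y) ≤ gauge K x + gauge K y := gauge_add_le hKx habs
  have hsmul : ∀ (c : ℝ) (x : X), 0 ≤ c → gauge K (c • x) = c * gauge K x :=
    fun c x hc => gauge_smul_of_nonneg hc x
  have hpos : ∀ x, x ≠ 0 → 0 < gauge K x := fun x hx => (gauge_pos habs hbd).2 hx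
  have hnn : ∀ x, 0 ≤ gauge K x := fun x => gauge_nonneg x
  have hcont : Continuous (gauge K) := continuous_gauge hKx hn
  have hmem : ∀ x, x ∈ K ↔ gauge K x ≤ 1 := fun x => by
    rw [gauge_le_one_iff_mem_closure hKx hn, hKc.isClosed.closure_eq]
  have hfr : ∀ x, gauge K x = 1 ↔ x ∈ frontier K :=
    fun x => gauge_eq_one_iff_mem_frontier hKx hn
  have hV : ∀ (l : X →ₗ[ℝ] ℝ) (p : X), l p = 0 → ∀ s : ℝ,
      gauge K p ≤ gauge K (p + s • R l p) := by
    intro l p hlp s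
    by_cases hp : p = 0
    · simp [hp]
    have hp' := hpos p hp
    have h1 := tqf_globalMin (gauge K) hadd hsmul ((gauge K p)⁻¹ • p) _
      (htan l ((gauge K p)⁻¹ • p)
        ((hfr _).1 (by rw [hsmul _ _ (by positivity), inv_mul_cancel₀ hp'.ne']))
        (by simp [hlp])) s
    have h2 : (gauge K p)⁻¹ • p + s • R l ((gauge K p)⁻¹ • p)
        = (gauge K p)⁻¹ • (p + s • R l p) := by
      simp only [map_smul]; module
    rw [h2, hsmul _ _ (by positivity), hsmul _ _ (by positivity)] at h1
    exact le_of_mul_le_mul_left h1 (by positivity)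
  obtain ⟨p0, p1, l0, l1, h00, h01, h10, h11, hx, hz, htr'⟩ := tqf_basis hX R
  have hp0 : p0 ≠ 0 := by
    rintro rfl
    simp at h00
  have hR10 : R l1 p0 = 0 := by
    have h1 : R l1 p0 = l0 (R l1 p0) • p0 := by
      conv_lhs => rw [hx (R l1 p0), hz]
      simp
    by_contra hne
    have hc : l0 (R l1 p0) ≠ 0 := by
      intro h
      rw [h, zero_smul] at h1
      exact hne h1
    have h2 := hV l1 p0 h10 (-(l0 (R l1 p0))⁻¹)
    rw [h1, smul_smul] at h2
    simp only [map_smul, h00, smul_eq_mul, mul_one] at h2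
    rw [neg_mul, inv_mul_cancel₀ hc, neg_one_smul, add_neg_cancel, gauge_zero] at h2
    exact absurd h2 (not_le.2 (hpos p0 hp0))
  -- the linear field
  let W : X →ₗ[ℝ] X := l0.smulRight (R l1 p1) - R l0
  have hWV : ∀ p, R (l0 p • l1 - l1 p • l0) p = l1 p • W p := by
    intro p
    have e1 : R l1 p = l1 p • R l1 p1 := by
      conv_lhs => rw [hx p]
      simp [hR10]
    simp only [W, map_sub, map_smul, LinearMap.sub_apply, LinearMap.smul_apply,
      LinearMap.smulRight_apply, e1]
    module
  have hT1 : ∀ p, l1 p ≠ 0 → ∀ s : ℝ, gauge K p ≤ gauge K (p + s • W p) := by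
    intro p hp s
    have h1 := hV (l0 p • l1 - l1 p • l0) p (by simp; ring) (s * (l1 p)⁻¹)
    rwa [hWV, smul_smul, mul_assoc, inv_mul_cancel₀ hp, mul_one] at h1
  have hWc := W.continuous_of_finiteDimensional
  have hT : ∀ (p : X) (s : ℝ), gauge K p ≤ gauge K (p + s • W p) := by
    intro p s
    by_cases hp : l1 p = 0
    · have c1 : Continuous fun t : ℝ => gauge K (p + t • p1) := by fun_prop
      have c2 : Continuous fun t : ℝ => gauge K ((p + t • p1) + s • W (p + t • p1)) := by fun_prop
      have t1 := (c1.tendsto 0).mono_left (nhdsWithin_le_nhds (s := {0}ᶜ))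
      have t2 := (c2.tendsto 0).mono_left (nhdsWithin_le_nhds (s := {0}ᶜ))
      have := le_of_tendsto_of_tendsto t1 t2 (by
        filter_upwards [self_mem_nhdsWithin] with t ht
        exact hT1 _ (by simpa [hp, h11] using ht) s)
      simpa using this
    · exact hT1 p hp s
  have htrW := tqf_trace (gauge K) hadd hsmul hpos hnn K hKc hmem p0 p1 l0 l1 h00 h01 h10 h11 hx W hT
  have ht0 := htr l0
  have ht1 := htr l1
  rw [htr'] at ht0 ht1
  simp only [W, LinearMap.sub_apply, LinearMap.smulRight_apply, map_sub, map_smul, h00, h01,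
    smul_eq_mul] at htrW
  have hR11 : R l1 p1 = 0 := by
    have a0 : l0 (R l1 p1) = 0 := by linarith
    have a1 : l1 (R l1 p1) = 0 := by simpa [hR10] using ht1
    rw [hx (R l1 p1), a0, a1]; simp
  have hR1 : R l1 = 0 := by
    ext x
    rw [hx x]; simp [hR10, hR11]
  have hW : W = - R l0 := by
    simp [W, hR11]
  intro l p _
  have hl : l = l p0 • l0 + l p1 • l1 := by
    ext x
    conv_lhs => rw [hx x]
    simp; ring
  have hRl : R l = -(l p0) • W := by
    conv_lhs => rw [hl]
    simp [hR1, hW]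
  refine tqf_deriv (gauge K) hadd hsmul (R l) (fun q s => ?_) p
  have := hT q (s * -(l p0))
  rwa [hRl, LinearMap.smul_apply, smul_smul]
end
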